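/- arXiv:2005.05200 — 3 statements merged into one kernel-verified Lean document; each statement's English description precedes it below -/
import Mathlib

section
/- Let A, A₀ > 0 and for ε ∈ (0,1) set c̃_ε = −(A − A₀)/log ε. Let w̃_{A,ε} be the local solution of the shooting problem −c̃_ε w' = (ε + Φ_ε²(w)) w'' + Φ_ε(w)(1 − Φ_ε²(w)) √(ε + Φ_ε²(w)) for x < 0 with w(0) = 0 and w'(0) = A₀, continued as long as it stays bounded. Then, as ε → 0, w̃_{A,ε} converges to the steady state w̃_A locally uniformly on (−log((1+A)/(1−A)), 0] if 0 < A < 1, and locally uniformly on (−∞, 0] if A > 1. -/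
open Set Filter Topology MeasureTheory

/-- `U_ε(φ) = 2∫₀^φ √(ε + s²) ds` (equation (1.3)); its inverse is `Φ_ε`. -/
noncomputable def Ureg (ε φ : ℝ) : ℝ := 2 * ∫ s in (0:ℝ)..φ, Real.sqrt (ε + s ^ 2)

/-- `w` (with derivative `w1`) solves the travelling-wave ODE
`-c w' = (ε + Φ_ε²(w)) w'' + Φ_ε(w)(1 - Φ_ε²(w)) √(ε + Φ_ε²(w))` on the set `s`. -/
def ShootODE (ε c : ℝ) (Φ : ℝ → ℝ) (s : Set ℝ) (w w1 : ℝ → ℝ) : Prop :=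
  ∀ x ∈ s, HasDerivWithinAt w (w1 x) s x ∧
    ∃ w2 : ℝ, HasDerivWithinAt w1 w2 s x ∧
      -c * w1 x = (ε + Φ (w x) ^ 2) * w2
        + Φ (w x) * (1 - Φ (w x) ^ 2) * Real.sqrt (ε + Φ (w x) ^ 2)

theorem hasDerivAt_Ureg (ε φ : ℝ) :
    HasDerivAt (Ureg ε) (2 * √(ε + φ ^ 2)) φ := by
  have hc : Continuous fun s : ℝ => √(ε + s ^ 2) := by fun_prop
  exact (hc.integral_hasStrictDerivAt 0 φ).hasDerivAt.const_mul 2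

theorem strictMono_Ureg {ε : ℝ} (hε : 0 < ε) : StrictMono (Ureg ε) :=
  strictMono_of_hasDerivAt_pos (fun φ => hasDerivAt_Ureg ε φ) fun φ => by positivity

theorem Ureg_zero (ε : ℝ) : Ureg ε 0 = 0 := by simp [Ureg]

theorem Ureg_neg (ε φ : ℝ) : Ureg ε (-φ) = -Ureg ε φ := by
  have h := intervalIntegral.integral_comp_neg (a := 0) (b := φ) fun s : ℝ => √(ε + s ^ 2)
  simp only [neg_sq, neg_zero] at h
  rw [Ureg, Ureg, h, intervalIntegral.integral_symm]
  ring

theorem sqrt_add_sq_le {ε : ℝ} (hε : 0 < ε) {s : ℝ} (hs : 0 ≤ s) : √(ε + s ^ 2) ≤ √ε + s := by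
  rw [Real.sqrt_le_left (by positivity)]
  nlinarith [Real.sq_sqrt hε.le, mul_nonneg (Real.sqrt_nonneg ε) hs]

theorem sq_le_Ureg {ε : ℝ} (hε : 0 < ε) {φ : ℝ} (hφ : 0 ≤ φ) : φ ^ 2 ≤ Ureg ε φ := by
  have h : ∫ s in (0 : ℝ)..φ, s ≤ ∫ s in (0 : ℝ)..φ, √(ε + s ^ 2) := by
    apply intervalIntegral.integral_mono_on hφ
    · exact continuous_id.intervalIntegrable _ _
    · exact Continuous.intervalIntegrable (by fun_prop) _ _
    · intro s hs
      exact Real.le_sqrt_of_sq_le (by linarith)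
  rw [integral_id] at h
  rw [Ureg]
  linarith

theorem Ureg_le {ε : ℝ} (hε : 0 < ε) {φ : ℝ} (hφ : 0 ≤ φ) :
    Ureg ε φ ≤ φ ^ 2 + 2 * √ε * φ := by
  have h : ∫ s in (0 : ℝ)..φ, √(ε + s ^ 2) ≤ ∫ s in (0 : ℝ)..φ, (√ε + s) := by
    apply intervalIntegral.integral_mono_on hφ
    · exact Continuous.intervalIntegrable (by fun_prop) _ _
    · exact Continuous.intervalIntegrable (by fun_prop) _ _
    · intro s hs
      exact sqrt_add_sq_le hε hs.1
  rw [intervalIntegral.integral_add (by simp) (by simp), integral_id] at h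
  simp only [intervalIntegral.integral_const, smul_eq_mul] at h
  rw [Ureg]
  linarith

theorem abs_Ureg (ε φ : ℝ) (hε : 0 < ε) : |Ureg ε φ| = Ureg ε |φ| := by
  have key : ∀ ψ : ℝ, 0 ≤ ψ → 0 ≤ Ureg ε ψ := fun ψ hψ => (sq_nonneg ψ).trans (sq_le_Ureg hε hψ)
  rcases le_total 0 φ with h | h
  · rw [abs_of_nonneg h, abs_of_nonneg (key φ h)]
  · rw [abs_of_nonpos h, Ureg_neg, abs_of_nonpos]
    have := key (-φ) (by linarith)
    rw [Ureg_neg] at this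
    linarith

theorem hasDerivAt_inverse_Ureg {ε : ℝ} (hε : 0 < ε) {Φ : ℝ → ℝ}
    (hl : Function.LeftInverse Φ (Ureg ε)) (hr : Function.RightInverse Φ (Ureg ε)) (u : ℝ) :
    HasDerivAt Φ (2 * √(ε + Φ u ^ 2))⁻¹ u := by
  have hmono : Monotone Φ := fun a b hab =>
    (strictMono_Ureg hε).le_iff_le.1 (by rwa [hr a, hr b])
  exact (hasDerivAt_Ureg ε (Φ u)).of_local_left_inverse
    (hmono.continuous_of_surjective hl.surjective).continuousAt (by positivity)
    (Eventually.of_forall hr)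

/-- The fraction of the total slope jump across the transition layer already made at `φ`. -/
noncomputable def layerFraction (ε φ : ℝ) : ℝ := 2 * Real.arsinh (φ / √ε) / Real.log ε

/-- The reaction term of the first-order system equivalent to the shooting equation. -/
noncomputable def reaction (ε φ : ℝ) : ℝ := -(φ * (1 - φ ^ 2) / √(ε + φ ^ 2))

theorem hasDerivAt_layerFraction_comp {ε : ℝ} (hε : 0 < ε) {Φ : ℝ → ℝ}
    (hl : Function.LeftInverse Φ (Ureg ε)) (hr : Function.RightInverse Φ (Ureg ε)) (u : ℝ) :
    HasDerivAt (fun u => layerFraction ε (Φ u)) (1 / (Real.log ε * (ε + Φ u ^ 2))) u := by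
  have h := ((((hasDerivAt_inverse_Ureg hε hl hr u).div_const √ε).arsinh).const_mul 2).div_const
    (Real.log ε)
  refine h.congr_deriv ?_
  have h0 : 0 < √ε := Real.sqrt_pos.2 hε
  have h1 : √(1 + (Φ u / √ε) ^ 2) = √(ε + Φ u ^ 2) / √ε := by
    rw [← Real.sqrt_div' _ hε.le, div_pow, Real.sq_sqrt hε.le]
    congr 1
    field_simp
  have h2 : 0 < √(ε + Φ u ^ 2) := by positivity
  rw [h1]
  have h3 : ε + Φ u ^ 2 = √(ε + Φ u ^ 2) ^ 2 := (Real.sq_sqrt (by positivity)).symm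
  rw [smul_eq_mul]
  conv_rhs => rw [h3]
  rcases eq_or_ne (Real.log ε) 0 with h4 | h4
  · simp [h4]
  · field_simp

theorem arsinh_div_sqrt {ε : ℝ} (hε : 0 < ε) {a : ℝ} (ha : 0 ≤ a) :
    Real.arsinh (a / √ε) = Real.log (a + √(ε + a ^ 2)) - Real.log ε / 2 := by
  have h0 : 0 < √ε := Real.sqrt_pos.2 hε
  have h1 : √(1 + (a / √ε) ^ 2) = √(ε + a ^ 2) / √ε := by
    rw [← Real.sqrt_div' _ hε.le, div_pow, Real.sq_sqrt hε.le]
    congr 1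
    field_simp
  rw [Real.arsinh, h1, ← add_div, Real.log_div (by positivity) h0.ne', Real.log_sqrt hε.le]

theorem abs_layerFraction {ε : ℝ} (hε : 0 < ε) (hε1 : ε < 1) (φ : ℝ) :
    |layerFraction ε φ| = 1 + 2 * Real.log (|φ| + √(ε + φ ^ 2)) / -Real.log ε := by
  have hlog : Real.log ε < 0 := Real.log_neg hε hε1
  have h0 : 0 < √ε := Real.sqrt_pos.2 hε
  have h1 : |Real.arsinh (φ / √ε)| = Real.arsinh (|φ| / √ε) := by
    rcases le_total 0 φ with h | h
    · rw [abs_of_nonneg h, abs_of_nonneg (Real.arsinh_nonneg_iff.2 (by positivity))]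
    · rw [abs_of_nonpos h, neg_div, Real.arsinh_neg, abs_of_nonpos]
      exact Real.arsinh_nonpos_iff.2 (div_nonpos_of_nonpos_of_nonneg h h0.le)
  rw [layerFraction, abs_div, abs_mul, h1, abs_of_neg hlog, abs_two,
    arsinh_div_sqrt hε (abs_nonneg φ), sq_abs]
  have h2 : Real.log ε ≠ 0 := hlog.ne
  field_simp
  ring

theorem layerFraction_nonneg {ε : ℝ} (hε : 0 < ε) (hε1 : ε < 1) {φ : ℝ} (hφ : φ ≤ 0) :
    0 ≤ layerFraction ε φ := by
  apply div_nonneg_of_nonpos _ (Real.log_neg hε hε1).le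
  have := Real.arsinh_nonpos_iff.2 (div_nonpos_of_nonpos_of_nonneg hφ (Real.sqrt_nonneg ε))
  linarith

theorem abs_reaction_le {ε : ℝ} (hε : 0 < ε) (φ : ℝ) : |reaction ε φ| ≤ 1 + φ ^ 2 := by
  have h2 : 0 < √(ε + φ ^ 2) := by positivity
  have h3 : |φ| ≤ √(ε + φ ^ 2) := Real.abs_le_sqrt (by linarith)
  rw [reaction, abs_neg, abs_div, abs_mul, abs_of_pos h2, div_le_iff₀ h2, mul_comm]
  have h4 : |1 - φ ^ 2| ≤ 1 + φ ^ 2 := by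
    rw [abs_le]; constructor <;> nlinarith [sq_nonneg φ]
  gcongr

theorem abs_reaction_sub_le {ε : ℝ} (hε : 0 < ε) {φ k : ℝ} (hk : 0 < k) (hφ : φ ≤ -k) :
    |reaction ε φ - 1 - Ureg ε φ| ≤ √ε / k * (1 + φ ^ 2) + 2 * √ε * |φ| := by
  have h2 : 0 < √(ε + φ ^ 2) := by positivity
  obtain ⟨a, rfl⟩ : ∃ a, φ = -a := ⟨-φ, by ring⟩
  have ha : k ≤ a := by linarith
  have ha0 : 0 < a := by linarith
  have h5 := sqrt_add_sq_le hε ha0.le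
  have h6 := sq_le_Ureg hε ha0.le
  have h7 := Ureg_le hε ha0.le
  have h8 : a ≤ √(ε + a ^ 2) := Real.le_sqrt_of_sq_le (by linarith)
  rw [reaction, Ureg_neg, abs_neg, abs_of_pos ha0]
  rw [neg_sq] at *
  set S := √(ε + a ^ 2)
  have e : -(-a * (1 - a ^ 2) / S) - 1 - -Ureg ε a
      = -((S - a) / S * (1 - a ^ 2)) + (Ureg ε a - a ^ 2) := by
    field_simp
    ring
  rw [e]
  have h9 : (S - a) / S ≤ √ε / k := by
    apply div_le_div₀ <;> linarith [Real.sqrt_nonneg ε]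
  have h10 : 0 ≤ (S - a) / S := div_nonneg (by linarith) h2.le
  have h4 : |1 - a ^ 2| ≤ 1 + a ^ 2 := by
    rw [abs_le]; constructor <;> nlinarith [sq_nonneg a]
  refine (abs_add_le _ _).trans (add_le_add ?_ ?_)
  · rw [abs_neg, abs_mul, abs_of_nonneg h10]
    gcongr
  · rw [abs_le]; constructor <;> linarith [mul_nonneg (Real.sqrt_nonneg ε) ha0.le]

/-- Uniform convergence, as `ε → 0`, of the coefficients of the first-order system on bounded
sets away from zero, together with uniform bounds on bounded sets. -/
theorem eventually_coefficients_close {Φ : ℝ → ℝ → ℝ}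
    (hΦ : ∀ ε > (0:ℝ), Function.LeftInverse (Φ ε) (Ureg ε) ∧
      Function.RightInverse (Φ ε) (Ureg ε)) {R γ κ : ℝ} (hγ : 0 < γ) (hκ : 0 < κ) :
    ∀ᶠ ε in 𝓝[>] (0 : ℝ), ∀ u, |u| ≤ R →
      (u ≤ 0 → 0 ≤ layerFraction ε (Φ ε u)) ∧ |layerFraction ε (Φ ε u)| ≤ 1 + γ ∧
      |reaction ε (Φ ε u)| ≤ 1 + R ∧
      (u ≤ -κ → |layerFraction ε (Φ ε u) - 1| ≤ γ ∧ |reaction ε (Φ ε u) - 1 - u| ≤ γ) := by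
  set k := √(κ / 2) with hk
  have hk0 : 0 < k := by positivity
  have hlog := tendsto_neg_atBot_atTop.comp Real.tendsto_log_nhdsGT_zero
  have hlog' := hlog.const_mul_atTop hγ
  have hsq : Tendsto (fun ε : ℝ => √ε) (𝓝[>] 0) (𝓝 0) := by
    have : Tendsto (fun ε : ℝ => √ε) (𝓝 0) (𝓝 √0) := Real.continuous_sqrt.tendsto 0
    rw [Real.sqrt_zero] at this
    exact this.mono_left nhdsWithin_le_nhds
  have hA : Tendsto (fun ε : ℝ => 2 * √ε * √R) (𝓝[>] 0) (𝓝 0) := by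
    simpa using (hsq.const_mul 2).mul_const √R
  have hB : Tendsto (fun ε : ℝ => √ε / k * (1 + R) + 2 * √ε * √R) (𝓝[>] 0) (𝓝 0) := by
    simpa using ((hsq.div_const k).mul_const (1 + R)).add hA
  filter_upwards [self_mem_nhdsWithin, Ioo_mem_nhdsGT (zero_lt_one' ℝ),
    hlog'.eventually_ge_atTop (2 * Real.log (2 * √R + 1)),
    hlog'.eventually_ge_atTop (-(2 * Real.log k)),
    hA.eventually_le_const (show (0 : ℝ) < κ / 2 by positivity),
    hB.eventually_le_const hγ] with ε hε hε1 h1 h2 h3 h4 u hu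
  obtain ⟨-, hr⟩ := hΦ ε hε
  simp only [Function.comp_apply] at h1 h2
  have hε0 : (0 : ℝ) < ε := hε
  have hL : 0 < -Real.log ε := neg_pos.2 (Real.log_neg hε hε1.2)
  set φ := Φ ε u with hφ
  have hU : Ureg ε φ = u := hr u
  have hsgn : u ≤ 0 → φ ≤ 0 := fun h => by
    rw [← (strictMono_Ureg hε0).le_iff_le, hU, Ureg_zero]; exact h
  have habs := abs_Ureg ε φ hε
  rw [hU] at habs
  have b1 := sq_le_Ureg hε (abs_nonneg φ)
  have b2 := Ureg_le hε (abs_nonneg φ)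
  rw [← habs] at b1 b2
  have b3 : |φ| ≤ √R := Real.le_sqrt_of_sq_le (b1.trans hu)
  have b4 : φ ^ 2 ≤ R := by rw [← sq_abs]; exact b1.trans hu
  have b5 : √(ε + φ ^ 2) ≤ 1 + |φ| := by
    rw [← sq_abs]
    refine (sqrt_add_sq_le hε0 (abs_nonneg φ)).trans ?_
    gcongr
    exact Real.sqrt_le_one.2 hε1.2.le
  have b6 : 0 < √(ε + φ ^ 2) := by positivity
  have hup : |layerFraction ε φ| ≤ 1 + γ := by
    rw [abs_layerFraction hε hε1.2]
    gcongr
    rw [div_le_iff₀ hL]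
    have : Real.log (|φ| + √(ε + φ ^ 2)) ≤ Real.log (2 * √R + 1) :=
      Real.log_le_log (by positivity) (by linarith)
    linarith
  refine ⟨fun h => layerFraction_nonneg hε hε1.2 (hsgn h), hup,
    (abs_reaction_le hε0 φ).trans (by linarith), fun h => ?_⟩
  have hu0 : u ≤ 0 := by linarith
  have hk1 : k ≤ |φ| := by
    rw [hk, Real.sqrt_le_left (abs_nonneg φ)]
    have : κ ≤ |u| := by rw [abs_of_nonpos hu0]; linarith
    have : 2 * √ε * |φ| ≤ 2 * √ε * √R := by gcongr
    linarith
  constructor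
  · have h0 := layerFraction_nonneg hε hε1.2 (hsgn hu0)
    have hlow : 1 - γ ≤ |layerFraction ε φ| := by
      rw [abs_layerFraction hε hε1.2]
      have : -γ ≤ 2 * Real.log (|φ| + √(ε + φ ^ 2)) / -Real.log ε := by
        rw [le_div_iff₀ hL]
        have : Real.log k ≤ Real.log (|φ| + √(ε + φ ^ 2)) := by
          gcongr
          linarith
        linarith
      linarith
    rw [abs_of_nonneg h0] at hup hlow
    rw [abs_le]
    constructor <;> linarith
  · rw [abs_of_nonpos (hsgn hu0)] at hk1
    have := abs_reaction_sub_le hε0 hk0 (φ := φ) (by linarith)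
    rw [hU] at this
    refine this.trans (le_trans ?_ h4)
    gcongr

theorem norm_le_of_perturbed_hyperbolic_system {x y g h : ℝ → ℝ} {a b D : ℝ}
    (hx : ∀ t ∈ Icc a b, HasDerivWithinAt x (-y t - g t) (Icc a b) t)
    (hy : ∀ t ∈ Icc a b, HasDerivWithinAt y (-x t - h t) (Icc a b) t)
    (hg : ∀ t ∈ Icc a b, |g t| ≤ D) (hh : ∀ t ∈ Icc a b, |h t| ≤ D) :
    ∀ t ∈ Icc a b,
      ‖(x t, y t)‖ ≤ ‖(x a, y a)‖ * Real.exp (t - a) + D * (Real.exp (t - a) - 1) := by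
  have hd : ∀ t ∈ Icc a b, HasDerivWithinAt (fun t => (x t, y t)) (-y t - g t, -x t - h t)
      (Icc a b) t := fun t ht => (hx t ht).prodMk (hy t ht)
  intro t ht
  have := norm_le_gronwallBound_of_norm_deriv_right_le (δ := ‖(x a, y a)‖) (K := 1) (ε := D)
    (fun t ht => (hd t ht).continuousWithinAt)
    (fun t ht => (hd t (Ico_subset_Icc_self ht)).mono_of_mem_nhdsWithin (Icc_mem_nhdsGE_of_mem ht))
    le_rfl (fun t ht => ?_) t ht
  · simpa [gronwallBound_of_K_ne_0 one_ne_zero] using this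
  · have ht' := Ico_subset_Icc_self ht
    have h1 : |x t| ≤ ‖(x t, y t)‖ := norm_fst_le (x t, y t)
    have h2 : |y t| ≤ ‖(x t, y t)‖ := norm_snd_le (x t, y t)
    rw [one_mul, Prod.norm_def]
    refine max_le ?_ ?_
    · rw [Real.norm_eq_abs]
      refine (abs_sub _ _).trans ?_
      rw [abs_neg]
      exact add_le_add h2 (hg t ht')
    · rw [Real.norm_eq_abs]
      refine (abs_sub _ _).trans ?_
      rw [abs_neg]
      exact add_le_add h1 (hh t ht')

/-- A uniformly positive initial slope forces `p` below a line of negative slope. -/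
theorem le_neg_mul_of_initial_slope {A A₀ m C τ γ : ℝ} {p q θ F : ℝ → ℝ}
    (hτC : C * τ ≤ m / 4) (hC : 0 ≤ C) (hm : 0 < m) (hmA : 2 * m ≤ A) (hmA₀ : 2 * m ≤ A₀)
    (hγ0 : 0 ≤ γ) (hγ : γ * |A - A₀| ≤ m / 4) (hp0 : p 0 = 0) (hq0 : q 0 = A₀)
    (hp : ∀ t ∈ Icc 0 τ, HasDerivWithinAt p (-(q t + (A - A₀) * θ t)) (Icc 0 τ) t)
    (hq : ∀ t ∈ Icc 0 τ, HasDerivWithinAt q (-F t) (Icc 0 τ) t)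
    (hF : ∀ t ∈ Icc 0 τ, |F t| ≤ C) (hθ : ∀ t ∈ Icc 0 τ, |θ t| ≤ 1 + γ)
    (hθ0 : ∀ t ∈ Icc 0 τ, p t ≤ 0 → 0 ≤ θ t) : ∀ t ∈ Icc 0 τ, p t ≤ -m * t := by
  have hqb : ∀ t ∈ Icc 0 τ, |q t - A₀| ≤ m / 4 := by
    intro t ht
    have := norm_image_sub_le_of_norm_deriv_right_le_segment
      (fun t ht => (hq t ht).continuousWithinAt)
      (fun t ht => (hq t (Ico_subset_Icc_self ht)).mono_of_mem_nhdsWithin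
        (Icc_mem_nhdsGE_of_mem ht))
      (fun t ht => by
        rw [Real.norm_eq_abs, abs_neg]
        exact hF t (Ico_subset_Icc_self ht)) t ht
    rw [Real.norm_eq_abs, hq0, sub_zero] at this
    exact this.trans ((mul_le_mul_of_nonneg_left ht.2 hC).trans hτC)
  refine image_le_of_deriv_right_lt_deriv_boundary (B := fun t => -m * t) (B' := fun _ => -m)
    (fun t ht => (hp t ht).continuousWithinAt)
    (fun t ht => (hp t (Ico_subset_Icc_self ht)).mono_of_mem_nhdsWithin
      (Icc_mem_nhdsGE_of_mem ht)) (by simp [hp0])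
    (fun t => by simpa using (hasDerivAt_id t).const_mul (-m)) fun t ht hpt => ?_
  have ht' := Ico_subset_Icc_self ht
  have h0 := hθ0 t ht' (by rw [hpt]; nlinarith [ht.1])
  have h1 := hθ t ht'
  have h2 := abs_le.1 (hqb t ht')
  rw [abs_of_nonneg h0] at h1
  suffices 2 * m - γ * |A - A₀| ≤ A₀ + (A - A₀) * θ t by linarith
  rcases le_total 0 (A - A₀) with h | h
  · have := mul_nonneg h h0
    have := mul_nonneg hγ0 (abs_nonneg (A - A₀))
    linarith
  · rw [abs_of_nonpos h]
    nlinarith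

theorem abs_sub_lt_of_two_phase_estimate {A A₀ M R S m γ κ₀ η δ₀ δ X τ : ℝ}
    {P Q θ F p q : ℝ → ℝ}
    (hPd : ∀ t, HasDerivAt P (-(Q t + (A - A₀))) t) (hQd : ∀ t, HasDerivAt Q (-(1 + P t)) t)
    (hP0 : P 0 = 0) (hQ0 : Q 0 = A₀) (hS : ∀ t ∈ Icc 0 M, |P t| ≤ S) (hSR : S + η ≤ R)
    (hm0 : 0 < m) (hmA : 2 * m ≤ A) (hmA₀ : 2 * m ≤ A₀) (hR0 : 0 < 1 + R)
    (hRδ₀ : (1 + R) * δ₀ ≤ m / 4) (hκP : ∀ t ∈ Icc δ₀ M, P t ≤ -(2 * κ₀))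
    (hη0 : 0 < η) (hηκ : η ≤ κ₀) (hX1 : 1 ≤ X) (hX : Real.exp M ≤ X) (hδ : 0 < δ)
    (hδη : (3 * |A - A₀| + 2 * (1 + R)) * (Real.exp δ - 1) * X ≤ η / 4)
    (hγ : 0 < γ) (hγ1 : γ ≤ 1) (hγm : γ * |A - A₀| ≤ m / 4)
    (hγη : (1 + |A - A₀|) * γ * X ≤ η / 4)
    (hco : ∀ u, |u| ≤ R → (u ≤ 0 → 0 ≤ θ u) ∧ |θ u| ≤ 1 + γ ∧ |F u| ≤ 1 + R ∧
      (u ≤ -min (m * δ) κ₀ → |θ u - 1| ≤ γ ∧ |F u - 1 - u| ≤ γ))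
    (hτ : τ ∈ Icc 0 M) (hp0 : p 0 = 0) (hq0 : q 0 = A₀)
    (hp : ∀ t ∈ Icc 0 τ, HasDerivWithinAt p (-(q t + (A - A₀) * θ (p t))) (Icc 0 τ) t)
    (hq : ∀ t ∈ Icc 0 τ, HasDerivWithinAt q (-F (p t)) (Icc 0 τ) t)
    (hclose : ∀ t ∈ Icc 0 τ, |p t - P t| ≤ η) : |p τ - P τ| < η := by
  set B := |A - A₀| with hB
  have hB0 : 0 ≤ B := abs_nonneg _
  set D := 3 * B + 2 * (1 + R) with hD
  have hD0 : 0 < D := by positivity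
  have hpR : ∀ t ∈ Icc 0 τ, |p t| ≤ R := by
    intro t ht
    have h1 := hclose t ht
    have h2 := hS t ⟨ht.1, ht.2.trans hτ.2⟩
    have h3 := abs_add_le (p t - P t) (P t)
    rw [sub_add_cancel] at h3
    linarith
  have hx : ∀ t ∈ Icc 0 τ, HasDerivWithinAt (fun t => p t - P t)
      (-(q t - Q t) - (A - A₀) * (θ (p t) - 1)) (Icc 0 τ) t := fun t ht =>
    ((hp t ht).sub (hPd t).hasDerivWithinAt).congr_deriv (by ring)
  have hy : ∀ t ∈ Icc 0 τ, HasDerivWithinAt (fun t => q t - Q t)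
      (-(p t - P t) - (F (p t) - 1 - p t)) (Icc 0 τ) t := fun t ht =>
    ((hq t ht).sub (hQd t).hasDerivWithinAt).congr_deriv (by ring)
  have hg : ∀ t ∈ Icc 0 τ, |(A - A₀) * (θ (p t) - 1)| ≤ D := by
    intro t ht
    have h1 := (hco _ (hpR t ht)).2.1
    have h2 : |θ (p t) - 1| ≤ 3 := by
      rw [abs_le] at h1 ⊢; constructor <;> linarith
    rw [abs_mul, hD]
    nlinarith [abs_nonneg (A - A₀)]
  have hh : ∀ t ∈ Icc 0 τ, |F (p t) - 1 - p t| ≤ D := by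
    intro t ht
    have h1 := abs_le.1 (hco _ (hpR t ht)).2.2.1
    have h2 := abs_le.1 (hpR t ht)
    rw [abs_le]; constructor <;> linarith
  have hinit : ∀ t ∈ Icc 0 τ, t ≤ δ →
      ‖(p t - P t, q t - Q t)‖ ≤ D * (Real.exp δ - 1) := by
    intro t ht htδ
    have := norm_le_of_perturbed_hyperbolic_system hx hy hg hh t ht
    simp only [hp0, hP0, hq0, hQ0, sub_self, sub_zero, Prod.mk_zero_zero, norm_zero, zero_mul,
      zero_add] at this
    refine this.trans ?_
    gcongr
  have hfst : |p τ - P τ| ≤ ‖(p τ - P τ, q τ - Q τ)‖ := norm_fst_le (p τ - P τ, q τ - Q τ)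
  have hδ1 : 0 ≤ D * (Real.exp δ - 1) :=
    mul_nonneg hD0.le (by linarith [Real.one_le_exp hδ.le])
  refine hfst.trans_lt ?_
  rcases le_or_gt τ δ with hτδ | hτδ
  · have h1 := hinit τ ⟨hτ.1, le_rfl⟩ hτδ
    nlinarith
  have hsub : Icc δ τ ⊆ Icc 0 τ := Icc_subset_Icc_left hδ.le
  have hpκ : ∀ t ∈ Icc δ τ, p t ≤ -min (m * δ) κ₀ := by
    intro t ht
    rcases le_total t δ₀ with htδ | htδ
    · have hs : Icc 0 t ⊆ Icc 0 τ := Icc_subset_Icc_right ht.2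
      have := le_neg_mul_of_initial_slope (θ := fun t => θ (p t)) (F := fun t => F (p t))
        ((mul_le_mul_of_nonneg_left htδ hR0.le).trans hRδ₀) hR0.le hm0 hmA hmA₀ hγ.le hγm hp0 hq0
        (fun r hr => (hp r (hs hr)).mono hs) (fun r hr => (hq r (hs hr)).mono hs)
        (fun r hr => (hco _ (hpR r (hs hr))).2.2.1) (fun r hr => (hco _ (hpR r (hs hr))).2.1)
        (fun r hr => (hco _ (hpR r (hs hr))).1) t ⟨hδ.le.trans ht.1, le_rfl⟩
      have h2 := mul_le_mul_of_nonneg_left ht.1 hm0.le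
      linarith [min_le_left (m * δ) κ₀]
    · have h1 := hκP t ⟨htδ, ht.2.trans hτ.2⟩
      have h2 := abs_le.1 (hclose t (hsub ht))
      have h3 : p t - P t ≤ η := h2.2
      linarith [min_le_right (m * δ) κ₀]
  have hγB : γ ≤ (1 + B) * γ := by nlinarith
  have hfin := norm_le_of_perturbed_hyperbolic_system (D := (1 + B) * γ)
    (fun t ht => (hx t (hsub ht)).mono hsub) (fun t ht => (hy t (hsub ht)).mono hsub)
    (fun t ht => by
      have := ((hco _ (hpR t (hsub ht))).2.2.2 (hpκ t ht)).1
      rw [abs_mul]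
      nlinarith [abs_nonneg (A - A₀)])
    (fun t ht => (((hco _ (hpR t (hsub ht))).2.2.2 (hpκ t ht)).2).trans hγB) τ ⟨hτδ.le, le_rfl⟩
  have h1 := hinit δ ⟨hδ.le, hτδ.le⟩ le_rfl
  have h2 : Real.exp (τ - δ) ≤ X :=
    (Real.exp_le_exp.2 (by linarith [hτ.2])).trans hX
  calc _ ≤ _ := hfin
    _ ≤ D * (Real.exp δ - 1) * X + (1 + B) * γ * X := by
      gcongr
      linarith
    _ < η := by linarith

theorem exists_stability_margin {A A₀ M η₀ : ℝ} (hA : 0 < A) (hA₀ : 0 < A₀)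
    (hP : ∀ t ∈ Ioc 0 M, Real.cosh t - 1 - A * Real.sinh t < 0) (hη₀ : 0 < η₀) :
    ∃ R γ κ η : ℝ, 0 < γ ∧ 0 < κ ∧ 0 < η ∧ η ≤ η₀ ∧
      (∀ t ∈ Icc 0 M, |Real.cosh t - 1 - A * Real.sinh t| + η ≤ R) ∧
      ∀ θ F : ℝ → ℝ,
      (∀ u, |u| ≤ R → (u ≤ 0 → 0 ≤ θ u) ∧ |θ u| ≤ 1 + γ ∧ |F u| ≤ 1 + R ∧
        (u ≤ -κ → |θ u - 1| ≤ γ ∧ |F u - 1 - u| ≤ γ)) →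
      ∀ τ ∈ Icc 0 M, ∀ p q : ℝ → ℝ, p 0 = 0 → q 0 = A₀ →
      (∀ t ∈ Icc 0 τ, HasDerivWithinAt p (-(q t + (A - A₀) * θ (p t))) (Icc 0 τ) t) →
      (∀ t ∈ Icc 0 τ, HasDerivWithinAt q (-F (p t)) (Icc 0 τ) t) →
      (∀ t ∈ Icc 0 τ, |p t - (Real.cosh t - 1 - A * Real.sinh t)| ≤ η) →
      |p τ - (Real.cosh τ - 1 - A * Real.sinh τ)| < η := by
  set P : ℝ → ℝ := fun t => Real.cosh t - 1 - A * Real.sinh t with hPdef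
  set Q : ℝ → ℝ := fun t => A * Real.cosh t - Real.sinh t - (A - A₀) with hQdef
  have hPc : Continuous P := by fun_prop
  have hPd : ∀ t, HasDerivAt P (-(Q t + (A - A₀))) t := fun t =>
    (((Real.hasDerivAt_cosh t).sub_const 1).sub ((Real.hasDerivAt_sinh t).const_mul A)).congr_deriv
      (by simp only [hQdef]; ring)
  have hQd : ∀ t, HasDerivAt Q (-(1 + P t)) t := fun t =>
    ((((Real.hasDerivAt_cosh t).const_mul A).sub (Real.hasDerivAt_sinh t)).sub_const
      (A - A₀)).congr_deriv (by simp only [hPdef]; ring)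
  have hP0 : P 0 = 0 := by simp [hPdef]
  have hQ0 : Q 0 = A₀ := by simp [hQdef]
  obtain ⟨S, hS⟩ := (isCompact_Icc (a := (0 : ℝ)) (b := M)).exists_bound_of_continuousOn
    hPc.continuousOn
  set R := |S| + 1 with hR
  set m := min A A₀ / 2 with hm
  have hm0 : 0 < m := by have := lt_min hA hA₀; positivity
  have hmA : 2 * m ≤ A := by linarith [min_le_left A A₀]
  have hmA₀ : 2 * m ≤ A₀ := by linarith [min_le_right A A₀]
  have hR0 : 0 < 1 + R := by positivity
  set δ₀ := m / 4 / (1 + R) with hδ₀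
  have hδ₀0 : 0 < δ₀ := by positivity
  have hRδ₀ : (1 + R) * δ₀ ≤ m / 4 := by rw [hδ₀]; field_simp; rfl
  obtain ⟨κ₀, hκ₀, hκP⟩ : ∃ κ₀ > 0, ∀ t ∈ Icc δ₀ M, P t ≤ -(2 * κ₀) := by
    rcases (Icc δ₀ M).eq_empty_or_nonempty with h | h
    · exact ⟨1, one_pos, by simp [h]⟩
    · obtain ⟨t₀, ht₀, hmax⟩ := isCompact_Icc.exists_isMaxOn h hPc.continuousOn
      have := hP t₀ ⟨hδ₀0.trans_le ht₀.1, ht₀.2⟩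
      exact ⟨-P t₀ / 2, by simp only [hPdef]; linarith, fun t ht => by linarith [isMaxOn_iff.1 hmax t ht]⟩
  set η := min η₀ (min κ₀ 1) with hη
  have hη0 : 0 < η := by positivity
  have hηκ : η ≤ κ₀ := (min_le_right _ _).trans (min_le_left _ _)
  have hη1 : η ≤ 1 := (min_le_right _ _).trans (min_le_right _ _)
  set B := |A - A₀| with hB
  have hB0 : 0 ≤ B := abs_nonneg _
  set D := 3 * B + 2 * (1 + R) with hD
  have hD0 : 0 < D := by positivity
  set X := Real.exp |M| with hX
  have hX1 : 1 ≤ X := Real.one_le_exp (abs_nonneg M)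
  obtain ⟨δ, hδ, hδη⟩ : ∃ δ > 0, D * (Real.exp δ - 1) * X ≤ η / 4 := by
    have hc : Tendsto (fun δ : ℝ => D * (Real.exp δ - 1) * X) (𝓝[>] 0) (𝓝 0) := by
      have : Continuous fun δ : ℝ => D * (Real.exp δ - 1) * X := by fun_prop
      have := this.tendsto 0
      simp only [Real.exp_zero, sub_self, mul_zero, zero_mul] at this
      exact this.mono_left nhdsWithin_le_nhds
    obtain ⟨δ, h1, h2⟩ := ((hc.eventually_le_const (show (0 : ℝ) < η / 4 by positivity)).and
      self_mem_nhdsWithin).exists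
    exact ⟨δ, h2, h1⟩
  obtain ⟨γ, hγ, hγ1, hγm, hγη⟩ : ∃ γ > 0, γ ≤ 1 ∧ γ * B ≤ m / 4 ∧
      (1 + B) * γ * X ≤ η / 4 := by
    refine ⟨min 1 (min (m / 4 / (1 + B)) (η / 4 / ((1 + B) * X))), by positivity,
      min_le_left _ _, ?_, ?_⟩
    · have h1 : min 1 (min (m / 4 / (1 + B)) (η / 4 / ((1 + B) * X))) ≤ m / 4 / (1 + B) :=
        (min_le_right _ _).trans (min_le_left _ _)
      rw [le_div_iff₀ (by positivity)] at h1
      have h2 : 0 < min 1 (min (m / 4 / (1 + B)) (η / 4 / ((1 + B) * X))) := by positivity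
      linarith
    · have h1 : min 1 (min (m / 4 / (1 + B)) (η / 4 / ((1 + B) * X))) ≤
        η / 4 / ((1 + B) * X) := (min_le_right _ _).trans (min_le_right _ _)
      rw [le_div_iff₀ (by positivity)] at h1
      linarith
  refine ⟨R, γ, min (m * δ) κ₀, η, hγ, by positivity, hη0, min_le_left _ _, fun t ht => ?_, ?_⟩
  · have := hS t ht
    rw [Real.norm_eq_abs] at this
    linarith [le_abs_self S]
  intro θ F hco τ hτ p q hp0 hq0 hp hq hclose
  exact abs_sub_lt_of_two_phase_estimate (P := P) (Q := Q) hPd hQd hP0 hQ0 hS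
    (by linarith [le_abs_self S]) hm0 hmA hmA₀ hR0 hRδ₀ hκP hη0 hηκ hX1
    (Real.exp_le_exp.2 (le_abs_self M)) hδ hδη hγ hγ1 hγm hγη hco hτ hp0 hq0 hp hq hclose

theorem steady_state_neg {A t : ℝ} (ht : 0 < t)
    (h : 1 ≤ A ∨ -Real.log ((1 + A) / (1 - A)) < -t) (hA : 0 < A) :
    Real.cosh t - 1 - A * Real.sinh t < 0 := by
  have hs : 0 < Real.sinh t := Real.sinh_pos_iff.2 ht
  by_cases hA1 : 1 ≤ A
  · have h1 := Real.cosh_sub_sinh t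
    have h2 : Real.exp (-t) < 1 := Real.exp_lt_one_iff.2 (by linarith)
    nlinarith
  · have h1 : t < Real.log ((1 + A) / (1 - A)) := by
      have := h.resolve_left hA1
      linarith
    push Not at hA1
    have hA2 : 0 < 1 - A := by linarith
    rw [Real.lt_log_iff_exp_lt (by positivity), lt_div_iff₀ hA2] at h1
    have hE : 1 < Real.exp t := Real.one_lt_exp_iff.2 ht
    rw [Real.cosh_eq, Real.sinh_eq, Real.exp_neg]
    have h2 : (Real.exp t + (Real.exp t)⁻¹) / 2 - 1 - A * ((Real.exp t - (Real.exp t)⁻¹) / 2)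
        = (Real.exp t - 1) * (Real.exp t * (1 - A) - (1 + A)) / (2 * Real.exp t) := by
      field_simp
      ring
    rw [h2]
    exact div_neg_of_neg_of_pos (mul_neg_of_pos_of_neg (by linarith) (by linarith)) (by positivity)

/-- A solution of the shooting equation turns into a first-order system with bounded right-hand
side once the slope is corrected by the contribution of the transition layer. -/
theorem ShootODE.hasDerivWithinAt_corrected {ε a : ℝ} (hε : 0 < ε) {Φ : ℝ → ℝ}
    (hl : Function.LeftInverse Φ (Ureg ε)) (hr : Function.RightInverse Φ (Ureg ε))
    {s : Set ℝ} {w w1 : ℝ → ℝ} (h : ShootODE ε (-a / Real.log ε) Φ s w w1) {x : ℝ}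
    (hx : x ∈ s) :
    HasDerivWithinAt (fun x => w1 x - a * layerFraction ε (Φ (w x)))
      (reaction ε (Φ (w x))) s x := by
  obtain ⟨hw, w2, hw1, heq⟩ := h x hx
  refine (hw1.sub (((hasDerivAt_layerFraction_comp hε hl hr (w x)).comp_hasDerivWithinAt x
    hw).const_mul a)).congr_deriv ?_
  have hS : 0 < √(ε + Φ (w x) ^ 2) := by positivity
  have hS2 : ε + Φ (w x) ^ 2 = √(ε + Φ (w x) ^ 2) ^ 2 := (Real.sq_sqrt (by positivity)).symm
  have hE : 0 < ε + Φ (w x) ^ 2 := by positivity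
  have h1 : w2 = (a / Real.log ε * w1 x
      - Φ (w x) * (1 - Φ (w x) ^ 2) * √(ε + Φ (w x) ^ 2)) / (ε + Φ (w x) ^ 2) := by
    rw [eq_div_iff hE.ne']
    linear_combination -heq
  have h2 : reaction ε (Φ (w x))
      = -(Φ (w x) * (1 - Φ (w x) ^ 2) * √(ε + Φ (w x) ^ 2)) / (ε + Φ (w x) ^ 2) := by
    rw [reaction]
    conv_rhs => rw [hS2]
    rw [Real.sqrt_sq hS.le]
    field_simp
  rw [h1, h2]
  rcases eq_or_ne (Real.log ε) 0 with h4 | h4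
  · simp [h4]
  · field_simp
    ring

/-- A continuity argument: a continuous function starting below `η` at the right endpoint that
improves every bound `≤ η` to `< η` stays below `η`. -/
theorem lt_of_improves_bound {e : ℝ → ℝ} {x b η : ℝ} (hxb : x ≤ b)
    (he : ContinuousOn e (Icc x b)) (hb : e b < η)
    (himp : ∀ y ∈ Icc x b, (∀ z ∈ Icc y b, e z ≤ η) → e y < η) : e x < η := by
  by_contra! hx
  have hcross : ∀ y ∈ Icc x b, η ≤ e y → ∃ z ∈ Icc y b, e z = η := fun y hy hey =>
    intermediate_value_Icc' hy.2 (he.mono (Icc_subset_Icc_left hy.1)) ⟨hb.le, hey⟩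
  have hcpt : IsCompact (Icc x b ∩ e ⁻¹' {η}) :=
    isCompact_Icc.of_isClosed_subset (he.preimage_isClosed_of_isClosed isClosed_Icc
      isClosed_singleton) inter_subset_left
  obtain ⟨z₀, hz₀, hez₀⟩ := hcross x (left_mem_Icc.2 hxb) hx
  obtain ⟨z, ⟨hz, hez⟩, hmax⟩ := hcpt.exists_isGreatest ⟨z₀, hz₀, hez₀⟩
  refine (himp z hz fun y hy => ?_).ne hez
  by_contra! hy'
  have hyx : y ∈ Icc x b := ⟨hz.1.trans hy.1, hy.2⟩
  obtain ⟨y', hy1, hy2⟩ := hcross y hyx hy'.le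
  have h1 : y' ≤ z := hmax ⟨⟨hyx.1.trans hy1.1, hy1.2⟩, hy2⟩
  have h2 : y' = y := le_antisymm (h1.trans hy.1) hy1.1
  rw [← h2, hy2] at hy'
  exact lt_irrefl _ hy'

/-- Corollary 4.2: the solution `w̃_{A,ε}` of the shooting problem on `x < 0` with velocity
`c̃_ε = -(A - A₀)/log ε`, `w(0) = 0`, `w'(0) = A₀`, continued as long as it stays bounded,
converges locally uniformly to the steady state `w̃_A(x) = min{A sinh x + cosh x - 1, 0}`
on `(-log((1+A)/(1-A)), 0]` if `0 < A < 1` and on `(-∞, 0]` if `A > 1`. -/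
theorem stmt8 (A A₀ : ℝ) (hA : 0 < A) (hA1 : A ≠ 1) (hA₀ : 0 < A₀)
    (Φ : ℝ → ℝ → ℝ)
    (hΦ : ∀ ε > (0:ℝ), Function.LeftInverse (Φ ε) (Ureg ε) ∧
      Function.RightInverse (Φ ε) (Ureg ε))
    (w w1 : ℝ → ℝ → ℝ) (s : ℝ → Set ℝ)
    (hsol : ∀ ε ∈ Set.Ioo (0:ℝ) 1,
      w ε 0 = 0 ∧ w1 ε 0 = A₀ ∧ (0:ℝ) ∈ s ε ∧
      ShootODE ε (-(A - A₀) / Real.log ε) (Φ ε) (s ε) (w ε) (w1 ε) ∧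
      (s ε = Set.Iic 0 ∨
        ∃ L > (0:ℝ), s ε = Set.Ioc (-L) 0 ∧ ¬ BddAbove ((fun x => |w ε x|) '' s ε))) :
    ∀ K : Set ℝ, IsCompact K →
      K ⊆ {x : ℝ | x ≤ 0 ∧ (1 ≤ A ∨ -Real.log ((1 + A) / (1 - A)) < x)} →
      ∀ η > (0:ℝ), ∀ᶠ ε in 𝓝[>] (0:ℝ), K ⊆ s ε ∧
        ∀ x ∈ K, |w ε x - min (A * Real.sinh x + Real.cosh x - 1) 0| < η := by
  intro K hK hKsub η₀ hη₀
  rcases K.eq_empty_or_nonempty with rfl | hKne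
  · simp
  obtain ⟨x₀, hx₀, hmin⟩ := hK.exists_isLeast hKne
  have hx₀s := hKsub hx₀
  have hP : ∀ t ∈ Ioc 0 (-x₀), Real.cosh t - 1 - A * Real.sinh t < 0 := fun t ht =>
    steady_state_neg ht.1 (hx₀s.2.imp_right fun h => by linarith [ht.2]) hA
  obtain ⟨R, γ, κ, η, hγ, hκ, hη, hηη₀, hR, hstep⟩ := exists_stability_margin hA hA₀ hP hη₀
  filter_upwards [eventually_coefficients_close hΦ (R := R) hγ hκ,
    Ioo_mem_nhdsGT (zero_lt_one' ℝ)] with ε hco hε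
  obtain ⟨hw0, hw10, h0s, hode, hs⟩ := hsol ε hε
  obtain ⟨hl, hr⟩ := hΦ ε hε.1
  have hs0 : ∀ x ∈ s ε, ∀ y ∈ Icc x 0, y ∈ s ε := by
    intro x hx y hy
    rcases hs with h | ⟨L, -, h, -⟩
    · rw [h]; exact hy.2
    · rw [h] at hx ⊢; exact ⟨hx.1.trans_le hy.1, hy.2⟩
  have hsle : ∀ x ∈ s ε, x ≤ 0 := by
    intro x hx
    rcases hs with h | ⟨L, -, h, -⟩
    · rwa [h] at hx
    · rw [h] at hx; exact hx.2
  set e : ℝ → ℝ := fun x => |w ε x - (Real.cosh (-x) - 1 - A * Real.sinh (-x))| with he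
  have hwc : ContinuousOn (w ε) (s ε) := fun x hx => (hode x hx).1.continuousWithinAt
  have hec : ContinuousOn e (s ε) := (hwc.sub (by fun_prop)).abs
  have himp : ∀ y ∈ s ε, x₀ ≤ y → (∀ z ∈ Icc y 0, e z ≤ η) → e y < η := by
    intro y hy hx₀y hz
    have hmaps : MapsTo (fun t : ℝ => -t) (Icc 0 (-y)) (s ε) := fun t ht =>
      hs0 y hy _ ⟨by linarith [ht.2], by linarith [ht.1]⟩
    have hneg : ∀ t, HasDerivWithinAt (fun t : ℝ => -t) (-1) (Icc 0 (-y)) t := fun t =>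
      (hasDerivAt_neg t).hasDerivWithinAt
    have := hstep (fun u => layerFraction ε (Φ ε u)) (fun u => reaction ε (Φ ε u)) hco (-y)
      ⟨by linarith [hsle y hy], by linarith⟩ (fun t => w ε (-t))
      (fun t => w1 ε (-t) - (A - A₀) * layerFraction ε (Φ ε (w ε (-t))))
      (by simp [hw0])
      (by
        have : Φ ε 0 = 0 := by rw [← Ureg_zero ε, hl, Ureg_zero]
        simp [hw0, hw10, this, layerFraction])
      (fun t ht => ((hode (-t) (hmaps ht)).1.comp t (hneg t) hmaps).congr_deriv (by ring))
      (fun t ht => ((hode.hasDerivWithinAt_corrected hε.1 hl hr (hmaps ht)).comp t (hneg t)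
        hmaps).congr_deriv (by ring))
      (fun t ht => by
        have := hz (-t) ⟨by linarith [ht.2], by linarith [ht.1]⟩
        simpa only [he, neg_neg] using this)
    simpa only [he, neg_neg] using this
  have hclose : ∀ x ∈ s ε, x₀ ≤ x → e x < η := by
    intro x hx hx₀x
    refine lt_of_improves_bound (hsle x hx) (hec.mono (hs0 x hx)) (by simpa [he, hw0] using hη)
      fun y hy => himp y (hs0 x hx y hy) (hx₀x.trans hy.1)
  have hx₀mem : x₀ ∈ s ε := by
    rcases hs with h | ⟨L, hL, h, hunb⟩
    · rw [h]; exact hx₀s.1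
    · by_contra hx₀L
      rw [h, mem_Ioc, not_and'] at hx₀L
      have hL' := hx₀L hx₀s.1
      refine hunb ⟨R, ?_⟩
      rintro _ ⟨x, hx, rfl⟩
      have hx' := hx
      rw [h] at hx'
      have h1 := hclose x hx (by linarith [hx'.1])
      have h2 := hR (-x) ⟨by linarith [hx'.2], by linarith [hx'.1]⟩
      have h3 := abs_add_le (w ε x - (Real.cosh (-x) - 1 - A * Real.sinh (-x)))
        (Real.cosh (-x) - 1 - A * Real.sinh (-x))
      rw [sub_add_cancel] at h3
      simp only [he] at h1
      show |w ε x| ≤ R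
      linarith
  have hKs : K ⊆ s ε := fun x hx => hs0 x₀ hx₀mem x ⟨hmin hx, (hKsub hx).1⟩
  refine ⟨hKs, fun x hx => ?_⟩
  have h1 := hclose x (hKs hx) (hmin hx)
  have h2 : A * Real.sinh x + Real.cosh x - 1 = Real.cosh (-x) - 1 - A * Real.sinh (-x) := by
    rw [Real.cosh_neg, Real.sinh_neg]; ring
  have h3 : Real.cosh (-x) - 1 - A * Real.sinh (-x) ≤ 0 := by
    rcases (hKsub hx).1.eq_or_lt with rfl | hx0
    · simp
    · exact (hP (-x) ⟨by linarith, by linarith [hmin hx]⟩).le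
  rw [h2, min_eq_left h3]
  exact h1.trans_le hηη₀
end

section
/- Let u be the unique classical solution of the limit problem (2.7), let x_i, x_{i+1} ∈ N₀ be consecutive zeros of u₀ with u > 0 on Q_i = (x_i, x_{i+1}) × (0,T], and define the difference quotient q(x,t) = u(x,t)/(x − x_i) for x ∈ (x_i, x_{i+1}) and t ∈ (0,T]. Then q(x,t) ≥ (t₀/t) q(x,t₀) whenever 0 < t₀ < t ≤ T; consequently the one-sided derivative satisfies u_x(x_i⁺, t) ≥ (t₀/t) u_x(x_i⁺, t₀) for 0 < t₀ < t ≤ T, and in particular u_x(x_i⁺, t) > 0 for all t > t₀ whenever u_x(x_i⁺, t₀) > 0. -/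
open Set Filter MeasureTheory Topology

/-- Partial derivative in `x` of `u(x,t)`. -/
noncomputable def pdx (u : ℝ → ℝ → ℝ) (x t : ℝ) : ℝ := deriv (fun y => u y t) x

/-- Second partial derivative in `x` of `u(x,t)`. -/
noncomputable def pdxx (u : ℝ → ℝ → ℝ) (x t : ℝ) : ℝ := deriv (fun y => pdx u y t) x

/-- Partial derivative in `t` of `u(x,t)`, one-sided at `t = T`. -/
noncomputable def pdtW (T : ℝ) (u : ℝ → ℝ → ℝ) (x t : ℝ) : ℝ :=
  derivWithin (fun s => u x s) (Set.Iic T) t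

/-- `Q = (a,b) × (0,T]`. -/
def QT (a b T : ℝ) : Set (ℝ × ℝ) := Set.Ioo a b ×ˢ Set.Ioc 0 T

/-- `N = N₀ × [0,T]`. -/
def NSet (N₀ : Set ℝ) (T : ℝ) : Set (ℝ × ℝ) := N₀ ×ˢ Set.Icc 0 T

/-- Condition (2.8): `u₀` is continuous, `u₀(a) = -1`, `u₀(b) = 1`, the zeros of `u₀`
form the finite set `N₀ ⊆ (a,b)`, and `u₀` changes sign at each of its zeros. -/
structure InitData (a b : ℝ) (N₀ : Set ℝ) (u₀ : ℝ → ℝ) : Prop where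
  cont : ContinuousOn u₀ (Set.Icc a b)
  bdry_a : u₀ a = -1
  bdry_b : u₀ b = 1
  fin : N₀.Finite
  sub : N₀ ⊆ Set.Ioo a b
  zeros : ∀ x ∈ Set.Icc a b, (u₀ x = 0 ↔ x ∈ N₀)
  sign_change : ∀ x ∈ N₀, ∀ δ > 0,
    ∃ y ∈ Set.Ioo (x - δ) x, ∃ z ∈ Set.Ioo x (x + δ), u₀ y * u₀ z < 0

/-- A classical solution of the limit problem (2.7): `u ∈ C(Q̄)` vanishing exactly on `N`,
`C^{2,1}` on `Q ∖ N`, with boundary values `∓1`, initial value `u₀`, satisfying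
`u_t = |u| u_xx + u(1-|u|)` on `Q ∖ N`. -/
structure IsClassicalSol (a b T : ℝ) (N₀ : Set ℝ) (u₀ : ℝ → ℝ) (u : ℝ → ℝ → ℝ) : Prop where
  cont : ContinuousOn (fun p : ℝ × ℝ => u p.1 p.2) (Set.Icc a b ×ˢ Set.Icc 0 T)
  zero_iff : ∀ x ∈ Set.Icc a b, ∀ t ∈ Set.Icc 0 T, (u x t = 0 ↔ x ∈ N₀)
  diff_x : ∀ p ∈ QT a b T \ NSet N₀ T, DifferentiableAt ℝ (fun y => u y p.2) p.1
  diff_xx : ∀ p ∈ QT a b T \ NSet N₀ T, DifferentiableAt ℝ (fun y => pdx u y p.2) p.1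
  diff_t : ∀ p ∈ QT a b T \ NSet N₀ T,
    DifferentiableWithinAt ℝ (fun s => u p.1 s) (Set.Iic T) p.2
  cont_x : ContinuousOn (fun p : ℝ × ℝ => pdx u p.1 p.2) (QT a b T \ NSet N₀ T)
  cont_xx : ContinuousOn (fun p : ℝ × ℝ => pdxx u p.1 p.2) (QT a b T \ NSet N₀ T)
  cont_t : ContinuousOn (fun p : ℝ × ℝ => pdtW T u p.1 p.2) (QT a b T \ NSet N₀ T)
  bdry_a : ∀ t ∈ Set.Ioc 0 T, u a t = -1
  bdry_b : ∀ t ∈ Set.Ioc 0 T, u b t = 1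
  init : ∀ x ∈ Set.Ioo a b, u x 0 = u₀ x
  pde : ∀ p ∈ QT a b T \ NSet N₀ T,
    pdtW T u p.1 p.2 = |u p.1 p.2| * pdxx u p.1 p.2 + u p.1 p.2 * (1 - |u p.1 p.2|)

/-- The positive part of a continuous function that is differentiable from the right on `(a, b)`
is the integral of the derivative over a set lying between `{0 < w}` and `{0 ≤ w}`; if `w a ≤ 0`
that integral is therefore nonnegative. -/
lemma exists_measurableSet_integral_indicator_deriv_nonneg {w w' : ℝ → ℝ} {a b : ℝ}
    (hab : a ≤ b) (hw : ContinuousOn w (Icc a b)) (hw' : ContinuousOn w' (Icc a b))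
    (hd : ∀ s ∈ Ioo a b, HasDerivWithinAt w (w' s) (Ioi s) s) (ha : w a ≤ 0) :
    ∃ A : Set ℝ, MeasurableSet A ∧ (∀ s ∈ Icc a b, 0 < w s → s ∈ A) ∧
      (∀ s ∈ Icc a b, s ∈ A → 0 ≤ w s) ∧ 0 ≤ ∫ s in a..b, A.indicator w' s := by
  set W : ℝ → ℝ := IccExtend hab ((Icc a b).domRestrict w) with hW
  set W' : ℝ → ℝ := IccExtend hab ((Icc a b).domRestrict w') with hW'
  have hWc : Continuous W := hw.domRestrict.Icc_extend'
  have hWc' : Continuous W' := hw'.domRestrict.Icc_extend'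
  have hWe : ∀ s ∈ Icc a b, W s = w s := fun s hs => by
    rw [hW, IccExtend_of_mem _ _ hs]; rfl
  have hWe' : ∀ s ∈ Icc a b, W' s = w' s := fun s hs => by
    rw [hW', IccExtend_of_mem _ _ hs]; rfl
  set A : Set ℝ := {s | 0 < W s} ∪ ({s | W s = 0} ∩ {s | 0 < W' s}) with hA
  have hAm : MeasurableSet A :=
    (isOpen_lt continuous_const hWc).measurableSet.union
      ((isClosed_eq hWc continuous_const).measurableSet.inter
        (isOpen_lt continuous_const hWc').measurableSet)
  have hmem : ∀ s ∈ Icc a b, (s ∈ A ↔ 0 < w s ∨ (w s = 0 ∧ 0 < w' s)) := fun s hs => by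
    simp only [hA, mem_union, mem_inter_iff, mem_ofPred_eq, hWe s hs, hWe' s hs]
  refine ⟨A, hAm, fun s hs h => (hmem s hs).2 (Or.inl h), fun s hs h => ?_, ?_⟩
  · rcases (hmem s hs).1 h with h | h
    exacts [h.le, h.1.ge]
  have key := intervalIntegral.sub_le_integral_of_hasDeriv_right_of_le (g := fun s => max (w s) 0)
    (g' := A.indicator w') (φ := A.indicator w') hab (hw.sup continuousOn_const) ?_
    ((hw'.integrableOn_Icc).indicator hAm) (fun _ _ => le_rfl)
  · have h0 : max (w a) 0 = 0 := max_eq_right ha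
    have h1 : 0 ≤ max (w b) 0 := le_max_right _ _
    simp only [h0, sub_zero] at key
    exact h1.trans key
  intro s hs
  have hsI := Ioo_subset_Icc_self hs
  have hcont : ContinuousAt w s := hw.continuousAt (Icc_mem_nhds hs.1 hs.2)
  rcases lt_trichotomy (w s) 0 with h | h | h
  · have : s ∉ A := fun hs' => by
      rcases (hmem s hsI).1 hs' with h' | ⟨h', -⟩ <;> linarith
    rw [indicator_of_notMem this]
    refine (hasDerivWithinAt_const s _ (0 : ℝ)).congr_of_eventuallyEq ?_ (max_eq_right h.le)
    filter_upwards [mem_nhdsWithin_of_mem_nhds (hcont.eventually_lt continuousAt_const h)]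
      with y hy using max_eq_right (le_of_lt hy)
  · have hval : A.indicator w' s = max (w' s) 0 := by
      by_cases h' : 0 < w' s
      · rw [indicator_of_mem ((hmem s hsI).2 (Or.inr ⟨h, h'⟩)), max_eq_left h'.le]
      · rw [indicator_of_notMem, max_eq_right (not_lt.1 h')]
        intro hs'
        rcases (hmem s hsI).1 hs' with h'' | h''
        exacts [h''.ne' h, h' h''.2]
    rw [hval, hasDerivWithinAt_iff_tendsto_slope' self_notMem_Ioi]
    have := (hasDerivWithinAt_iff_tendsto_slope' self_notMem_Ioi).1 (hd s hs)
    refine (this.max tendsto_const_nhds).congr' ?_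
    filter_upwards [self_mem_nhdsWithin] with y hy
    have hy' : 0 ≤ (y - s)⁻¹ := inv_nonneg.2 (sub_nonneg.2 (le_of_lt hy))
    simp only [slope_def_field, h, max_self, sub_zero, div_eq_inv_mul]
    rw [mul_max_of_nonneg _ _ hy', mul_zero]
  · rw [indicator_of_mem ((hmem s hsI).2 (Or.inl h))]
    refine (hd s hs).congr_of_eventuallyEq ?_ (max_eq_left h.le)
    filter_upwards [mem_nhdsWithin_of_mem_nhds (continuousAt_const.eventually_lt hcont h)]
      with y hy using max_eq_left (le_of_lt hy)

/-- A lower bound on the second derivative bounds the symmetric second difference from below. -/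
lemma mul_sq_le_second_difference {f f' f'' : ℝ → ℝ} {x h c : ℝ} (hh : 0 ≤ h)
    (hf : ∀ y ∈ Icc (x - h) (x + h), HasDerivAt f (f' y) y)
    (hf' : ∀ y ∈ Icc (x - h) (x + h), HasDerivAt f' (f'' y) y)
    (hc : ∀ y ∈ Icc (x - h) (x + h), c ≤ f'' y) :
    c * h ^ 2 ≤ f (x + h) + f (x - h) - 2 * f x := by
  have hconv : ConvexOn ℝ (Icc (x - h) (x + h)) (fun y => f y - c / 2 * (y - x) ^ 2) := by
    refine convexOn_of_hasDerivWithinAt2_nonneg (convex_Icc _ _)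
      (f' := fun y => f' y - c * (y - x)) (f'' := fun y => f'' y - c) ?_ ?_ ?_ ?_
    · intro y hy
      exact ((hf y hy).continuousAt.sub (by fun_prop)).continuousWithinAt
    · intro y hy
      have h1 := (((hasDerivAt_id y).sub_const x).pow 2).const_mul (c / 2)
      refine (((hf y (interior_subset hy)).sub h1).congr_deriv ?_).hasDerivWithinAt
      simp; ring
    · intro y hy
      have h1 := ((hasDerivAt_id y).sub_const x).const_mul c
      exact (((hf' y (interior_subset hy)).sub h1).congr_deriv (by simp)).hasDerivWithinAt
    · intro y hy
      linarith [hc y (interior_subset hy)]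
  have := hconv.2 (left_mem_Icc.2 (by linarith)) (right_mem_Icc.2 (by linarith))
    (by norm_num : (0 : ℝ) ≤ 1 / 2) (by norm_num : (0 : ℝ) ≤ 1 / 2) (by norm_num)
  have hx : (1 / 2 : ℝ) • (x - h) + (1 / 2 : ℝ) • (x + h) = x := by
    simp only [smul_eq_mul]; ring
  rw [hx] at this
  simp only [smul_eq_mul] at this
  nlinarith

/-- Comparison principle for degenerate parabolic equations in logarithmic form: if
`w_t = f_xx - f - c` with `0 ≤ c`, where `w` and `f` have the same sign, `f` vanishes on the lateral boundary and
`w` is negative initially, then `f ≤ 0`. The time integral of the positive part of `f` is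
strictly subharmonic where it is positive, hence has no positive maximum. -/
theorem nonpos_of_log_parabolic {l r S c : ℝ} (hlr : l < r) (hS : 0 < S) (hc : 0 ≤ c)
    {f fx fxx w : ℝ → ℝ → ℝ}
    (hf : ContinuousOn (fun p : ℝ × ℝ => f p.1 p.2) (Icc l r ×ˢ Icc 0 S))
    (hl : ∀ s ∈ Icc 0 S, f l s = 0) (hr : ∀ s ∈ Icc 0 S, f r s = 0)
    (hfx : ∀ x ∈ Ioo l r, ∀ s ∈ Ioc 0 S, HasDerivAt (fun y => f y s) (fx x s) x)
    (hfxx : ∀ x ∈ Ioo l r, ∀ s ∈ Ioc 0 S, HasDerivAt (fun y => fx y s) (fxx x s) x)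
    (hfxxc : ContinuousOn (fun p : ℝ × ℝ => fxx p.1 p.2) (Ioo l r ×ˢ Ioc 0 S))
    (hw : ∀ x ∈ Ioo l r, ContinuousOn (w x) (Icc 0 S))
    (hw0 : ∀ x ∈ Ioo l r, w x 0 < 0)
    (hfw : ∀ x ∈ Ioo l r, ∀ s ∈ Icc 0 S, 0 < f x s → 0 < w x s)
    (hwf : ∀ x ∈ Ioo l r, ∀ s ∈ Icc 0 S, 0 ≤ w x s → 0 ≤ f x s)
    (hwt : ∀ x ∈ Ioo l r, ∀ s ∈ Ioo 0 S, HasDerivAt (w x) (fxx x s - f x s - c) s) :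
    ∀ x ∈ Icc l r, ∀ s ∈ Icc 0 S, f x s ≤ 0 := by
  set F : ℝ → ℝ → ℝ := fun x s => max (f (projIcc l r hlr.le x) (projIcc 0 S hS.le s)) 0 with hF
  have hFc : Continuous (Function.uncurry F) := by
    have h1 : Continuous (fun p : ℝ × ℝ =>
        (((projIcc l r hlr.le p.1 : ℝ), (projIcc 0 S hS.le p.2 : ℝ)) : ℝ × ℝ)) := by
      have h2 := (continuous_projIcc (h := hlr.le) (a := l) (b := r))
      have h3 := (continuous_projIcc (h := hS.le) (a := (0 : ℝ)) (b := S))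
      fun_prop
    exact (hf.comp_continuous h1
      fun p => ⟨(projIcc l r hlr.le p.1).2, (projIcc 0 S hS.le p.2).2⟩).max continuous_const
  have hFe : ∀ x ∈ Icc l r, ∀ s ∈ Icc 0 S, F x s = max (f x s) 0 := fun x hx s hs => by
    simp only [hF, projIcc_of_mem hlr.le hx, projIcc_of_mem hS.le hs]
  have hF0 : ∀ x s, 0 ≤ F x s := fun x s => le_max_right _ _
  have hFs : ∀ x, Continuous (F x) := fun x => hFc.comp (Continuous.prodMk_right x)
  set P : ℝ → ℝ := fun x => ∫ s in (0 : ℝ)..S, F x s with hP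
  have hPc : Continuous P :=
    intervalIntegral.continuous_parametric_intervalIntegral_of_continuous' hFc 0 S
  by_contra! hcon
  obtain ⟨x₁, hx₁, s₁, hs₁, hpos₁⟩ := hcon
  have hPx₁ : 0 < P x₁ :=
    intervalIntegral.integral_pos hS (hFs x₁).continuousOn (fun s _ => hF0 x₁ s)
      ⟨s₁, hs₁, by rw [hFe x₁ hx₁ s₁ hs₁]; exact lt_max_of_lt_left hpos₁⟩
  obtain ⟨x₀, hx₀I, hmax⟩ := isCompact_Icc.exists_isMaxOn ⟨x₁, hx₁⟩ hPc.continuousOn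
  have hPx₀ : 0 < P x₀ := hPx₁.trans_le (hmax hx₁)
  have hPz : ∀ x ∈ Icc l r, (∀ s ∈ Icc 0 S, f x s = 0) → P x = 0 := fun x hx hz => by
    rw [hP]
    refine intervalIntegral.integral_zero_ae (ae_of_all _ fun s hs => ?_)
    rw [uIoc_of_le hS.le] at hs
    rw [hFe x hx s ⟨hs.1.le, hs.2⟩, hz s ⟨hs.1.le, hs.2⟩, max_self]
  have hx₀ : x₀ ∈ Ioo l r := by
    refine ⟨lt_of_le_of_ne hx₀I.1 ?_, lt_of_le_of_ne hx₀I.2 ?_⟩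
    · rintro rfl
      exact hPx₀.ne' (hPz _ hx₀I hl)
    · rintro rfl
      exact hPx₀.ne' (hPz _ hx₀I hr)
  obtain ⟨τ, hτ, hτS, hτw⟩ : ∃ τ, 0 < τ ∧ τ < S ∧ ∀ s ∈ Icc 0 τ, w x₀ s < 0 := by
    have h1 : ∀ᶠ s in 𝓝[Icc 0 S] (0 : ℝ), w x₀ s < 0 :=
      (hw x₀ hx₀ 0 ⟨le_rfl, hS.le⟩).eventually_lt continuousWithinAt_const (hw0 x₀ hx₀)
    rw [eventually_nhdsWithin_iff, Metric.eventually_nhds_iff] at h1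
    obtain ⟨δ, hδ, h1⟩ := h1
    refine ⟨min (δ / 2) (S / 2), by positivity, (min_le_right _ _).trans_lt (by linarith), ?_⟩
    intro s hs
    have hs1 := hs.2.trans (min_le_left _ _)
    have hs2 := hs.2.trans (min_le_right _ _)
    refine h1 ?_ ⟨hs.1, by linarith⟩
    rw [Real.dist_eq, sub_zero, abs_of_nonneg hs.1]
    linarith
  have hsub : Icc τ S ⊆ Icc 0 S := Icc_subset_Icc_left hτ.le
  have hsub' : Icc τ S ⊆ Ioc 0 S := fun s hs => ⟨hτ.trans_le hs.1, hs.2⟩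
  have hfc : ∀ x ∈ Icc l r, ContinuousOn (f x) (Icc τ S) := fun x hx =>
    hf.comp (f := fun s => (x, s)) (by fun_prop) fun s hs => ⟨hx, hsub hs⟩
  have hgc : ContinuousOn (fxx x₀) (Icc τ S) :=
    hfxxc.comp (f := fun s => (x₀, s)) (by fun_prop) fun s hs => ⟨hx₀, hsub' hs⟩
  obtain ⟨A, hAm, hA1, hA2, hA3⟩ := exists_measurableSet_integral_indicator_deriv_nonneg
    (w := w x₀) (w' := fun s => fxx x₀ s - f x₀ s - c) hτS.le ((hw x₀ hx₀).mono hsub)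
    ((hgc.sub (hfc x₀ hx₀I)).sub continuousOn_const)
    (fun s hs => (hwt x₀ hx₀ s ⟨hτ.trans hs.1, hs.2⟩).hasDerivWithinAt)
    (hτw τ ⟨hτ.le, le_rfl⟩).le
  have hint : ∀ {g : ℝ → ℝ}, ContinuousOn g (Icc τ S) →
      IntervalIntegrable (A.indicator g) volume τ S := fun {g} hg => by
    rw [intervalIntegrable_iff_integrableOn_Icc_of_le hτS.le]
    exact hg.integrableOn_Icc.indicator hAm
  have hPge : ∀ x ∈ Icc l r, ∫ s in τ..S, A.indicator (f x) s ≤ P x := fun x hx => by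
    have h1 : ∫ s in τ..S, A.indicator (f x) s ≤ ∫ s in τ..S, F x s := by
      refine intervalIntegral.integral_mono_on hτS.le (hint (hfc x hx))
        ((hFs x).intervalIntegrable _ _) fun s hs => ?_
      rw [hFe x hx s (hsub hs)]
      by_cases h : s ∈ A
      · rw [indicator_of_mem h]; exact le_max_left _ _
      · rw [indicator_of_notMem h]; exact le_max_right _ _
    exact h1.trans (intervalIntegral.integral_mono_interval hτ.le hτS.le le_rfl
      (ae_of_all _ fun s => hF0 x s) ((hFs x).intervalIntegrable _ _))
  have hPeq : P x₀ = ∫ s in τ..S, A.indicator (f x₀) s := by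
    have h1 : ∫ s in (0 : ℝ)..τ, F x₀ s = 0 := by
      refine intervalIntegral.integral_zero_ae (ae_of_all _ fun s hs => ?_)
      rw [uIoc_of_le hτ.le] at hs
      have hs' : s ∈ Icc 0 S := ⟨hs.1.le, hs.2.trans hτS.le⟩
      rw [hFe x₀ hx₀I s hs']
      refine max_eq_right (not_lt.1 fun h => ?_)
      exact lt_asymm (hfw x₀ hx₀ s hs' h) (hτw s ⟨hs.1.le, hs.2⟩)
    have h2 : ∫ s in τ..S, F x₀ s = ∫ s in τ..S, A.indicator (f x₀) s := by
      refine intervalIntegral.integral_congr fun s hs => ?_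
      rw [uIcc_of_le hτS.le] at hs
      rw [hFe x₀ hx₀I s (hsub hs)]
      by_cases h : s ∈ A
      · rw [indicator_of_mem h]
        exact max_eq_left (hwf x₀ hx₀ s (hsub hs) (hA2 s hs h))
      · rw [indicator_of_notMem h]
        exact max_eq_right (not_lt.1 fun h' => h (hA1 s hs (hfw x₀ hx₀ s (hsub hs) h')))
    rw [← h2, hP]
    beta_reduce
    rw [← intervalIntegral.integral_add_adjacent_intervals
      ((hFs x₀).intervalIntegrable 0 τ) ((hFs x₀).intervalIntegrable τ S), h1, zero_add]
  set ε : ℝ := P x₀ / (2 * S) with hε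
  have hεpos : 0 < ε := by positivity
  obtain ⟨h, hh, hhl, hhr, hunif⟩ : ∃ h, 0 < h ∧ l < x₀ - h ∧ x₀ + h < r ∧
      ∀ s ∈ Icc τ S, ∀ y ∈ Icc (x₀ - h) (x₀ + h), fxx x₀ s - ε ≤ fxx y s := by
    obtain ⟨ρ, hρ, hρl, hρr⟩ : ∃ ρ, 0 < ρ ∧ l < x₀ - ρ ∧ x₀ + ρ < r :=
      ⟨min (x₀ - l) (r - x₀) / 2, by have := hx₀.1; have := hx₀.2; simp; constructor <;> linarith,
        by have := min_le_left (x₀ - l) (r - x₀); linarith [hx₀.1],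
        by have := min_le_right (x₀ - l) (r - x₀); linarith [hx₀.2]⟩
    have hK := (isCompact_Icc (a := x₀ - ρ) (b := x₀ + ρ)).prod (isCompact_Icc (a := τ) (b := S))
    have hKc := hK.uniformContinuousOn_of_continuous (hfxxc.mono (prod_mono
      (fun y hy => ⟨hρl.trans_le hy.1, hy.2.trans_lt hρr⟩) hsub'))
    rw [Metric.uniformContinuousOn_iff_le] at hKc
    obtain ⟨δ, hδ, hKc⟩ := hKc ε hεpos
    have hm1 := min_le_left δ ρ
    have hm2 := min_le_right δ ρ
    refine ⟨min δ ρ, lt_min hδ hρ, by linarith, by linarith, fun s hs y hy => ?_⟩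
    have := hKc (y, s) ⟨⟨by linarith [hy.1], by linarith [hy.2]⟩, hs⟩ (x₀, s)
      ⟨⟨by linarith, by linarith⟩, hs⟩ ?_
    · rw [Real.dist_eq] at this
      linarith [(abs_le.1 this).1]
    · rw [Prod.dist_eq, dist_self, max_eq_left dist_nonneg, Real.dist_eq, abs_le]
      constructor <;> linarith [hy.1, hy.2]
  have hp : x₀ + h ∈ Icc l r := ⟨by linarith, hhr.le⟩
  have hm : x₀ - h ∈ Icc l r := ⟨hhl.le, by linarith⟩
  have hi1 : IntervalIntegrable (A.indicator (fun s => fxx x₀ s - f x₀ s - c)) volume τ S :=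
    hint ((hgc.sub (hfc x₀ hx₀I)).sub continuousOn_const)
  have hdiff : ∫ s in τ..S, (A.indicator (fun s => fxx x₀ s - f x₀ s - c) s +
      A.indicator (f x₀) s - ε) * h ^ 2 ≤ ∫ s in τ..S, (A.indicator (f (x₀ + h)) s +
      A.indicator (f (x₀ - h)) s - 2 * A.indicator (f x₀) s) := by
    refine intervalIntegral.integral_mono_on hτS.le
      (((hi1.add (hint (hfc x₀ hx₀I))).sub intervalIntegrable_const).mul_const _)
      (((hint (hfc _ hp)).add (hint (hfc _ hm))).sub ((hint (hfc x₀ hx₀I)).const_mul 2))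
      fun s hs => ?_
    have hh2 : 0 ≤ h ^ 2 := by positivity
    by_cases hsA : s ∈ A
    · simp only [indicator_of_mem hsA]
      have hmemI : ∀ y ∈ Icc (x₀ - h) (x₀ + h), y ∈ Ioo l r := fun y hy =>
        ⟨hhl.trans_le hy.1, hy.2.trans_lt hhr⟩
      have := mul_sq_le_second_difference (f := fun y => f y s) (f' := fun y => fx y s)
        (f'' := fun y => fxx y s) (x := x₀) (c := fxx x₀ s - ε) hh.le
        (fun y hy => hfx y (hmemI y hy) s (hsub' hs))
        (fun y hy => hfxx y (hmemI y hy) s (hsub' hs)) (hunif s hs)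
      nlinarith
    · simp only [indicator_of_notMem hsA]
      nlinarith
  rw [intervalIntegral.integral_mul_const, intervalIntegral.integral_sub
      (hi1.add (hint (hfc x₀ hx₀I))) intervalIntegrable_const,
    intervalIntegral.integral_add hi1 (hint (hfc x₀ hx₀I)), intervalIntegral.integral_const,
    intervalIntegral.integral_sub ((hint (hfc _ hp)).add (hint (hfc _ hm)))
      ((hint (hfc x₀ hx₀I)).const_mul 2),
    intervalIntegral.integral_add (hint (hfc _ hp)) (hint (hfc _ hm)),
    intervalIntegral.integral_const_mul, ← hPeq, smul_eq_mul] at hdiff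
  have hεS : (S - τ) * ε < P x₀ := by
    have : S * ε = P x₀ / 2 := by rw [hε]; field_simp
    nlinarith
  have hlow : 0 < ((∫ s in τ..S, A.indicator (fun s => fxx x₀ s - f x₀ s - c) s) + P x₀ -
      (S - τ) * ε) * h ^ 2 := mul_pos (by linarith) (by positivity)
  have h1 := (hPge _ hp).trans (hmax hp)
  have h2 := (hPge _ hm).trans (hmax hm)
  linarith

section ClassicalSolution

variable {a b T : ℝ} {N₀ : Set ℝ} {u₀ : ℝ → ℝ} {u : ℝ → ℝ → ℝ} {xi xip : ℝ}

lemma mem_QT_diff_NSet (hsub : N₀ ⊆ Ioo a b) (hxi : xi ∈ N₀) (hxip : xip ∈ N₀)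
    (hcons : Ioo xi xip ∩ N₀ = ∅) {x t : ℝ} (hx : x ∈ Ioo xi xip) (ht : t ∈ Ioc 0 T) :
    (x, t) ∈ QT a b T \ NSet N₀ T :=
  ⟨⟨⟨(hsub hxi).1.trans hx.1, hx.2.trans (hsub hxip).2⟩, ht⟩,
    fun h => (hcons.subset ⟨hx, h.1⟩ : x ∈ (∅ : Set ℝ))⟩

/-- A classical solution that is positive for positive times between consecutive zeros is positive
there at time `0` too. -/
lemma IsClassicalSol.pos_of_mem_Icc (hu : IsClassicalSol a b T N₀ u₀ u) (hT : 0 < T)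
    (hsub : N₀ ⊆ Ioo a b) (hxi : xi ∈ N₀) (hxip : xip ∈ N₀) (hcons : Ioo xi xip ∩ N₀ = ∅)
    (hpos : ∀ x ∈ Ioo xi xip, ∀ t ∈ Ioc (0 : ℝ) T, 0 < u x t)
    {x t : ℝ} (hx : x ∈ Ioo xi xip) (ht : t ∈ Icc 0 T) : 0 < u x t := by
  rcases ht.1.eq_or_lt with rfl | h
  swap
  · exact hpos x hx t ⟨h, ht.2⟩
  have hxI : x ∈ Icc a b := ⟨((hsub hxi).1.trans hx.1).le, (hx.2.trans (hsub hxip).2).le⟩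
  have hne : u x 0 ≠ 0 := fun h0 =>
    (hcons.subset ⟨hx, (hu.zero_iff x hxI 0 ht).1 h0⟩ : x ∈ (∅ : Set ℝ))
  have hc : ContinuousOn (u x) (Icc 0 T) :=
    hu.cont.comp (f := fun s => (x, s)) (by fun_prop) fun s hs => ⟨hxI, hs⟩
  have hlim : Tendsto (u x) (𝓝[Ioc 0 T] 0) (𝓝 (u x 0)) :=
    (hc 0 ht).mono_left (nhdsWithin_mono _ Ioc_subset_Icc_self)
  have : (𝓝[Ioc 0 T] (0 : ℝ)).NeBot := by
    rw [← mem_closure_iff_nhdsWithin_neBot, closure_Ioc hT.ne]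
    exact ht
  refine lt_of_le_of_ne (ge_of_tendsto hlim ?_) hne.symm
  filter_upwards [self_mem_nhdsWithin] with s hs using (hpos x hx s hs).le

/-- The logarithmic form `(log u)_t = u_xx + 1 - u` of the equation where `u` is positive. -/
lemma IsClassicalSol.hasDerivAt_log (hu : IsClassicalSol a b T N₀ u₀ u) {x t : ℝ}
    (hmem : (x, t) ∈ QT a b T \ NSet N₀ T) (ht : t < T) (hpos : 0 < u x t) :
    HasDerivAt (fun s => Real.log (u x s)) (pdxx u x t + 1 - u x t) t := by
  have h1 := (hu.diff_t _ hmem).hasDerivWithinAt.hasDerivAt (Iic_mem_nhds ht)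
  have h2 := hu.pde _ hmem
  simp only [pdtW, abs_of_pos hpos] at h2
  simp only [h2] at h1
  refine (h1.log hpos.ne').congr_deriv ?_
  field_simp
  ring

/-- For positive classical solutions `t * u x t` is nondecreasing in time: the rescaled function
`(x, s) ↦ (t / t₀) * u x (t / t₀ * s)` is a supersolution with larger initial datum. -/
lemma IsClassicalSol.le_div_mul (hu : IsClassicalSol a b T N₀ u₀ u)
    (hsub : N₀ ⊆ Ioo a b) (hxi : xi ∈ N₀) (hxip : xip ∈ N₀) (hlt : xi < xip)
    (hcons : Ioo xi xip ∩ N₀ = ∅)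
    (hpos : ∀ x ∈ Ioo xi xip, ∀ t ∈ Ioc (0 : ℝ) T, 0 < u x t)
    {x t₀ t : ℝ} (hx : x ∈ Ioo xi xip) (ht₀ : 0 < t₀) (ht : t₀ < t) (htT : t ≤ T) :
    u x t₀ ≤ t / t₀ * u x t := by
  set c := t / t₀ with hc
  have hc1 : 1 < c := (one_lt_div ht₀).2 ht
  have hc0 : 0 < c := one_pos.trans hc1
  have hct : c * t₀ = t := div_mul_cancel₀ _ ht₀.ne'
  have hT : 0 < T := ht₀.trans (ht.trans_le htT)
  have hIcc : ∀ s ∈ Icc 0 t₀, s ∈ Icc 0 T ∧ c * s ∈ Icc 0 T := fun s hs =>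
    ⟨⟨hs.1, by linarith [hs.2]⟩, mul_nonneg hc0.le hs.1, by nlinarith [hs.2]⟩
  have hIoc : ∀ s ∈ Ioc 0 t₀, s ∈ Ioc 0 T ∧ c * s ∈ Ioc 0 T := fun s hs =>
    ⟨⟨hs.1, by linarith [hs.2]⟩, mul_pos hc0 hs.1, by nlinarith [hs.2]⟩
  have hxab : ∀ y ∈ Icc xi xip, y ∈ Icc a b := fun y hy =>
    ⟨(hsub hxi).1.le.trans hy.1, hy.2.trans (hsub hxip).2.le⟩
  have hmem : ∀ y ∈ Ioo xi xip, ∀ s ∈ Ioc 0 T, (y, s) ∈ QT a b T \ NSet N₀ T :=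
    fun y hy s hs => mem_QT_diff_NSet hsub hxi hxip hcons hy hs
  have hp : ∀ y ∈ Ioo xi xip, ∀ s ∈ Icc 0 T, 0 < u y s := fun y hy s hs =>
    hu.pos_of_mem_Icc hT hsub hxi hxip hcons hpos hy hs
  have hzero : ∀ y ∈ Icc xi xip, y ∈ N₀ → ∀ s ∈ Icc 0 t₀, u y s - c * u y (c * s) = 0 :=
    fun y hy hyN s hs => by
      rw [(hu.zero_iff y (hxab y hy) s (hIcc s hs).1).2 hyN,
        (hu.zero_iff y (hxab y hy) _ (hIcc s hs).2).2 hyN, mul_zero, sub_zero]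
  have hcu : ∀ y ∈ Icc xi xip, ContinuousOn (u y) (Icc 0 T) := fun y hy =>
    hu.cont.comp (f := fun s => (y, s)) (by fun_prop) fun s hs => ⟨hxab y hy, hs⟩
  have hscale : ContinuousOn (fun s : ℝ => c * s) (Icc 0 t₀) := by fun_prop
  have key := nonpos_of_log_parabolic hlt ht₀ (sub_nonneg.2 hc1.le)
    (f := fun y s => u y s - c * u y (c * s))
    (fx := fun y s => pdx u y s - c * pdx u y (c * s))
    (fxx := fun y s => pdxx u y s - c * pdxx u y (c * s))
    (w := fun y s => Real.log (u y s) - (Real.log c + Real.log (u y (c * s))))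
    ?_ (hzero xi (left_mem_Icc.2 hlt.le) hxi) (hzero xip (right_mem_Icc.2 hlt.le) hxip)
    ?_ ?_ ?_ ?_ ?_ ?_ ?_ ?_ x (Ioo_subset_Icc_self hx) t₀ (right_mem_Icc.2 ht₀.le)
  · rw [hct] at key
    linarith
  · exact (hu.cont.mono fun p hp => ⟨hxab _ hp.1, (hIcc _ hp.2).1⟩).sub
      (continuousOn_const.mul (hu.cont.comp (f := fun p : ℝ × ℝ => (p.1, c * p.2)) (by fun_prop)
        fun p hp => ⟨hxab _ hp.1, (hIcc _ hp.2).2⟩))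
  · exact fun y hy s hs => (hu.diff_x _ (hmem y hy s (hIoc s hs).1)).hasDerivAt.sub
      ((hu.diff_x _ (hmem y hy _ (hIoc s hs).2)).hasDerivAt.const_mul c)
  · exact fun y hy s hs => (hu.diff_xx _ (hmem y hy s (hIoc s hs).1)).hasDerivAt.sub
      ((hu.diff_xx _ (hmem y hy _ (hIoc s hs).2)).hasDerivAt.const_mul c)
  · exact (hu.cont_xx.mono fun p hp => hmem _ hp.1 _ (hIoc _ hp.2).1).sub
      (continuousOn_const.mul (hu.cont_xx.comp (f := fun p : ℝ × ℝ => (p.1, c * p.2))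
        (by fun_prop) fun p hp => hmem _ hp.1 _ (hIoc _ hp.2).2))
  · intro y hy
    have hyI := Ioo_subset_Icc_self hy
    exact (((hcu y hyI).mono fun s hs => (hIcc s hs).1).log
      fun s hs => (hp y hy s (hIcc s hs).1).ne').sub (continuousOn_const.add
        (((hcu y hyI).comp hscale fun s hs => (hIcc s hs).2).log
          fun s hs => (hp y hy _ (hIcc s hs).2).ne'))
  · intro y hy
    simp only [mul_zero]
    linarith [Real.log_pos hc1]
  · intro y hy s hs h
    rw [← Real.log_mul hc0.ne' (hp y hy _ (hIcc s hs).2).ne', sub_pos]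
    exact Real.log_lt_log (mul_pos hc0 (hp y hy _ (hIcc s hs).2)) (sub_pos.1 h)
  · intro y hy s hs h
    rw [← Real.log_mul hc0.ne' (hp y hy _ (hIcc s hs).2).ne', sub_nonneg] at h
    exact sub_nonneg.2 ((Real.log_le_log_iff (mul_pos hc0 (hp y hy _ (hIcc s hs).2))
      (hp y hy s (hIcc s hs).1)).1 h)
  · intro y hy s hs
    have hs' := Ioo_subset_Ioc_self hs
    have hst : c * s < T := ((mul_lt_mul_iff_right₀ hc0).2 hs.2).trans_le (hct.trans_le htT)
    have h1 := hu.hasDerivAt_log (hmem y hy s (hIoc s hs').1) (by linarith [hs.2])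
      (hpos y hy s (hIoc s hs').1)
    have h2 := hu.hasDerivAt_log (hmem y hy _ (hIoc s hs').2) hst (hpos y hy _ (hIoc s hs').2)
    have h3 := h2.comp s ((hasDerivAt_id s).const_mul c)
    refine (h1.sub (h3.const_add (Real.log c))).congr_deriv ?_
    ring

/-- The limit of `u_x` at a zero is the limit of the difference quotients. -/
lemma IsClassicalSol.tendsto_div_sub (hu : IsClassicalSol a b T N₀ u₀ u)
    (hsub : N₀ ⊆ Ioo a b) (hxi : xi ∈ N₀) (hxip : xip ∈ N₀) (hlt : xi < xip)
    (hcons : Ioo xi xip ∩ N₀ = ∅) {t m : ℝ} (ht : t ∈ Ioc 0 T)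
    (hm : Tendsto (fun y => pdx u y t) (𝓝[>] xi) (𝓝 m)) :
    Tendsto (fun x => u x t / (x - xi)) (𝓝[>] xi) (𝓝 m) := by
  have htI := Ioc_subset_Icc_self ht
  have hcx : ContinuousWithinAt (fun y => u y t) (Ioo xi xip) xi :=
    (hu.cont.comp (f := fun y => (y, t)) (s := Icc a b) (by fun_prop) (fun y hy => ⟨hy, htI⟩) xi
      (Ioo_subset_Icc_self (hsub hxi))).mono
      fun y hy => ⟨((hsub hxi).1.trans hy.1).le, (hy.2.trans (hsub hxip).2).le⟩
  have hd := hasDerivWithinAt_Ici_of_tendsto_deriv (f := fun y => u y t) (s := Ioo xi xip)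
    (fun y hy => (hu.diff_x _
      (mem_QT_diff_NSet hsub hxi hxip hcons hy ht)).differentiableWithinAt)
    hcx (Ioo_mem_nhdsGT hlt) hm
  have := (hasDerivWithinAt_iff_tendsto_slope' self_notMem_Ioi).1 (hd.mono Ioi_subset_Ici_self)
  refine this.congr fun y => ?_
  simp only [slope_def_field, (hu.zero_iff xi (Ioo_subset_Icc_self (hsub hxi)) t htI).2 hxi,
    sub_zero]

end ClassicalSolution

/-- The monotonicity (6.34) of the difference quotient `q(x,t) = u(x,t)/(x - x_i)`:
`q(x,t) ≥ (t₀/t) q(x,t₀)` for `0 < t₀ < t ≤ T`, hence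
`u_x(x_i⁺,t) ≥ (t₀/t) u_x(x_i⁺,t₀)`, and `u_x(x_i⁺,t) > 0` for `t > t₀` whenever
`u_x(x_i⁺,t₀) > 0`. -/
theorem stmt11 (a b T : ℝ) (hab : a < b) (hT : 0 < T)
    (N₀ : Set ℝ) (u₀ : ℝ → ℝ) (h₀ : InitData a b N₀ u₀)
    (u : ℝ → ℝ → ℝ) (hu : IsClassicalSol a b T N₀ u₀ u)
    (xi xip : ℝ) (hxi : xi ∈ N₀) (hxip : xip ∈ N₀) (hlt : xi < xip)
    (hcons : Set.Ioo xi xip ∩ N₀ = ∅)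
    (hpos : ∀ x ∈ Set.Ioo xi xip, ∀ t ∈ Set.Ioc (0:ℝ) T, 0 < u x t)
    (uxp : ℝ → ℝ)
    (huxp : ∀ t ∈ Set.Ioc (0:ℝ) T, Tendsto (fun y => pdx u y t) (𝓝[>] xi) (𝓝 (uxp t))) :
    (∀ x ∈ Set.Ioo xi xip, ∀ t₀ t : ℝ, 0 < t₀ → t₀ < t → t ≤ T →
      t₀ / t * (u x t₀ / (x - xi)) ≤ u x t / (x - xi)) ∧
    (∀ t₀ t : ℝ, 0 < t₀ → t₀ < t → t ≤ T → t₀ / t * uxp t₀ ≤ uxp t) ∧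
    (∀ t₀ : ℝ, 0 < t₀ → t₀ ≤ T → 0 < uxp t₀ →
      ∀ t : ℝ, t₀ < t → t ≤ T → 0 < uxp t) := by
  have hq : ∀ x ∈ Set.Ioo xi xip, ∀ t₀ t : ℝ, 0 < t₀ → t₀ < t → t ≤ T →
      t₀ / t * (u x t₀ / (x - xi)) ≤ u x t / (x - xi) := by
    intro x hx t₀ t ht₀ ht htT
    have h := hu.le_div_mul h₀.sub hxi hxip hlt hcons hpos hx ht₀ ht htT
    have ht' : 0 < t := ht₀.trans ht
    rw [← mul_div_assoc]
    refine div_le_div_of_nonneg_right ?_ (sub_nonneg.2 hx.1.le)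
    rw [div_mul_eq_mul_div, div_le_iff₀ ht']
    rw [div_mul_eq_mul_div, le_div_iff₀ ht₀] at h
    linarith
  have hd : ∀ t₀ t : ℝ, 0 < t₀ → t₀ < t → t ≤ T → t₀ / t * uxp t₀ ≤ uxp t := by
    intro t₀ t ht₀ ht htT
    have hlim : ∀ s ∈ Ioc 0 T, Tendsto (fun x => u x s / (x - xi)) (𝓝[>] xi) (𝓝 (uxp s)) :=
      fun s hs => hu.tendsto_div_sub h₀.sub hxi hxip hlt hcons hs (huxp s hs)
    refine le_of_tendsto_of_tendsto ((hlim t₀ ⟨ht₀, by linarith⟩).const_mul (t₀ / t))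
      (hlim t ⟨by linarith, htT⟩) ?_
    filter_upwards [Ioo_mem_nhdsGT hlt] with x hx using hq x hx t₀ t ht₀ ht htT
  exact ⟨hq, hd, fun t₀ ht₀ _ hu₀ t ht htT =>
    (mul_pos (div_pos ht₀ (ht₀.trans ht)) hu₀).trans_le (hd t₀ t ht₀ ht htT)⟩
end

section
/- Let u_{i,n} and u_i be as in Lemma 8.1 (u_{i,n} the smooth solution of the approximating problem (8.45), u_i its decreasing pointwise limit), and let α > −1. Then there exists a constant K > 0 independent of n such that (4(α+1)/(α+2)²) ∬_{Q_i} ( ∂_x ( u_{i,n}^{(α+2)/2} ) )² dx dt + ∫₀^T n^{−(α+1)} ( |∂_x u_{i,n}(x_{i+1}, t)| + |∂_x u_{i,n}(x_i, t)| ) dt ≤ K. Moreover u_i^{(α+2)/2} ∈ L²(0,T; H¹((x_i, x_{i+1}))) and ∂_x( u_{i,n}^{(α+2)/2} ) → ∂_x( u_i^{(α+2)/2} ) in L²(Q_i) as n → ∞. -/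
open Set Filter Topology MeasureTheory

/-- `Q_i = (x_i, x_{i+1}) × (0,T]`. -/
def QiSet (xi xip T : ℝ) : Set (ℝ × ℝ) := Set.Ioo xi xip ×ˢ Set.Ioc 0 T

/-- A solution of the approximating problem (8.45):
`u ∈ C(Q̄_i) ∩ C^{2,1}([x_i,x_{i+1}] × (0,T])` with `u_t = u(u_xx + 1 - u)` in `Q_i`,
boundary values `c` and initial datum `f`. -/
def IsApproxSol (xi xip T c : ℝ) (f : ℝ → ℝ) (u : ℝ → ℝ → ℝ) : Prop :=
  ContinuousOn (fun p : ℝ × ℝ => u p.1 p.2) (Set.Icc xi xip ×ˢ Set.Icc 0 T) ∧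
  (∀ t ∈ Set.Ioc (0:ℝ) T, u xi t = c ∧ u xip t = c) ∧
  (∀ x ∈ Set.Icc xi xip, u x 0 = f x) ∧
  ∃ v1 v2 vt : ℝ → ℝ → ℝ,
    ContinuousOn (fun p : ℝ × ℝ => v1 p.1 p.2) (Set.Icc xi xip ×ˢ Set.Ioc 0 T) ∧
    ContinuousOn (fun p : ℝ × ℝ => v2 p.1 p.2) (Set.Icc xi xip ×ˢ Set.Ioc 0 T) ∧
    ContinuousOn (fun p : ℝ × ℝ => vt p.1 p.2) (Set.Icc xi xip ×ˢ Set.Ioc 0 T) ∧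
    (∀ x ∈ Set.Icc xi xip, ∀ t ∈ Set.Ioc (0:ℝ) T,
      HasDerivWithinAt (fun y => u y t) (v1 x t) (Set.Icc xi xip) x ∧
      HasDerivWithinAt (fun y => v1 y t) (v2 x t) (Set.Icc xi xip) x ∧
      HasDerivWithinAt (fun s => u x s) (vt x t) (Set.Iic T) t) ∧
    (∀ x ∈ Set.Ioo xi xip, ∀ t ∈ Set.Ioc (0:ℝ) T,
      vt x t = u x t * (v2 x t + 1 - u x t))

/-- A positive classical solution of the degenerate problem (8.44):
`u ∈ C(Q̄_i) ∩ C^{2,1}(Q_i)`, positive in `Q_i`, with `u_t = u u_xx + u(1-u)` in `Q_i`,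
zero boundary values and initial datum `f`. -/
def IsDegSol (xi xip T : ℝ) (f : ℝ → ℝ) (u : ℝ → ℝ → ℝ) : Prop :=
  ContinuousOn (fun p : ℝ × ℝ => u p.1 p.2) (Set.Icc xi xip ×ˢ Set.Icc 0 T) ∧
  (∀ t ∈ Set.Ioc (0:ℝ) T, u xi t = 0 ∧ u xip t = 0) ∧
  (∀ x ∈ Set.Icc xi xip, u x 0 = f x) ∧
  (∀ x ∈ Set.Ioo xi xip, ∀ t ∈ Set.Ioc (0:ℝ) T, 0 < u x t) ∧
  (∀ x ∈ Set.Ioo xi xip, ∀ t ∈ Set.Ioc (0:ℝ) T,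
    DifferentiableAt ℝ (fun y => u y t) x ∧
    DifferentiableAt ℝ (fun y => deriv (fun z => u z t) y) x ∧
    DifferentiableWithinAt ℝ (fun s => u x s) (Set.Iic T) t ∧
    derivWithin (fun s => u x s) (Set.Iic T) t
      = u x t * deriv (fun y => deriv (fun z => u z t) y) x + u x t * (1 - u x t)) ∧
  ContinuousOn (fun p : ℝ × ℝ => deriv (fun z => u z p.2) p.1) (QiSet xi xip T) ∧
  ContinuousOn (fun p : ℝ × ℝ => deriv (fun y => deriv (fun z => u z p.2) y) p.1)
    (QiSet xi xip T) ∧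
  ContinuousOn (fun p : ℝ × ℝ => derivWithin (fun s => u p.1 s) (Set.Iic T) p.2)
    (QiSet xi xip T)

/-! ### Measure-theoretic tools -/

theorem aecover_of_exhaustion {X : Type*} [MeasurableSpace X] {μ : Measure X} {Q : Set X}
    {S : ℕ → Set X} (hQ : MeasurableSet Q) (hS : ∀ k, MeasurableSet (S k))
    (hev : ∀ x ∈ Q, ∀ᶠ k in atTop, x ∈ S k) : AECover (μ.restrict Q) atTop S :=
  ⟨(ae_restrict_mem hQ).mono hev, hS⟩

theorem integrableOn_of_exhaustion {X : Type*} [MeasurableSpace X] {μ : Measure X} {Q : Set X}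
    {S : ℕ → Set X} (hQ : MeasurableSet Q) (hS : ∀ k, MeasurableSet (S k))
    (hSQ : ∀ k, S k ⊆ Q) (hev : ∀ x ∈ Q, ∀ᶠ k in atTop, x ∈ S k) {f : X → ℝ}
    (hf : ∀ k, IntegrableOn f (S k) μ) (h0 : ∀ x ∈ Q, 0 ≤ f x) {C : ℝ}
    (hC : ∀ᶠ k in atTop, ∫ x in S k, f x ∂μ ≤ C) : IntegrableOn f Q μ := by
  refine (aecover_of_exhaustion (μ := μ) hQ hS hev).integrable_of_integral_bounded_of_nonneg_ae C
    (fun k => ?_) ((ae_restrict_mem hQ).mono h0) ?_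
  · rw [IntegrableOn, Measure.restrict_restrict_of_subset (hSQ k)]; exact hf k
  · filter_upwards [hC] with k hk
    rwa [Measure.restrict_restrict_of_subset (hSQ k)]

theorem tendsto_setIntegral_of_exhaustion {X : Type*} [MeasurableSpace X] {μ : Measure X}
    {Q : Set X} {S : ℕ → Set X} (hQ : MeasurableSet Q) (hS : ∀ k, MeasurableSet (S k))
    (hSQ : ∀ k, S k ⊆ Q) (hev : ∀ x ∈ Q, ∀ᶠ k in atTop, x ∈ S k) {f : X → ℝ}
    (hf : IntegrableOn f Q μ) :
    Tendsto (fun k => ∫ x in S k, f x ∂μ) atTop (𝓝 (∫ x in Q, f x ∂μ)) := by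
  have := (aecover_of_exhaustion (μ := μ) hQ hS hev).integral_tendsto_of_countably_generated hf
  refine this.congr fun k => ?_
  rw [Measure.restrict_restrict_of_subset (hSQ k)]

theorem tendsto_setIntegral_of_bounded {X : Type*} [MeasurableSpace X] {μ : Measure X}
    {S : Set X} (hS : MeasurableSet S) (hμ : μ S < ⊤) {F : ℕ → X → ℝ} {f : X → ℝ}
    (hm : ∀ᶠ n in atTop, AEStronglyMeasurable (F n) (μ.restrict S)) {C : ℝ}
    (hC : ∀ᶠ n in atTop, ∀ x ∈ S, |F n x| ≤ C)
    (hlim : ∀ x ∈ S, Tendsto (fun n => F n x) atTop (𝓝 (f x))) :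
    Tendsto (fun n => ∫ x in S, F n x ∂μ) atTop (𝓝 (∫ x in S, f x ∂μ)) := by
  refine tendsto_integral_filter_of_dominated_convergence (fun _ => C) hm ?_ ?_ ?_
  · filter_upwards [hC] with n hn
    exact (ae_restrict_mem hS).mono hn
  · exact integrableOn_const hμ.ne
  · exact (ae_restrict_mem hS).mono hlim

/-- If `f n` has square integrals converging to `A` and pairs asymptotically with `f` on every set
of an exhaustion as `f` itself does, then `f` is square integrable, with square integral at
most `A`. -/
theorem integrableOn_sq_of_local_pairing {X : Type*} [MeasurableSpace X] {μ : Measure X}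
    {Q : Set X} {S : ℕ → Set X} (hQ : MeasurableSet Q) (hS : ∀ k, MeasurableSet (S k))
    (hSQ : ∀ k, S k ⊆ Q) (hev : ∀ x ∈ Q, ∀ᶠ k in atTop, x ∈ S k)
    {F : ℕ → X → ℝ} {f : X → ℝ} {A : ℝ}
    (hFm : ∀ᶠ n in atTop, AEStronglyMeasurable (F n) (μ.restrict Q))
    (hfm : AEStronglyMeasurable f (μ.restrict Q))
    (hF : ∀ᶠ n in atTop, IntegrableOn (fun x => F n x ^ 2) Q μ)
    (hf : ∀ k, IntegrableOn (fun x => f x ^ 2) (S k) μ)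
    (hA : Tendsto (fun n => ∫ x in Q, F n x ^ 2 ∂μ) atTop (𝓝 A))
    (hpair : ∀ k, Tendsto (fun n => ∫ x in S k, F n x * f x ∂μ) atTop
      (𝓝 (∫ x in S k, f x ^ 2 ∂μ))) :
    IntegrableOn (fun x => f x ^ 2) Q μ ∧
    (A ≤ ∫ x in Q, f x ^ 2 ∂μ →
      Tendsto (fun n => ∫ x in Q, (F n x - f x) ^ 2 ∂μ) atTop (𝓝 0)) := by
  have hfL : ∀ k, MemLp ((S k).indicator f) 2 (μ.restrict Q) := by
    intro k
    rw [memLp_indicator_iff_restrict (hS k), Measure.restrict_restrict_of_subset (hSQ k),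
      memLp_two_iff_integrable_sq (hfm.mono_measure (Measure.restrict_mono_set μ (hSQ k)))]
    exact hf k
  have hind : ∀ k, ∫ x in Q, (S k).indicator f x ^ 2 ∂μ = ∫ x in S k, f x ^ 2 ∂μ := by
    intro k
    rw [← Measure.restrict_restrict_of_subset (μ := μ) (hSQ k), ← integral_indicator (hS k)]
    congr 1; ext x
    by_cases hx : x ∈ S k <;> simp [hx]
  have hexp : ∀ k, Tendsto (fun n => ∫ x in Q, (F n x - (S k).indicator f x) ^ 2 ∂μ) atTop
      (𝓝 (A - ∫ x in S k, f x ^ 2 ∂μ)) := by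
    intro k
    have h1 := (hA.sub ((hpair k).const_mul 2)).add_const (∫ x in S k, f x ^ 2 ∂μ)
    rw [show A - 2 * (∫ x in S k, f x ^ 2 ∂μ) + ∫ x in S k, f x ^ 2 ∂μ
      = A - ∫ x in S k, f x ^ 2 ∂μ by ring] at h1
    refine h1.congr' ?_
    filter_upwards [hFm, hF] with n hnm hn
    have hFL := (memLp_two_iff_integrable_sq hnm).2 hn
    have hprod : IntegrableOn (fun x => F n x * (S k).indicator f x) Q μ :=
      hFL.integrable_mul (hfL k)
    have hsq : IntegrableOn (fun x => (S k).indicator f x ^ 2) Q μ := (hfL k).integrable_sq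
    have e1 : ∫ x in Q, F n x * (S k).indicator f x ∂μ = ∫ x in S k, F n x * f x ∂μ := by
      rw [← Measure.restrict_restrict_of_subset (μ := μ) (hSQ k), ← integral_indicator (hS k)]
      congr 1; ext x
      by_cases hx : x ∈ S k <;> simp [hx]
    have hdiff : IntegrableOn
        (fun x => F n x ^ 2 - 2 * (F n x * (S k).indicator f x)) Q μ := hn.sub (hprod.const_mul 2)
    rw [← e1, ← hind, ← integral_const_mul, ← integral_sub hn (hprod.const_mul 2),
      ← integral_add hdiff hsq]
    congr 1; ext x; ring
  have hle : ∀ k, ∫ x in S k, f x ^ 2 ∂μ ≤ A := fun k => by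
    have := ge_of_tendsto' (hexp k) fun n => integral_nonneg fun x => sq_nonneg _
    linarith
  have hint : IntegrableOn (fun x => f x ^ 2) Q μ :=
    integrableOn_of_exhaustion hQ hS hSQ hev hf (fun _ _ => sq_nonneg _)
      (Eventually.of_forall hle)
  refine ⟨hint, fun hAle => ?_⟩
  have hlimS := tendsto_setIntegral_of_exhaustion hQ hS hSQ hev hint
  have hfQ := (memLp_two_iff_integrable_sq hfm).2 hint
  have hrest : ∀ k, ∫ x in Q, ((S k).indicator f x - f x) ^ 2 ∂μ
      = ∫ x in Q, f x ^ 2 ∂μ - ∫ x in S k, f x ^ 2 ∂μ := by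
    intro k
    rw [← hind, ← integral_sub hint (hfL k).integrable_sq]
    congr 1; ext x
    by_cases hx : x ∈ S k <;> simp [hx]
  rw [Metric.tendsto_atTop]
  intro ε hε
  have hk : ∃ k, ∫ x in Q, f x ^ 2 ∂μ - ∫ x in S k, f x ^ 2 ∂μ < ε / 8 := by
    obtain ⟨k, hk⟩ := (hlimS.eventually (lt_mem_nhds (show ∫ x in Q, f x ^ 2 ∂μ - ε / 8
      < ∫ x in Q, f x ^ 2 ∂μ by linarith))).exists
    exact ⟨k, by linarith⟩
  obtain ⟨k, hk⟩ := hk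
  have hev2 := (hexp k).eventually (gt_mem_nhds (show A - ∫ x in S k, f x ^ 2 ∂μ < ε / 4 by
    linarith))
  obtain ⟨N, hN⟩ := eventually_atTop.1 (hev2.and (hFm.and hF))
  refine ⟨N, fun n hn => ?_⟩
  obtain ⟨h1, h2, h3⟩ := hN n hn
  have hFL := (memLp_two_iff_integrable_sq h2).2 h3
  have i1 : IntegrableOn (fun x => (F n x - (S k).indicator f x) ^ 2) Q μ :=
    (hFL.sub (hfL k)).integrable_sq
  have i2 : IntegrableOn (fun x => ((S k).indicator f x - f x) ^ 2) Q μ :=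
    ((hfL k).sub hfQ).integrable_sq
  have hnn : 0 ≤ ∫ x in Q, (F n x - f x) ^ 2 ∂μ := integral_nonneg fun x => sq_nonneg _
  rw [Real.dist_eq, sub_zero, abs_of_nonneg hnn]
  have : ∫ x in Q, (F n x - f x) ^ 2 ∂μ
      ≤ ∫ x in Q, (2 * (F n x - (S k).indicator f x) ^ 2
        + 2 * ((S k).indicator f x - f x) ^ 2) ∂μ := by
    refine integral_mono (hFL.sub hfQ).integrable_sq ((i1.const_mul 2).add (i2.const_mul 2))
      fun x => ?_
    simp only
    nlinarith [sq_nonneg ((F n x - (S k).indicator f x) - ((S k).indicator f x - f x))]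
  rw [integral_add (i1.const_mul 2) (i2.const_mul 2), integral_const_mul, integral_const_mul,
    hrest] at this
  linarith

/-! ### Integration by parts on rectangles -/

theorem ContinuousOn.integrableOn_rect {f : ℝ × ℝ → ℝ} {c d τ T : ℝ}
    (hf : ContinuousOn f (Icc c d ×ˢ Icc τ T)) :
    IntegrableOn f (Ioo c d ×ˢ Ioc τ T) :=
  (hf.integrableOn_compact (isCompact_Icc.prod isCompact_Icc)).mono_set
    (Set.prod_mono Ioo_subset_Icc_self Ioc_subset_Icc_self)

theorem ContinuousOn.integrableOn_Ioc' {f : ℝ → ℝ} {c d : ℝ} (hf : ContinuousOn f (Icc c d)) :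
    IntegrableOn f (Ioc c d) :=
  (hf.integrableOn_compact isCompact_Icc).mono_set Ioc_subset_Icc_self

theorem ContinuousOn.integrableOn_Ioo' {f : ℝ → ℝ} {c d : ℝ} (hf : ContinuousOn f (Icc c d)) :
    IntegrableOn f (Ioo c d) :=
  (hf.integrableOn_compact isCompact_Icc).mono_set Ioo_subset_Icc_self

theorem ContinuousOn.slice_left {f : ℝ × ℝ → ℝ} {s t : Set ℝ} (hf : ContinuousOn f (s ×ˢ t))
    {y : ℝ} (hy : y ∈ t) : ContinuousOn (fun x => f (x, y)) s :=
  hf.comp (by fun_prop) fun _ hx => ⟨hx, hy⟩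

theorem ContinuousOn.slice_right {f : ℝ × ℝ → ℝ} {s t : Set ℝ} (hf : ContinuousOn f (s ×ˢ t))
    {x : ℝ} (hx : x ∈ s) : ContinuousOn (fun y => f (x, y)) t :=
  hf.comp (by fun_prop) fun _ hy => ⟨hx, hy⟩

theorem setIntegral_rect_deriv_fst {c d τ T : ℝ} (hcd : c ≤ d) {Φ Φ' : ℝ × ℝ → ℝ}
    (hΦ : ContinuousOn Φ (Icc c d ×ˢ Icc τ T)) (hΦ' : ContinuousOn Φ' (Icc c d ×ˢ Icc τ T))
    (hd : ∀ x ∈ Ioo c d, ∀ t ∈ Ioc τ T, HasDerivAt (fun y => Φ (y, t)) (Φ' (x, t)) x) :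
    ∫ p in Ioo c d ×ˢ Ioc τ T, Φ' p = ∫ t in Ioc τ T, (Φ (d, t) - Φ (c, t)) := by
  have hi := hΦ'.integrableOn_rect
  rw [IntegrableOn, Measure.volume_eq_prod, ← Measure.prod_restrict] at hi
  rw [Measure.volume_eq_prod, ← Measure.prod_restrict, integral_prod_symm _ hi]
  refine setIntegral_congr_fun measurableSet_Ioc fun t ht => ?_
  have ht' := Ioc_subset_Icc_self ht
  have hc := hΦ'.slice_left ht'
  have := intervalIntegral.integral_eq_sub_of_hasDerivAt_of_le hcd (hΦ.slice_left ht')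
    (fun x hx => hd x hx t ht) (hc.intervalIntegrable_of_Icc hcd)
  rw [intervalIntegral.integral_of_le hcd, integral_Ioc_eq_integral_Ioo] at this
  exact this

theorem setIntegral_rect_deriv_snd {c d τ T : ℝ} (hτT : τ ≤ T) {Φ Φ' : ℝ × ℝ → ℝ}
    (hΦ : ContinuousOn Φ (Icc c d ×ˢ Icc τ T)) (hΦ' : ContinuousOn Φ' (Icc c d ×ˢ Icc τ T))
    (hd : ∀ x ∈ Ioo c d, ∀ t ∈ Ioo τ T, HasDerivAt (fun s => Φ (x, s)) (Φ' (x, t)) t) :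
    ∫ p in Ioo c d ×ˢ Ioc τ T, Φ' p = ∫ x in Ioo c d, (Φ (x, T) - Φ (x, τ)) := by
  have hi := hΦ'.integrableOn_rect
  rw [Measure.volume_eq_prod] at hi ⊢
  rw [setIntegral_prod _ hi]
  refine setIntegral_congr_fun measurableSet_Ioo fun x hx => ?_
  have hx' := Ioo_subset_Icc_self hx
  have := intervalIntegral.integral_eq_sub_of_hasDerivAt_of_le hτT (hΦ.slice_right hx')
    (fun t ht => hd x hx t ht) ((hΦ'.slice_right hx').intervalIntegrable_of_Icc hτT)
  rw [intervalIntegral.integral_of_le hτT] at this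
  exact this

/-- A positive smooth solution of `u_t = u (u_xx + 1 - u)` on a closed rectangle, with spatial
derivatives `ux`, `uxx`. -/
structure IsSmoothSol (c d τ T : ℝ) (u ux uxx : ℝ → ℝ → ℝ) : Prop where
  lt : c < d
  lt_time : τ < T
  cont : ContinuousOn (fun p : ℝ × ℝ => u p.1 p.2) (Icc c d ×ˢ Icc τ T)
  cont_x : ContinuousOn (fun p : ℝ × ℝ => ux p.1 p.2) (Icc c d ×ˢ Icc τ T)
  cont_xx : ContinuousOn (fun p : ℝ × ℝ => uxx p.1 p.2) (Icc c d ×ˢ Icc τ T)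
  pos : ∀ x ∈ Icc c d, ∀ t ∈ Icc τ T, 0 < u x t
  deriv_x : ∀ x ∈ Ioo c d, ∀ t ∈ Ioc τ T, HasDerivAt (fun y => u y t) (ux x t) x
  deriv_xx : ∀ x ∈ Ioo c d, ∀ t ∈ Ioc τ T, HasDerivAt (fun y => ux y t) (uxx x t) x
  deriv_t : ∀ x ∈ Ioo c d, ∀ t ∈ Ioo τ T,
    HasDerivAt (fun s => u x s) (u x t * (uxx x t + 1 - u x t)) t

theorem IsSmoothSol.comp_cont {c d τ T : ℝ} {u ux uxx : ℝ → ℝ → ℝ}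
    (hu : IsSmoothSol c d τ T u ux uxx) {g : ℝ → ℝ} (hg : ContinuousOn g (Ioi 0)) :
    ContinuousOn (fun p : ℝ × ℝ => g (u p.1 p.2)) (Icc c d ×ˢ Icc τ T) :=
  hg.comp hu.cont fun p hp => hu.pos p.1 hp.1 p.2 hp.2

theorem IsSmoothSol.energy {c d τ T : ℝ} {u ux uxx : ℝ → ℝ → ℝ}
    (hu : IsSmoothSol c d τ T u ux uxx) {H g g' : ℝ → ℝ}
    (hH : ∀ s, 0 < s → HasDerivAt H (g s / s) s) (hg : ∀ s, 0 < s → HasDerivAt g (g' s) s)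
    (hg' : ContinuousOn g' (Ioi 0)) :
    ∫ p in Ioo c d ×ˢ Ioc τ T, g' (u p.1 p.2) * ux p.1 p.2 ^ 2
      = (∫ x in Ioo c d, H (u x τ)) - (∫ x in Ioo c d, H (u x T))
        + (∫ t in Ioc τ T, (g (u d t) * ux d t - g (u c t) * ux c t))
        + ∫ p in Ioo c d ×ˢ Ioc τ T, g (u p.1 p.2) * (1 - u p.1 p.2) := by
  have hHc : ContinuousOn H (Ioi 0) := fun s hs => (hH s hs).continuousAt.continuousWithinAt
  have hgc : ContinuousOn g (Ioi 0) := fun s hs => (hg s hs).continuousAt.continuousWithinAt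
  have cH := hu.comp_cont hHc
  have cg := hu.comp_cont hgc
  have cg' := hu.comp_cont hg'
  have c0 := hu.cont
  have c1 := hu.cont_x
  have c2 := hu.cont_xx
  have cA : ContinuousOn (fun p : ℝ × ℝ => g' (u p.1 p.2) * ux p.1 p.2 ^ 2)
    (Icc c d ×ˢ Icc τ T) := cg'.mul (c1.pow 2)
  have cB : ContinuousOn (fun p : ℝ × ℝ => g (u p.1 p.2) * (1 - u p.1 p.2))
    (Icc c d ×ˢ Icc τ T) := cg.mul (continuousOn_const.sub c0)
  have cD : ContinuousOn (fun p : ℝ × ℝ => g (u p.1 p.2) * uxx p.1 p.2)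
    (Icc c d ×ˢ Icc τ T) := cg.mul c2
  have h1 := setIntegral_rect_deriv_fst hu.lt.le
    (Φ := fun p : ℝ × ℝ => g (u p.1 p.2) * ux p.1 p.2)
    (Φ' := fun p : ℝ × ℝ => g' (u p.1 p.2) * ux p.1 p.2 ^ 2 + g (u p.1 p.2) * uxx p.1 p.2)
    (cg.mul c1) (cA.add cD) (fun x hx t ht => by
      have hp := hu.pos x (Ioo_subset_Icc_self hx) t (Ioc_subset_Icc_self ht)
      have := ((hg _ hp).comp x (hu.deriv_x x hx t ht)).mul (hu.deriv_xx x hx t ht)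
      refine this.congr_deriv ?_
      simp only [Function.comp]; ring)
  have h2 := setIntegral_rect_deriv_snd hu.lt_time.le
    (Φ := fun p : ℝ × ℝ => H (u p.1 p.2))
    (Φ' := fun p : ℝ × ℝ => g (u p.1 p.2) * uxx p.1 p.2 + g (u p.1 p.2) * (1 - u p.1 p.2))
    cH (cD.add cB) (fun x hx t ht => by
      have hp := hu.pos x (Ioo_subset_Icc_self hx) t (Ioo_subset_Icc_self ht)
      have := (hH _ hp).comp t (hu.deriv_t x hx t ht)
      refine this.congr_deriv ?_
      field_simp; ring)
  rw [integral_add cA.integrableOn_rect cD.integrableOn_rect] at h1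
  rw [integral_add cD.integrableOn_rect cB.integrableOn_rect, integral_sub] at h2
  · linarith
  · exact (cH.slice_left (right_mem_Icc.2 hu.lt_time.le)).integrableOn_Ioo'
  · exact (cH.slice_left (left_mem_Icc.2 hu.lt_time.le)).integrableOn_Ioo'

/-! ### Minimum principle -/

theorem deriv_nonpos_of_min_right {f : ℝ → ℝ} {f' c d : ℝ} (hcd : c < d)
    (hf : HasDerivWithinAt f f' (Icc c d) d) (hmin : ∀ x ∈ Ioo c d, f d ≤ f x) : f' ≤ 0 := by
  have h1 := hf.mono Ioo_subset_Icc_self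
  rw [hasDerivWithinAt_iff_tendsto_slope' (by simp)] at h1
  have := right_nhdsWithin_Ioo_neBot hcd
  refine le_of_tendsto h1 ?_
  filter_upwards [self_mem_nhdsWithin] with x hx
  rw [slope_def_field]
  exact div_nonpos_of_nonneg_of_nonpos (sub_nonneg.2 (hmin x hx)) (sub_nonpos.2 hx.2.le)

theorem deriv_nonneg_of_min_left {f : ℝ → ℝ} {f' c d : ℝ} (hcd : c < d)
    (hf : HasDerivWithinAt f f' (Icc c d) c) (hmin : ∀ x ∈ Ioo c d, f c ≤ f x) : 0 ≤ f' := by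
  have h1 := hf.mono Ioo_subset_Icc_self
  rw [hasDerivWithinAt_iff_tendsto_slope' (by simp)] at h1
  have := left_nhdsWithin_Ioo_neBot hcd
  refine ge_of_tendsto h1 ?_
  filter_upwards [self_mem_nhdsWithin] with x hx
  rw [slope_def_field]
  exact div_nonneg (sub_nonneg.2 (hmin x hx)) (sub_nonneg.2 hx.1.le)

theorem second_deriv_nonneg_of_isLocalMin {f f' : ℝ → ℝ} {f'' x : ℝ} (hmin : IsLocalMin f x)
    (hf : ∀ᶠ y in 𝓝 x, HasDerivAt f (f' y) y) (hf' : HasDerivAt f' f'' x) : 0 ≤ f'' := by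
  by_contra! hneg
  have hder : deriv f =ᶠ[𝓝 x] f' := hf.mono fun y hy => hy.deriv
  have hdd : deriv (deriv f) x = f'' := by rw [hder.deriv_eq, hf'.deriv]
  have hmax := isLocalMax_of_deriv_deriv_neg (hdd ▸ hneg) hmin.deriv_eq_zero
    hf.self_of_nhds.continuousAt
  have hconst : f =ᶠ[𝓝 x] fun _ => f x := by
    filter_upwards [hmax, hmin] with y h1 h2 using le_antisymm h1 h2
  have h0 : deriv f =ᶠ[𝓝 x] fun _ => 0 := by
    have := hconst.deriv
    simpa using this
  have : deriv (deriv f) x = 0 := by rw [h0.deriv_eq]; simp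
  linarith

theorem IsApproxSol.ge_of_pos {a b T c : ℝ} {f : ℝ → ℝ} {u : ℝ → ℝ → ℝ}
    (hab : a < b) (hT : 0 < T) (hu : IsApproxSol a b T c f u) (hc1 : c ≤ 1)
    (hf : ∀ x ∈ Icc a b, c ≤ f x)
    (hpos : ∀ x ∈ Icc a b, ∀ t ∈ Icc 0 T, 0 < u x t) :
    ∀ x ∈ Icc a b, ∀ t ∈ Icc 0 T, c ≤ u x t := by
  obtain ⟨hcont, hbd, hini, v1, v2, vt, -, -, -, hder, heq⟩ := hu
  obtain ⟨⟨x₀, t₀⟩, ⟨hx₀, ht₀⟩, hmin⟩ := (isCompact_Icc.prod isCompact_Icc).exists_isMinOn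
    (⟨(a, 0), left_mem_Icc.2 hab.le, left_mem_Icc.2 hT.le⟩ :
      (Icc a b ×ˢ Icc (0:ℝ) T).Nonempty) hcont
  simp only at hx₀ ht₀
  have hmin' : ∀ x ∈ Icc a b, ∀ t ∈ Icc 0 T, u x₀ t₀ ≤ u x t := fun x hx t ht =>
    hmin (show (x, t) ∈ Icc a b ×ˢ Icc 0 T from ⟨hx, ht⟩)
  suffices h : c ≤ u x₀ t₀ from fun x hx t ht => h.trans (hmin' x hx t ht)
  by_contra! hlt
  have ht0 : 0 < t₀ := by
    rcases ht₀.1.eq_or_lt with h | h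
    · rw [← h, hini x₀ hx₀] at hlt
      exact absurd (hf x₀ hx₀) (not_le.2 hlt)
    · exact h
  have ht₀' : t₀ ∈ Ioc 0 T := ⟨ht0, ht₀.2⟩
  have hxa : a < x₀ := by
    rcases hx₀.1.eq_or_lt with h | h
    · rw [← h, (hbd t₀ ht₀').1] at hlt
      exact absurd hlt (lt_irrefl _)
    · exact h
  have hxb : x₀ < b := by
    rcases hx₀.2.eq_or_lt with h | h
    · rw [h, (hbd t₀ ht₀').2] at hlt
      exact absurd hlt (lt_irrefl _)
    · exact h
  obtain ⟨-, h2, h3⟩ := hder x₀ hx₀ t₀ ht₀'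
  have hvt : vt x₀ t₀ ≤ 0 := by
    refine deriv_nonpos_of_min_right ht0 (h3.mono Icc_subset_Iic_self |>.mono
      (Icc_subset_Icc_right ht₀.2)) fun s hs => ?_
    exact hmin' x₀ hx₀ s ⟨hs.1.le, hs.2.le.trans ht₀.2⟩
  have hnhds : Icc a b ∈ 𝓝 x₀ := Icc_mem_nhds hxa hxb
  have hv2 : 0 ≤ v2 x₀ t₀ := by
    refine second_deriv_nonneg_of_isLocalMin (f := fun y => u y t₀) (f' := fun y => v1 y t₀)
      (x := x₀) ?_ ?_ (h2.hasDerivAt hnhds)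
    · filter_upwards [hnhds] with y hy using hmin' y hy t₀ ht₀
    · filter_upwards [Ioo_mem_nhds hxa hxb] with y hy
      exact (hder y (Ioo_subset_Icc_self hy) t₀ ht₀').1.hasDerivAt (Icc_mem_nhds hy.1 hy.2)
  have hp := hpos x₀ hx₀ t₀ ht₀
  have := heq x₀ ⟨hxa, hxb⟩ t₀ ht₀'
  have : 0 < u x₀ t₀ * (v2 x₀ t₀ + 1 - u x₀ t₀) := mul_pos hp (by linarith)
  linarith

/-- The data extracted from a solution of the approximating problem that lies above its boundary
value `c`. -/
structure IsApproxReg (a b T c : ℝ) (u v : ℝ → ℝ → ℝ) : Prop where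
  cont : ContinuousOn (fun p : ℝ × ℝ => u p.1 p.2) (Icc a b ×ˢ Icc 0 T)
  cont_x : ContinuousOn (fun p : ℝ × ℝ => v p.1 p.2) (Icc a b ×ˢ Ioc 0 T)
  ge : ∀ x ∈ Icc a b, ∀ t ∈ Icc 0 T, c ≤ u x t
  bdry : ∀ t ∈ Ioc 0 T, u a t = c ∧ u b t = c
  deriv_left : ∀ t ∈ Ioc 0 T, 0 ≤ v a t
  deriv_right : ∀ t ∈ Ioc 0 T, v b t ≤ 0
  deriv_x : ∀ x ∈ Icc a b, ∀ t ∈ Ioc 0 T,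
    HasDerivWithinAt (fun y => u y t) (v x t) (Icc a b) x
  smooth : ∃ w, ∀ τ, 0 < τ → τ < T → IsSmoothSol a b τ T u v w

theorem IsApproxSol.exists_reg {a b T c : ℝ} {f : ℝ → ℝ} {u : ℝ → ℝ → ℝ}
    (hab : a < b) (hT : 0 < T) (hu : IsApproxSol a b T c f u) (hc1 : c ≤ 1)
    (hf : ∀ x ∈ Icc a b, c ≤ f x)
    (hpos : ∀ x ∈ Icc a b, ∀ t ∈ Icc 0 T, 0 < u x t) :
    ∃ v, IsApproxReg a b T c u v := by
  have hge := hu.ge_of_pos hab hT hc1 hf hpos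
  obtain ⟨hcont, hbd, hini, v1, v2, vt, hc1, hc2, -, hder, heq⟩ := hu
  refine ⟨v1, hcont, hc1, hge, hbd, fun t ht => ?_, fun t ht => ?_,
    fun x hx t ht => (hder x hx t ht).1, v2, fun τ hτ hτT => ?_⟩
  · refine deriv_nonneg_of_min_left hab (hder a (left_mem_Icc.2 hab.le) t ht).1 fun x hx => ?_
    rw [(hbd t ht).1]
    exact hge x (Ioo_subset_Icc_self hx) t (Ioc_subset_Icc_self ht)
  · refine deriv_nonpos_of_min_right hab (hder b (right_mem_Icc.2 hab.le) t ht).1 fun x hx => ?_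
    rw [(hbd t ht).2]
    exact hge x (Ioo_subset_Icc_self hx) t (Ioc_subset_Icc_self ht)
  · have hs : Icc τ T ⊆ Ioc 0 T := fun t ht => ⟨hτ.trans_le ht.1, ht.2⟩
    have hs' : Icc τ T ⊆ Icc 0 T := hs.trans Ioc_subset_Icc_self
    have hs'' : Ioc τ T ⊆ Ioc 0 T := Ioc_subset_Icc_self.trans hs
    refine ⟨hab, hτT, hcont.mono (Set.prod_mono le_rfl hs'), hc1.mono (Set.prod_mono le_rfl hs),
      hc2.mono (Set.prod_mono le_rfl hs), fun x hx t ht => hpos x hx t (hs' ht),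
      fun x hx t ht => ?_, fun x hx t ht => ?_, fun x hx t ht => ?_⟩
    · exact (hder x (Ioo_subset_Icc_self hx) t (hs'' ht)).1.hasDerivAt (Icc_mem_nhds hx.1 hx.2)
    · exact (hder x (Ioo_subset_Icc_self hx) t (hs'' ht)).2.1.hasDerivAt (Icc_mem_nhds hx.1 hx.2)
    · have ht' := hs (Ioo_subset_Icc_self ht)
      rw [← heq x hx t ht']
      exact (hder x (Ioo_subset_Icc_self hx) t ht').2.2.hasDerivAt (Iic_mem_nhds ht.2)

/-! ### Energy identity up to the initial time -/

theorem tendsto_setIntegral_moving {a b T C σ : ℝ} {h : ℝ → ℝ → ℝ}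
    (hc : ContinuousOn (fun p : ℝ × ℝ => h p.1 p.2) (Ioo a b ×ˢ Icc 0 T))
    (hC : ∀ x ∈ Ioo a b, ∀ t ∈ Icc 0 T, |h x t| ≤ C) {c d τ : ℕ → ℝ}
    (hc_ge : ∀ k, a ≤ c k) (hd_le : ∀ k, d k ≤ b) (hca : Tendsto c atTop (𝓝 a))
    (hdb : Tendsto d atTop (𝓝 b)) (hτ : ∀ k, τ k ∈ Icc 0 T) (hσ : σ ∈ Icc 0 T)
    (hτσ : Tendsto τ atTop (𝓝 σ)) :
    Tendsto (fun k => ∫ x in Ioo (c k) (d k), h x (τ k)) atTop (𝓝 (∫ x in Ioo a b, h x σ)) := by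
  have hsub : ∀ k, Ioo (c k) (d k) ⊆ Ioo a b := fun k => Ioo_subset_Ioo (hc_ge k) (hd_le k)
  have key : Tendsto (fun k => ∫ x in Ioo a b,
      (Ioo (c k) (d k)).indicator (fun x => h x (τ k)) x) atTop (𝓝 (∫ x in Ioo a b, h x σ)) := by
    refine tendsto_setIntegral_of_bounded measurableSet_Ioo (by simp)
      (Eventually.of_forall fun k => ?_) (C := C) (Eventually.of_forall fun k x hx => ?_)
      fun x hx => ?_
    · exact ((hc.slice_left (hτ k)).aestronglyMeasurable measurableSet_Ioo).indicator
        measurableSet_Ioo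
    · by_cases hxk : x ∈ Ioo (c k) (d k)
      · simpa [hxk] using hC x hx _ (hτ k)
      · simpa [hxk] using (abs_nonneg _).trans (hC x hx σ hσ)
    · have h1 : Tendsto (fun k => h x (τ k)) atTop (𝓝 (h x σ)) :=
        ((hc.slice_right hx) σ hσ).tendsto.comp
          (tendsto_nhdsWithin_iff.2 ⟨hτσ, Eventually.of_forall hτ⟩)
      refine h1.congr' ?_
      filter_upwards [hca.eventually (gt_mem_nhds hx.1), hdb.eventually (lt_mem_nhds hx.2)]
        with k h2 h3
      rw [indicator_of_mem (show x ∈ Ioo (c k) (d k) from ⟨h2, h3⟩)]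
  refine key.congr fun k => ?_
  rw [setIntegral_indicator measurableSet_Ioo, inter_eq_self_of_subset_right (hsub k)]

theorem measurableSet_QiSet (a b T : ℝ) : MeasurableSet (QiSet a b T) :=
  measurableSet_Ioo.prod measurableSet_Ioc

theorem volume_QiSet_lt_top (a b T : ℝ) : volume (QiSet a b T) < ⊤ :=
  (measure_mono (Set.prod_mono Ioo_subset_Icc_self Ioc_subset_Icc_self)).trans_lt
    (isCompact_Icc.prod isCompact_Icc).measure_lt_top

theorem exhaustion_subset {a b T c d τ : ℝ} (hc : a ≤ c) (hd : d ≤ b) (hτ : 0 ≤ τ) :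
    Ioo c d ×ˢ Ioc τ T ⊆ QiSet a b T :=
  Set.prod_mono (Ioo_subset_Ioo hc hd) (Ioc_subset_Ioc_left hτ)

theorem exhaustion_eventually_mem {a b T : ℝ} {c d τ : ℕ → ℝ} (hca : Tendsto c atTop (𝓝 a))
    (hdb : Tendsto d atTop (𝓝 b)) (hτ : Tendsto τ atTop (𝓝 0)) :
    ∀ p ∈ QiSet a b T, ∀ᶠ k in atTop, p ∈ Ioo (c k) (d k) ×ˢ Ioc (τ k) T := by
  rintro ⟨x, t⟩ ⟨hx, ht⟩
  filter_upwards [hca.eventually (gt_mem_nhds hx.1), hdb.eventually (lt_mem_nhds hx.2),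
    hτ.eventually (gt_mem_nhds ht.1)] with k h1 h2 h3
  exact ⟨⟨h1, h2⟩, h3, ht.2⟩

theorem tendsto_div_nat_add_two (C : ℝ) :
    Tendsto (fun k : ℕ => C / ((k : ℝ) + 2)) atTop (𝓝 0) :=
  tendsto_const_nhds.div_atTop
    (tendsto_atTop_add_const_right _ _ tendsto_natCast_atTop_atTop)

/-- The right-hand side of the energy identity. -/
noncomputable def energyData (a b T α : ℝ) (u : ℝ → ℝ → ℝ) : ℝ :=
  (∫ x in Ioo a b, u x 0 ^ (α + 1) / (α + 1)) - (∫ x in Ioo a b, u x T ^ (α + 1) / (α + 1))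
    + ∫ p in QiSet a b T, u p.1 p.2 ^ (α + 1) * (1 - u p.1 p.2)

theorem IsApproxReg.energy {a b T c α : ℝ} {u v : ℝ → ℝ → ℝ} (hab : a < b) (hT : 0 < T)
    (hc : 0 < c) (hu : IsApproxReg a b T c u v) (hα : -1 < α) :
    IntegrableOn (fun p : ℝ × ℝ => (α + 1) * u p.1 p.2 ^ α * v p.1 p.2 ^ 2) (QiSet a b T) ∧
    IntegrableOn (fun t => v a t - v b t) (Ioc 0 T) ∧
    (∫ p in QiSet a b T, (α + 1) * u p.1 p.2 ^ α * v p.1 p.2 ^ 2)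
      + c ^ (α + 1) * ∫ t in Ioc 0 T, (v a t - v b t) = energyData a b T α u := by
  have hα1 : 0 < α + 1 := by linarith
  have hpos : ∀ x ∈ Icc a b, ∀ t ∈ Icc 0 T, 0 < u x t := fun x hx t ht =>
    hc.trans_le (hu.ge x hx t ht)
  set τ : ℕ → ℝ := fun k => T / ((k : ℝ) + 2) with hτdef
  have hτ0 : ∀ k, 0 < τ k := fun k => by positivity
  have hτT : ∀ k, τ k < T := fun k => by
    rw [hτdef]; simp only
    rw [div_lt_iff₀ (by positivity)]
    nlinarith [(Nat.cast_nonneg k : (0:ℝ) ≤ k)]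
  have hτl : Tendsto τ atTop (𝓝 0) := tendsto_div_nat_add_two T
  obtain ⟨w, hw⟩ := hu.smooth
  have hE : ∀ k, _ := fun k => (hw (τ k) (hτ0 k) (hτT k)).energy
    (H := fun s => s ^ (α + 1) / (α + 1)) (g := fun s => s ^ (α + 1))
    (g' := fun s => (α + 1) * s ^ α)
    (fun s hs => by
      have := (Real.hasDerivAt_rpow_const (p := α + 1) (Or.inl hs.ne')).div_const (α + 1)
      refine this.congr_deriv ?_
      rw [Real.rpow_sub_one hs.ne']; field_simp)
    (fun s hs => by
      have := (Real.hasDerivAt_rpow_const (p := α + 1) (Or.inl hs.ne'))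
      simpa using this)
    (continuousOn_const.mul fun s hs =>
      (Real.continuousAt_rpow_const s α (Or.inl (ne_of_gt hs))).continuousWithinAt)
  have hbd : ∀ k, ∫ t in Ioc (τ k) T,
      (u b t ^ (α + 1) * v b t - u a t ^ (α + 1) * v a t)
        = - (c ^ (α + 1) * ∫ t in Ioc (τ k) T, (v a t - v b t)) := by
    intro k
    rw [← integral_const_mul, ← integral_neg]
    refine setIntegral_congr_fun measurableSet_Ioc fun t ht => ?_
    have ht' : t ∈ Ioc 0 T := ⟨(hτ0 k).trans ht.1, ht.2⟩
    simp only [(hu.bdry t ht').1, (hu.bdry t ht').2]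
    ring
  simp only [hbd] at hE
  have hpow : ContinuousOn (fun p : ℝ × ℝ => u p.1 p.2 ^ (α + 1)) (Icc a b ×ˢ Icc 0 T) :=
    hu.cont.rpow_const fun p hp => Or.inr hα1.le
  have hpowd : ContinuousOn (fun p : ℝ × ℝ => u p.1 p.2 ^ (α + 1) / (α + 1))
    (Icc a b ×ˢ Icc 0 T) := hpow.div_const _
  obtain ⟨C, hC⟩ := (isCompact_Icc.prod isCompact_Icc).exists_bound_of_continuousOn hpowd
  have hsub : ∀ k, Ioo a b ×ˢ Ioc (τ k) T ⊆ QiSet a b T := fun k =>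
    exhaustion_subset le_rfl le_rfl (hτ0 k).le
  have hev := exhaustion_eventually_mem (T := T) (tendsto_const_nhds (x := a) (f := atTop (α := ℕ)))
    (tendsto_const_nhds (x := b)) hτl
  have hmeas : ∀ k, MeasurableSet (Ioo a b ×ˢ Ioc (τ k) T) := fun k =>
    measurableSet_Ioo.prod measurableSet_Ioc
  have hlim1 := tendsto_setIntegral_moving
    (h := fun x t => u x t ^ (α + 1) / (α + 1)) (C := C) (σ := 0)
    (hpowd.mono (Set.prod_mono Ioo_subset_Icc_self le_rfl))
    (fun x hx t ht => hC (x, t) ⟨Ioo_subset_Icc_self hx, ht⟩)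
    (c := fun _ => a) (d := fun _ => b) (fun _ => le_rfl) (fun _ => le_rfl) tendsto_const_nhds
    tendsto_const_nhds (fun k => ⟨(hτ0 k).le, (hτT k).le⟩) (left_mem_Icc.2 hT.le) hτl
  have hlim2 := tendsto_setIntegral_of_exhaustion (measurableSet_QiSet a b T) hmeas hsub hev
    (μ := volume) (f := fun p : ℝ × ℝ => u p.1 p.2 ^ (α + 1) * (1 - u p.1 p.2))
    ((hpow.mul (continuousOn_const.sub hu.cont)).integrableOn_rect)
  have hlim : Tendsto (fun k => (∫ p in Ioo a b ×ˢ Ioc (τ k) T,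
      (α + 1) * u p.1 p.2 ^ α * v p.1 p.2 ^ 2)
      + c ^ (α + 1) * ∫ t in Ioc (τ k) T, (v a t - v b t)) atTop (𝓝 (energyData a b T α u)) := by
    refine ((hlim1.sub_const _).add hlim2).congr fun k => ?_
    rw [hE k]; ring
  have hEnn : ∀ p ∈ QiSet a b T, 0 ≤ (α + 1) * u p.1 p.2 ^ α * v p.1 p.2 ^ 2 := fun p hp => by
    have := hpos p.1 (Ioo_subset_Icc_self hp.1) p.2 (Ioc_subset_Icc_self hp.2)
    positivity
  have hBnn : ∀ t ∈ Ioc 0 T, 0 ≤ v a t - v b t := fun t ht => by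
    have := hu.deriv_left t ht
    have := hu.deriv_right t ht
    linarith
  have hcp : 0 < c ^ (α + 1) := by positivity
  have hI1 : ∀ k, 0 ≤ ∫ p in Ioo a b ×ˢ Ioc (τ k) T,
      (α + 1) * u p.1 p.2 ^ α * v p.1 p.2 ^ 2 := fun k =>
    setIntegral_nonneg (hmeas k) fun p hp => hEnn p (hsub k hp)
  have hsub' : ∀ k, Ioc (τ k) T ⊆ Ioc 0 T := fun k => Ioc_subset_Ioc_left (hτ0 k).le
  have hI2 : ∀ k, 0 ≤ ∫ t in Ioc (τ k) T, (v a t - v b t) := fun k =>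
    setIntegral_nonneg measurableSet_Ioc fun t ht => hBnn t (hsub' k ht)
  have hbound := hlim.eventually (gt_mem_nhds (lt_add_one (energyData a b T α u)))
  have hev' : ∀ t ∈ Ioc 0 T, ∀ᶠ k in atTop, t ∈ Ioc (τ k) T := fun t ht => by
    filter_upwards [hτl.eventually (gt_mem_nhds ht.1)] with k hk using ⟨hk, ht.2⟩
  have int1 : IntegrableOn (fun p : ℝ × ℝ => (α + 1) * u p.1 p.2 ^ α * v p.1 p.2 ^ 2)
      (QiSet a b T) := by
    refine integrableOn_of_exhaustion (measurableSet_QiSet a b T) hmeas hsub hev (fun k => ?_)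
      hEnn (C := energyData a b T α u + 1) ?_
    · refine ContinuousOn.integrableOn_rect ?_
      have hs := hw (τ k) (hτ0 k) (hτT k)
      exact (continuousOn_const.mul (hs.cont.rpow_const fun p hp =>
        Or.inl (hs.pos _ hp.1 _ hp.2).ne')).mul (hs.cont_x.pow 2)
    · filter_upwards [hbound] with k hk
      nlinarith [mul_nonneg hcp.le (hI2 k)]
  have int2 : IntegrableOn (fun t => v a t - v b t) (Ioc 0 T) := by
    refine integrableOn_of_exhaustion measurableSet_Ioc (fun _ => measurableSet_Ioc) hsub' hev'
      (fun k => ?_) hBnn (C := (energyData a b T α u + 1) / c ^ (α + 1)) ?_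
    · have hs := hw (τ k) (hτ0 k) (hτT k)
      exact ((hs.cont_x.slice_right (left_mem_Icc.2 hab.le)).sub
        (hs.cont_x.slice_right (right_mem_Icc.2 hab.le))).integrableOn_Ioc'
    · filter_upwards [hbound] with k hk
      rw [le_div_iff₀ hcp]
      nlinarith [hI1 k]
  refine ⟨int1, int2, tendsto_nhds_unique ?_ hlim⟩
  exact (tendsto_setIntegral_of_exhaustion (measurableSet_QiSet a b T) hmeas hsub hev int1).add
    ((tendsto_setIntegral_of_exhaustion measurableSet_Ioc (fun _ => measurableSet_Ioc) hsub' hev'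
      int2).const_mul _)

theorem tendsto_energyData {a b T α M : ℝ} (hT : 0 < T) (hα : -1 < α) {U : ℕ → ℝ → ℝ → ℝ}
    {u : ℝ → ℝ → ℝ}
    (hcont : ∀ᶠ n in atTop,
      ContinuousOn (fun p : ℝ × ℝ => U n p.1 p.2) (Icc a b ×ˢ Icc 0 T))
    (hbd : ∀ᶠ n in atTop, ∀ x ∈ Icc a b, ∀ t ∈ Icc 0 T, 0 ≤ U n x t ∧ U n x t ≤ M)
    (hlim : ∀ x ∈ Icc a b, ∀ t ∈ Icc 0 T, Tendsto (fun n => U n x t) atTop (𝓝 (u x t))) :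
    Tendsto (fun n => energyData a b T α (U n)) atTop (𝓝 (energyData a b T α u)) := by
  have hα1 : 0 < α + 1 := by linarith
  have hslice : ∀ t ∈ Icc 0 T, Tendsto (fun n => ∫ x in Ioo a b, U n x t ^ (α + 1) / (α + 1))
      atTop (𝓝 (∫ x in Ioo a b, u x t ^ (α + 1) / (α + 1))) := by
    intro t ht
    refine tendsto_setIntegral_of_bounded measurableSet_Ioo (by simp) ?_
      (C := M ^ (α + 1) / (α + 1)) ?_ fun x hx => ?_
    · filter_upwards [hcont] with n hn
      exact ((((hn.slice_left ht).rpow_const fun _ _ => Or.inr hα1.le).div_const _).mono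
        Ioo_subset_Icc_self).aestronglyMeasurable measurableSet_Ioo
    · filter_upwards [hbd] with n hn x hx
      obtain ⟨h0, h1⟩ := hn x (Ioo_subset_Icc_self hx) t ht
      rw [abs_of_nonneg (by positivity)]
      gcongr
    · exact ((hlim x (Ioo_subset_Icc_self hx) t ht).rpow_const (Or.inr hα1.le)).div_const _
  refine ((hslice 0 (left_mem_Icc.2 hT.le)).sub (hslice T (right_mem_Icc.2 hT.le))).add ?_
  have hQ : QiSet a b T ⊆ Icc a b ×ˢ Icc 0 T :=
    Set.prod_mono Ioo_subset_Icc_self Ioc_subset_Icc_self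
  refine tendsto_setIntegral_of_bounded (measurableSet_QiSet a b T) (volume_QiSet_lt_top a b T) ?_
    (C := M ^ (α + 1) * (1 + M)) ?_ fun p hp => ?_
  · filter_upwards [hcont] with n hn
    exact (((hn.rpow_const fun _ _ => Or.inr hα1.le).mul (continuousOn_const.sub hn)).mono
      hQ).aestronglyMeasurable (measurableSet_QiSet a b T)
  · filter_upwards [hbd] with n hn p hp
    obtain ⟨h0, h1⟩ := hn p.1 (hQ hp).1 p.2 (hQ hp).2
    rw [abs_mul, abs_of_nonneg (by positivity : 0 ≤ U n p.1 p.2 ^ (α + 1))]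
    have h2 : |1 - U n p.1 p.2| ≤ 1 + M := abs_le.2 ⟨by linarith, by linarith⟩
    have h3 : U n p.1 p.2 ^ (α + 1) ≤ M ^ (α + 1) := by gcongr
    have h4 : 0 ≤ M ^ (α + 1) := Real.rpow_nonneg (h0.trans h1) _
    exact mul_le_mul h3 h2 (abs_nonneg _) h4
  · have := hlim p.1 (hQ hp).1 p.2 (hQ hp).2
    exact (this.rpow_const (Or.inr hα1.le)).mul (tendsto_const_nhds.sub this)

/-! ### Truncated powers -/

theorem hasDerivAt_max_pow (k : ℕ) (ε s : ℝ) :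
    HasDerivAt (fun s => max (s - ε) 0 ^ (k + 2)) ((k + 2) * max (s - ε) 0 ^ (k + 1)) s := by
  rcases lt_trichotomy s ε with h | h | h
  · have : (fun s => max (s - ε) 0 ^ (k + 2)) =ᶠ[𝓝 s] fun _ => 0 := by
      filter_upwards [gt_mem_nhds h] with y hy
      rw [max_eq_right (by linarith)]; simp
    refine ((hasDerivAt_const s (0:ℝ)).congr_of_eventuallyEq this).congr_deriv ?_
    rw [max_eq_right (by linarith)]; simp
  · subst h
    simp only [sub_self, max_self]
    rw [hasDerivAt_iff_tendsto_slope]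
    have hb : Tendsto (fun y : ℝ => |y - s| ^ (k + 1)) (𝓝[≠] s) (𝓝 0) := by
      have : Continuous fun y : ℝ => |y - s| ^ (k + 1) := by fun_prop
      have h2 := this.tendsto s
      simp only [sub_self, abs_zero, ne_eq, Nat.add_eq_zero_iff, one_ne_zero, and_false,
        not_false_eq_true, zero_pow] at h2
      exact h2.mono_left nhdsWithin_le_nhds
    rw [show ((k:ℝ) + 2) * 0 ^ (k + 1) = 0 by simp]
    refine squeeze_zero_norm' ?_ hb
    filter_upwards [self_mem_nhdsWithin] with y hy
    have hy' : 0 < |y - s| := abs_pos.2 (sub_ne_zero.2 hy)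
    rw [slope_def_field, Real.norm_eq_abs, abs_div, div_le_iff₀ hy']
    simp only [sub_self, max_self, ne_eq, Nat.add_eq_zero_iff, OfNat.ofNat_ne_zero, and_false,
      not_false_eq_true, zero_pow, sub_zero]
    rw [← pow_succ, abs_pow]
    have : |max (y - s) 0| ≤ |y - s| := by
      rw [abs_of_nonneg (le_max_right _ _)]
      exact max_le (le_abs_self _) (abs_nonneg _)
    exact pow_le_pow_left₀ (abs_nonneg _) this _
  · have : (fun s => max (s - ε) 0 ^ (k + 2)) =ᶠ[𝓝 s] fun s => (s - ε) ^ (k + 2) := by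
      filter_upwards [lt_mem_nhds h] with y hy
      rw [max_eq_left (by linarith)]
    have h2 := ((hasDerivAt_id s).sub_const ε).pow (k + 2)
    refine (h2.congr_of_eventuallyEq this).congr_deriv ?_
    rw [max_eq_left (by linarith)]; simp

/-- A truncation of `s ^ (α + 1) / (α + 1)` vanishing for `s ≤ ε`. -/
noncomputable def truncH (α ε s : ℝ) : ℝ := s ^ (α - 2) * max (s - ε) 0 ^ 3 / (α + 1)

/-- The product of `s` and the derivative of `truncH`, a truncation of `s ^ (α + 1)`. -/
noncomputable def truncG (α ε s : ℝ) : ℝ :=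
  ((α - 2) * (s ^ (α - 2) * max (s - ε) 0 ^ 3) + 3 * (s ^ (α - 1) * max (s - ε) 0 ^ 2)) / (α + 1)

/-- The derivative of `truncG`, a truncation of `(α + 1) * s ^ α`. -/
noncomputable def truncG' (α ε s : ℝ) : ℝ :=
  ((α - 2) ^ 2 * (s ^ (α - 3) * max (s - ε) 0 ^ 3)
    + (6 * α - 9) * (s ^ (α - 2) * max (s - ε) 0 ^ 2)
    + 6 * (s ^ (α - 1) * max (s - ε) 0 ^ 1)) / (α + 1)

theorem hasDerivAt_truncH {α ε s : ℝ} (hs : 0 < s) :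
    HasDerivAt (truncH α ε) (truncG α ε s / s) s := by
  have h1 := Real.hasDerivAt_rpow_const (p := α - 2) (Or.inl hs.ne')
  have h := (h1.mul (hasDerivAt_max_pow 1 ε s)).div_const (α + 1)
  refine h.congr_deriv ?_
  rw [truncG, Real.rpow_sub_one hs.ne', show α - 1 = α - 2 + 1 by ring, Real.rpow_add_one hs.ne']
  push_cast
  field_simp
  ring

theorem hasDerivAt_truncG {α ε s : ℝ} (hs : 0 < s) :
    HasDerivAt (truncG α ε) (truncG' α ε s) s := by
  have h1 := Real.hasDerivAt_rpow_const (p := α - 2) (Or.inl hs.ne')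
  have h2 := Real.hasDerivAt_rpow_const (p := α - 1) (Or.inl hs.ne')
  have h := (((h1.mul (hasDerivAt_max_pow 1 ε s)).const_mul (α - 2)).add
    ((h2.mul (hasDerivAt_max_pow 0 ε s)).const_mul 3)).div_const (α + 1)
  refine h.congr_deriv ?_
  rw [truncG', show α - 2 - 1 = α - 3 by ring, show α - 1 - 1 = α - 2 by ring]
  push_cast
  ring

theorem continuousOn_truncG' (α ε : ℝ) : ContinuousOn (truncG' α ε) (Ioi 0) := by
  have h : ∀ β : ℝ, ContinuousOn (fun s : ℝ => s ^ β) (Ioi 0) := fun β s hs =>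
    (Real.continuousAt_rpow_const s β (Or.inl (ne_of_gt hs))).continuousWithinAt
  have hm : ∀ k : ℕ, ContinuousOn (fun s : ℝ => max (s - ε) 0 ^ k) (Ioi 0) := fun k =>
    Continuous.continuousOn (by fun_prop)
  exact (((((h _).mul (hm 3)).const_smul ((α - 2) ^ 2)).add
    (((h _).mul (hm 2)).const_smul (6 * α - 9))).add
    (((h _).mul (hm 1)).const_smul (6 : ℝ))).div_const _

theorem truncG_eq_zero {α ε s : ℝ} (h : s ≤ ε) : truncG α ε s = 0 := by
  rw [truncG, max_eq_right (by linarith)]; simp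

theorem rpow_mul_max_pow_le {β ε s : ℝ} (hs : 0 < s) (hε : 0 ≤ ε) (k : ℕ) :
    |s ^ (β - k) * max (s - ε) 0 ^ k| ≤ s ^ β := by
  have hm : max (s - ε) 0 ≤ s := max_le (by linarith) hs.le
  have hm0 : 0 ≤ max (s - ε) 0 := le_max_right _ _
  rw [abs_of_nonneg (by positivity), Real.rpow_sub_natCast hs.ne', div_mul_eq_mul_div,
    div_le_iff₀ (by positivity)]
  gcongr

theorem tendsto_rpow_mul_max_pow {β s : ℝ} (hs : 0 < s) (k : ℕ) {ε : ℕ → ℝ}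
    (hε : Tendsto ε atTop (𝓝 0)) :
    Tendsto (fun j => s ^ (β - k) * max (s - ε j) 0 ^ k) atTop (𝓝 (s ^ β)) := by
  have h1 : Tendsto (fun j => max (s - ε j) 0) atTop (𝓝 s) := by
    have := (tendsto_const_nhds (x := s)).sub hε |>.max (tendsto_const_nhds (x := (0:ℝ)))
    simpa [hs.le] using this
  have h2 := (h1.pow k).const_mul (s ^ (β - k))
  rw [Real.rpow_sub_natCast hs.ne', div_mul_cancel₀ _ (by positivity)] at h2
  simpa only [Real.rpow_sub_natCast hs.ne'] using h2

theorem abs_truncH_le {α ε s : ℝ} (hα : -1 < α) (hs : 0 < s) (hε : 0 ≤ ε) :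
    |truncH α ε s| ≤ s ^ (α + 1) / (α + 1) := by
  have hα1 : 0 < α + 1 := by linarith
  have h := rpow_mul_max_pow_le (β := α + 1) hs hε 3
  rw [truncH, abs_div, abs_of_pos hα1]
  rw [show α + 1 - (3 : ℕ) = α - 2 by push_cast; ring] at h
  gcongr

theorem abs_truncG_le {α ε s : ℝ} (hα : -1 < α) (hs : 0 < s) (hε : 0 ≤ ε) :
    |truncG α ε s| ≤ (|α - 2| + 3) / (α + 1) * s ^ (α + 1) := by
  have hα1 : 0 < α + 1 := by linarith
  have h3 := rpow_mul_max_pow_le (β := α + 1) hs hε 3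
  have h2 := rpow_mul_max_pow_le (β := α + 1) hs hε 2
  rw [show α + 1 - (3 : ℕ) = α - 2 by push_cast; ring] at h3
  rw [show α + 1 - (2 : ℕ) = α - 1 by push_cast; ring] at h2
  rw [truncG, abs_div, abs_of_pos hα1, div_mul_eq_mul_div]
  gcongr
  refine (abs_add_le _ _).trans ?_
  rw [abs_mul (α - 2), abs_mul 3, add_mul, abs_of_pos (by norm_num : (0:ℝ) < 3)]
  gcongr

theorem abs_truncG'_le {α ε s : ℝ} (hα : -1 < α) (hs : 0 < s) (hε : 0 ≤ ε) :
    |truncG' α ε s| ≤ ((α - 2) ^ 2 + |6 * α - 9| + 6) / (α + 1) * s ^ α := by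
  have hα1 : 0 < α + 1 := by linarith
  have h3 := rpow_mul_max_pow_le (β := α) hs hε 3
  have h2 := rpow_mul_max_pow_le (β := α) hs hε 2
  have h1 := rpow_mul_max_pow_le (β := α) hs hε 1
  push_cast at h1 h2 h3
  rw [truncG', abs_div, abs_of_pos hα1, div_mul_eq_mul_div]
  gcongr
  refine (abs_add_three _ _ _).trans ?_
  rw [abs_mul ((α - 2) ^ 2), abs_mul (6 * α - 9), abs_mul 6, add_mul, add_mul, abs_of_pos (by norm_num : (0:ℝ) < 6),
    abs_of_nonneg (sq_nonneg (α - 2))]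
  gcongr

theorem tendsto_truncH {α s : ℝ} (hs : 0 < s) {ε : ℕ → ℝ} (hε : Tendsto ε atTop (𝓝 0)) :
    Tendsto (fun j => truncH α (ε j) s) atTop (𝓝 (s ^ (α + 1) / (α + 1))) := by
  have h3 := tendsto_rpow_mul_max_pow (β := α + 1) hs 3 hε
  rw [show α + 1 - (3 : ℕ) = α - 2 by push_cast; ring] at h3
  exact h3.div_const _

theorem tendsto_truncG {α s : ℝ} (hα : -1 < α) (hs : 0 < s) {ε : ℕ → ℝ}
    (hε : Tendsto ε atTop (𝓝 0)) :
    Tendsto (fun j => truncG α (ε j) s) atTop (𝓝 (s ^ (α + 1))) := by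
  have hα1 : α + 1 ≠ 0 := by linarith
  have h3 := tendsto_rpow_mul_max_pow (β := α + 1) hs 3 hε
  have h2 := tendsto_rpow_mul_max_pow (β := α + 1) hs 2 hε
  rw [show α + 1 - (3 : ℕ) = α - 2 by push_cast; ring] at h3
  rw [show α + 1 - (2 : ℕ) = α - 1 by push_cast; ring] at h2
  have h := ((h3.const_mul (α - 2)).add (h2.const_mul 3)).div_const (α + 1)
  rwa [show ((α - 2) * s ^ (α + 1) + 3 * s ^ (α + 1)) / (α + 1) = s ^ (α + 1) by
    field_simp; ring] at h

theorem tendsto_truncG' {α s : ℝ} (hα : -1 < α) (hs : 0 < s) {ε : ℕ → ℝ}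
    (hε : Tendsto ε atTop (𝓝 0)) :
    Tendsto (fun j => truncG' α (ε j) s) atTop (𝓝 ((α + 1) * s ^ α)) := by
  have hα1 : α + 1 ≠ 0 := by linarith
  have h3 := tendsto_rpow_mul_max_pow (β := α) hs 3 hε
  have h2 := tendsto_rpow_mul_max_pow (β := α) hs 2 hε
  have h1 := tendsto_rpow_mul_max_pow (β := α) hs 1 hε
  push_cast at h1 h2 h3
  have h := (((h3.const_mul ((α - 2) ^ 2)).add (h2.const_mul (6 * α - 9))).add
    (h1.const_mul 6)).div_const (α + 1)
  rwa [show ((α - 2) ^ 2 * s ^ α + (6 * α - 9) * s ^ α + 6 * s ^ α) / (α + 1)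
    = (α + 1) * s ^ α by field_simp; ring] at h

/-! ### The degenerate limit -/

/-- The data extracted from a positive classical solution of the degenerate problem. -/
structure IsDegReg (a b T : ℝ) (u ux uxx : ℝ → ℝ → ℝ) : Prop where
  cont : ContinuousOn (fun p : ℝ × ℝ => u p.1 p.2) (Icc a b ×ˢ Icc 0 T)
  bdry : ∀ t ∈ Icc 0 T, u a t = 0 ∧ u b t = 0
  pos : ∀ x ∈ Ioo a b, ∀ t ∈ Icc 0 T, 0 < u x t
  cont_x : ContinuousOn (fun p : ℝ × ℝ => ux p.1 p.2) (QiSet a b T)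
  deriv_x : ∀ x ∈ Ioo a b, ∀ t ∈ Ioc 0 T, HasDerivAt (fun y => u y t) (ux x t) x
  smooth : ∀ c d τ, a < c → c < d → d < b → 0 < τ → τ < T → IsSmoothSol c d τ T u ux uxx

theorem IsDegSol.exists_reg {a b T : ℝ} {f : ℝ → ℝ} {u : ℝ → ℝ → ℝ} (hab : a < b)
    (hu : IsDegSol a b T f u) (hf : ∀ x ∈ Ioo a b, 0 < f x) (hfa : f a = 0) (hfb : f b = 0) :
    ∃ ux uxx, IsDegReg a b T u ux uxx := by
  obtain ⟨hcont, hbd, hini, hpos, hder, hcx, hcxx, -⟩ := hu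
  have hpos' : ∀ x ∈ Ioo a b, ∀ t ∈ Icc 0 T, 0 < u x t := fun x hx t ht => by
    rcases ht.1.eq_or_lt with h | h
    · rw [← h, hini x (Ioo_subset_Icc_self hx)]; exact hf x hx
    · exact hpos x hx t ⟨h, ht.2⟩
  refine ⟨fun x t => deriv (fun z => u z t) x,
    fun x t => deriv (fun y => deriv (fun z => u z t) y) x, hcont, fun t ht => ?_, hpos', hcx,
    fun x hx t ht => (hder x hx t ht).1.hasDerivAt, fun c d τ hc hcd hd hτ hτT => ?_⟩
  · rcases ht.1.eq_or_lt with h | h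
    · rw [← h, hini a (left_mem_Icc.2 hab.le), hini b (right_mem_Icc.2 hab.le)]
      exact ⟨hfa, hfb⟩
    · exact hbd t ⟨h, ht.2⟩
  · have hx : Icc c d ⊆ Ioo a b := fun x hx => ⟨hc.trans_le hx.1, hx.2.trans_lt hd⟩
    have ht : Icc τ T ⊆ Ioc 0 T := fun t ht => ⟨hτ.trans_le ht.1, ht.2⟩
    have hsub : Icc c d ×ˢ Icc τ T ⊆ QiSet a b T := Set.prod_mono hx ht
    refine ⟨hcd, hτT, hcont.mono (Set.prod_mono (hx.trans Ioo_subset_Icc_self)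
      (ht.trans Ioc_subset_Icc_self)), hcx.mono hsub, hcxx.mono hsub,
      fun x hxx t htt => hpos x (hx hxx) t (ht htt),
      fun x hxx t htt => ?_, fun x hxx t htt => ?_, fun x hxx t htt => ?_⟩
    · exact (hder x (hx (Ioo_subset_Icc_self hxx)) t (ht (Ioc_subset_Icc_self htt))).1.hasDerivAt
    · exact (hder x (hx (Ioo_subset_Icc_self hxx)) t
        (ht (Ioc_subset_Icc_self htt))).2.1.hasDerivAt
    · obtain ⟨-, -, h3, h4⟩ := hder x (hx (Ioo_subset_Icc_self hxx)) t
        (ht (Ioo_subset_Icc_self htt))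
      have := h3.hasDerivWithinAt.hasDerivAt (Iic_mem_nhds htt.2)
      rw [h4] at this
      refine this.congr_deriv ?_
      ring

/-- Parameters of an exhaustion of `QiSet a b T` by compactly contained rectangles. -/
theorem exists_exhaustion {a b T : ℝ} (hab : a < b) (hT : 0 < T) :
    ∃ c d τ : ℕ → ℝ, (∀ k, a < c k ∧ c k < d k ∧ d k < b ∧ 0 < τ k ∧ τ k < T) ∧
      Tendsto c atTop (𝓝 a) ∧ Tendsto d atTop (𝓝 b) ∧ Tendsto τ atTop (𝓝 0) := by
  have h0 := tendsto_div_nat_add_two ((b - a) / 3)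
  refine ⟨fun k => a + (b - a) / 3 / ((k : ℝ) + 2), fun k => b - (b - a) / 3 / ((k : ℝ) + 2),
    fun k => T / ((k : ℝ) + 2), fun k => ?_, by simpa using h0.const_add a,
    by simpa using h0.const_sub b, tendsto_div_nat_add_two T⟩
  have hk : (2:ℝ) ≤ (k : ℝ) + 2 := by linarith [(Nat.cast_nonneg k : (0:ℝ) ≤ k)]
  have h1 : 0 < (b - a) / 3 := by linarith
  have h2 : 0 < (b - a) / 3 / ((k : ℝ) + 2) := by positivity
  have h3 : (b - a) / 3 / ((k : ℝ) + 2) < (b - a) / 3 := div_lt_self h1 (by linarith)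
  exact ⟨by linarith, by linarith, by linarith, by positivity, div_lt_self hT (by linarith)⟩

theorem IsDegReg.eventually_small {a b T : ℝ} {u ux uxx : ℝ → ℝ → ℝ} (hu : IsDegReg a b T u ux uxx)
    {z : ℝ} (hz : z ∈ Icc a b) (hz0 : ∀ t ∈ Icc 0 T, u z t = 0) {c : ℕ → ℝ}
    (hc : ∀ k, c k ∈ Icc a b) (hcz : Tendsto c atTop (𝓝 z)) {ε : ℝ} (hε : 0 < ε) :
    ∀ᶠ k in atTop, ∀ t ∈ Icc 0 T, u (c k) t ≤ ε := by
  have huc := (isCompact_Icc.prod isCompact_Icc).uniformContinuousOn_of_continuous hu.cont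
  rw [Metric.uniformContinuousOn_iff] at huc
  obtain ⟨δ, hδ, h⟩ := huc ε hε
  filter_upwards [hcz.eventually (Metric.ball_mem_nhds z hδ)] with k hk t ht
  have := h (c k, t) ⟨hc k, ht⟩ (z, t) ⟨hz, ht⟩ (by
    rw [Prod.dist_eq]; exact max_lt hk (by simpa using hδ))
  simp only [hz0 t ht, Real.dist_eq, sub_zero] at this
  exact (le_abs_self _).trans this.le

theorem IsDegReg.energy_trunc {a b T α M ε : ℝ} {u ux uxx : ℝ → ℝ → ℝ} (hab : a < b)
    (hT : 0 < T) (hα : -1 < α) (hε : 0 < ε) (hu : IsDegReg a b T u ux uxx)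
    (hM : ∀ x ∈ Ioo a b, ∀ t ∈ Icc 0 T, u x t ≤ M)
    (hint : IntegrableOn (fun p : ℝ × ℝ => u p.1 p.2 ^ α * ux p.1 p.2 ^ 2) (QiSet a b T)) :
    ∫ p in QiSet a b T, truncG' α ε (u p.1 p.2) * ux p.1 p.2 ^ 2
      = (∫ x in Ioo a b, truncH α ε (u x 0)) - (∫ x in Ioo a b, truncH α ε (u x T))
        + ∫ p in QiSet a b T, truncG α ε (u p.1 p.2) * (1 - u p.1 p.2) := by
  have hα1 : 0 < α + 1 := by linarith
  obtain ⟨c, d, τ, hcdτ, hca, hdb, hτ0⟩ := exists_exhaustion hab hT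
  have hE := fun k => (hu.smooth (c k) (d k) (τ k) (hcdτ k).1 (hcdτ k).2.1 (hcdτ k).2.2.1
    (hcdτ k).2.2.2.1 (hcdτ k).2.2.2.2).energy (fun s hs => hasDerivAt_truncH (α := α) (ε := ε) hs)
    (fun s hs => hasDerivAt_truncG hs) (continuousOn_truncG' α ε)
  have hQm := measurableSet_QiSet a b T
  have hmeas : ∀ k, MeasurableSet (Ioo (c k) (d k) ×ˢ Ioc (τ k) T) := fun k =>
    measurableSet_Ioo.prod measurableSet_Ioc
  have hsub : ∀ k, Ioo (c k) (d k) ×ˢ Ioc (τ k) T ⊆ QiSet a b T := fun k =>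
    exhaustion_subset (hcdτ k).1.le (hcdτ k).2.2.1.le (hcdτ k).2.2.2.1.le
  have hev := exhaustion_eventually_mem (T := T) hca hdb hτ0
  have hQpos : ∀ p ∈ QiSet a b T, 0 < u p.1 p.2 := fun p hp =>
    hu.pos p.1 hp.1 p.2 (Ioc_subset_Icc_self hp.2)
  have hQc : ContinuousOn (fun p : ℝ × ℝ => u p.1 p.2) (QiSet a b T) :=
    hu.cont.mono (Set.prod_mono Ioo_subset_Icc_self Ioc_subset_Icc_self)
  have hHc : ContinuousOn (truncH α ε) (Ioi 0) := fun s hs =>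
    (hasDerivAt_truncH hs).continuousAt.continuousWithinAt
  have hGc : ContinuousOn (truncG α ε) (Ioi 0) := fun s hs =>
    (hasDerivAt_truncG hs).continuousAt.continuousWithinAt
  have i1 : IntegrableOn (fun p : ℝ × ℝ => truncG' α ε (u p.1 p.2) * ux p.1 p.2 ^ 2)
      (QiSet a b T) := by
    refine (hint.const_mul (((α - 2) ^ 2 + |6 * α - 9| + 6) / (α + 1))).mono'
      ((((continuousOn_truncG' α ε).comp hQc hQpos).mul
        (hu.cont_x.pow 2)).aestronglyMeasurable hQm) ?_
    filter_upwards [ae_restrict_mem hQm] with p hp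
    rw [Real.norm_eq_abs, abs_mul, abs_of_nonneg (sq_nonneg (ux p.1 p.2)), ← mul_assoc]
    exact mul_le_mul_of_nonneg_right (abs_truncG'_le hα (hQpos p hp) hε.le) (sq_nonneg _)
  have i2 : IntegrableOn (fun p : ℝ × ℝ => truncG α ε (u p.1 p.2) * (1 - u p.1 p.2))
      (QiSet a b T) := by
    refine IntegrableOn.of_bound (volume_QiSet_lt_top a b T)
      (((hGc.comp hQc hQpos).mul (continuousOn_const.sub hQc)).aestronglyMeasurable hQm)
      ((|α - 2| + 3) / (α + 1) * M ^ (α + 1) * (1 + M)) ?_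
    filter_upwards [ae_restrict_mem hQm] with p hp
    have hp0 := hQpos p hp
    have hpM := hM p.1 hp.1 p.2 (Ioc_subset_Icc_self hp.2)
    rw [Real.norm_eq_abs, abs_mul]
    have h2 : |1 - u p.1 p.2| ≤ 1 + M := abs_le.2 ⟨by linarith, by linarith⟩
    have h3 := abs_truncG_le hα hp0 hε.le
    have h4 : u p.1 p.2 ^ (α + 1) ≤ M ^ (α + 1) := by gcongr
    have h5 : 0 < M := hp0.trans_le hpM
    exact mul_le_mul (h3.trans (by gcongr)) h2 (abs_nonneg _) (by positivity)
  have l1 := tendsto_setIntegral_of_exhaustion hQm hmeas hsub hev i1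
  have l2 := tendsto_setIntegral_of_exhaustion hQm hmeas hsub hev i2
  have hbound : ∀ x ∈ Ioo a b, ∀ t ∈ Icc 0 T,
      |truncH α ε (u x t)| ≤ M ^ (α + 1) / (α + 1) := fun x hx t ht => by
    refine (abs_truncH_le hα (hu.pos x hx t ht) hε.le).trans ?_
    have := (hu.pos x hx t ht).le
    have := hM x hx t ht
    gcongr
  have hHcu : ContinuousOn (fun p : ℝ × ℝ => truncH α ε (u p.1 p.2)) (Ioo a b ×ˢ Icc 0 T) :=
    hHc.comp (hu.cont.mono (Set.prod_mono Ioo_subset_Icc_self le_rfl))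
      fun p hp => hu.pos p.1 hp.1 p.2 hp.2
  have l3 := tendsto_setIntegral_moving (h := fun x t => truncH α ε (u x t)) hHcu hbound
    (fun k => (hcdτ k).1.le) (fun k => (hcdτ k).2.2.1.le) hca hdb
    (fun k => ⟨(hcdτ k).2.2.2.1.le, (hcdτ k).2.2.2.2.le⟩) (left_mem_Icc.2 hT.le) hτ0
  have l4 := tendsto_setIntegral_moving (h := fun x t => truncH α ε (u x t)) hHcu hbound
    (fun k => (hcdτ k).1.le) (fun k => (hcdτ k).2.2.1.le) hca hdb
    (fun _ => right_mem_Icc.2 hT.le) (right_mem_Icc.2 hT.le) tendsto_const_nhds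
  have s1 := hu.eventually_small (left_mem_Icc.2 hab.le) (fun t ht => (hu.bdry t ht).1)
    (fun k => ⟨(hcdτ k).1.le, ((hcdτ k).2.1.trans (hcdτ k).2.2.1).le⟩) hca hε
  have s2 := hu.eventually_small (right_mem_Icc.2 hab.le) (fun t ht => (hu.bdry t ht).2)
    (fun k => ⟨((hcdτ k).1.trans (hcdτ k).2.1).le, (hcdτ k).2.2.1.le⟩) hdb hε
  refine tendsto_nhds_unique l1 (((l3.sub l4).add l2).congr' ?_)
  filter_upwards [s1, s2] with k h1 h2
  have hz : ∫ t in Ioc (τ k) T, (truncG α ε (u (d k) t) * ux (d k) t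
      - truncG α ε (u (c k) t) * ux (c k) t) = 0 := by
    refine setIntegral_eq_zero_of_forall_eq_zero fun t ht => ?_
    have ht' : t ∈ Icc 0 T := ⟨(hcdτ k).2.2.2.1.le.trans ht.1.le, ht.2⟩
    simp [truncG_eq_zero (h1 t ht'), truncG_eq_zero (h2 t ht')]
  rw [hE k, hz, add_zero]

theorem IsDegReg.energy {a b T α M : ℝ} {u ux uxx : ℝ → ℝ → ℝ} (hab : a < b)
    (hT : 0 < T) (hα : -1 < α) (hu : IsDegReg a b T u ux uxx)
    (hM : ∀ x ∈ Ioo a b, ∀ t ∈ Icc 0 T, u x t ≤ M)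
    (hint : IntegrableOn (fun p : ℝ × ℝ => u p.1 p.2 ^ α * ux p.1 p.2 ^ 2) (QiSet a b T)) :
    ∫ p in QiSet a b T, (α + 1) * u p.1 p.2 ^ α * ux p.1 p.2 ^ 2 = energyData a b T α u := by
  have hα1 : 0 < α + 1 := by linarith
  set ε : ℕ → ℝ := fun j => 1 / ((j : ℝ) + 2) with hεdef
  have hε : ∀ j, 0 < ε j := fun j => by positivity
  have hε0 : Tendsto ε atTop (𝓝 0) := tendsto_div_nat_add_two 1
  have hE := fun j => hu.energy_trunc hab hT hα (hε j) hM hint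
  have hQm := measurableSet_QiSet a b T
  have hQpos : ∀ p ∈ QiSet a b T, 0 < u p.1 p.2 := fun p hp =>
    hu.pos p.1 hp.1 p.2 (Ioc_subset_Icc_self hp.2)
  have hQc : ContinuousOn (fun p : ℝ × ℝ => u p.1 p.2) (QiSet a b T) :=
    hu.cont.mono (Set.prod_mono Ioo_subset_Icc_self Ioc_subset_Icc_self)
  have hHc : ∀ j, ContinuousOn (truncH α (ε j)) (Ioi 0) := fun j s hs =>
    (hasDerivAt_truncH hs).continuousAt.continuousWithinAt
  have hGc : ∀ j, ContinuousOn (truncG α (ε j)) (Ioi 0) := fun j s hs =>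
    (hasDerivAt_truncG hs).continuousAt.continuousWithinAt
  have l1 : Tendsto (fun j => ∫ p in QiSet a b T, truncG' α (ε j) (u p.1 p.2) * ux p.1 p.2 ^ 2)
      atTop (𝓝 (∫ p in QiSet a b T, (α + 1) * u p.1 p.2 ^ α * ux p.1 p.2 ^ 2)) := by
    refine tendsto_integral_filter_of_dominated_convergence _ (Eventually.of_forall fun j =>
      (((continuousOn_truncG' α (ε j)).comp hQc hQpos).mul
        (hu.cont_x.pow 2)).aestronglyMeasurable hQm) (Eventually.of_forall fun j => ?_)
      (hint.const_mul (((α - 2) ^ 2 + |6 * α - 9| + 6) / (α + 1))) ?_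
    · filter_upwards [ae_restrict_mem hQm] with p hp
      rw [Real.norm_eq_abs, abs_mul, abs_of_nonneg (sq_nonneg (ux p.1 p.2)), ← mul_assoc]
      exact mul_le_mul_of_nonneg_right (abs_truncG'_le hα (hQpos p hp) (hε j).le) (sq_nonneg _)
    · filter_upwards [ae_restrict_mem hQm] with p hp
      exact (tendsto_truncG' hα (hQpos p hp) hε0).mul_const _
  have l2 : Tendsto (fun j => ∫ p in QiSet a b T, truncG α (ε j) (u p.1 p.2) * (1 - u p.1 p.2))
      atTop (𝓝 (∫ p in QiSet a b T, u p.1 p.2 ^ (α + 1) * (1 - u p.1 p.2))) := by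
    refine tendsto_setIntegral_of_bounded hQm (volume_QiSet_lt_top a b T)
      (Eventually.of_forall fun j => (((hGc j).comp hQc hQpos).mul
        (continuousOn_const.sub hQc)).aestronglyMeasurable hQm)
      (C := (|α - 2| + 3) / (α + 1) * M ^ (α + 1) * (1 + M))
      (Eventually.of_forall fun j p hp => ?_) fun p hp => ?_
    · have hp0 := hQpos p hp
      have hpM := hM p.1 hp.1 p.2 (Ioc_subset_Icc_self hp.2)
      rw [abs_mul]
      have h2 : |1 - u p.1 p.2| ≤ 1 + M := abs_le.2 ⟨by linarith, by linarith⟩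
      have h3 := abs_truncG_le hα hp0 (hε j).le
      have h4 : u p.1 p.2 ^ (α + 1) ≤ M ^ (α + 1) := by gcongr
      have h5 : 0 < M := hp0.trans_le hpM
      exact mul_le_mul (h3.trans (by gcongr)) h2 (abs_nonneg _) (by positivity)
    · exact (tendsto_truncG hα (hQpos p hp) hε0).mul_const _
  have l3 : ∀ t ∈ Icc 0 T, Tendsto (fun j => ∫ x in Ioo a b, truncH α (ε j) (u x t)) atTop
      (𝓝 (∫ x in Ioo a b, u x t ^ (α + 1) / (α + 1))) := by
    intro t ht
    refine tendsto_setIntegral_of_bounded measurableSet_Ioo (by simp)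
      (Eventually.of_forall fun j => ((hHc j).comp ((hu.cont.slice_left ht).mono
        Ioo_subset_Icc_self) fun x hx => hu.pos x hx t ht).aestronglyMeasurable measurableSet_Ioo)
      (C := M ^ (α + 1) / (α + 1)) (Eventually.of_forall fun j x hx => ?_) fun x hx => ?_
    · refine (abs_truncH_le hα (hu.pos x hx t ht) (hε j).le).trans ?_
      have := (hu.pos x hx t ht).le
      have := hM x hx t ht
      gcongr
    · exact tendsto_truncH (hu.pos x hx t ht) hε0
  refine tendsto_nhds_unique l1 ((((l3 0 (left_mem_Icc.2 hT.le)).sub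
    (l3 T (right_mem_Icc.2 hT.le))).add l2).congr fun j => (hE j).symm)

/-! ### Convergence of the derivatives -/

theorem tendsto_setIntegral_deriv_mul {c d τ T C : ℝ} (hcd : c ≤ d) {W W' : ℕ → ℝ × ℝ → ℝ}
    {w w' f f' : ℝ × ℝ → ℝ}
    (hW : ∀ᶠ n in atTop, ContinuousOn (W n) (Icc c d ×ˢ Icc τ T) ∧
      ContinuousOn (W' n) (Icc c d ×ˢ Icc τ T) ∧
      ∀ x ∈ Ioo c d, ∀ t ∈ Ioc τ T, HasDerivAt (fun y => W n (y, t)) (W' n (x, t)) x)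
    (hw : ContinuousOn w (Icc c d ×ˢ Icc τ T)) (hw' : ContinuousOn w' (Icc c d ×ˢ Icc τ T))
    (hwd : ∀ x ∈ Ioo c d, ∀ t ∈ Ioc τ T, HasDerivAt (fun y => w (y, t)) (w' (x, t)) x)
    (hf : ContinuousOn f (Icc c d ×ˢ Icc τ T)) (hf' : ContinuousOn f' (Icc c d ×ˢ Icc τ T))
    (hfd : ∀ x ∈ Ioo c d, ∀ t ∈ Ioc τ T, HasDerivAt (fun y => f (y, t)) (f' (x, t)) x)
    (hC : ∀ᶠ n in atTop, ∀ p ∈ Icc c d ×ˢ Icc τ T, |W n p| ≤ C)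
    (hlim : ∀ p ∈ Icc c d ×ˢ Icc τ T, Tendsto (fun n => W n p) atTop (𝓝 (w p))) :
    Tendsto (fun n => ∫ p in Ioo c d ×ˢ Ioc τ T, W' n p * f p) atTop
      (𝓝 (∫ p in Ioo c d ×ˢ Ioc τ T, w' p * f p)) := by
  have hparts : ∀ z z' : ℝ × ℝ → ℝ, ContinuousOn z (Icc c d ×ˢ Icc τ T) →
      ContinuousOn z' (Icc c d ×ˢ Icc τ T) →
      (∀ x ∈ Ioo c d, ∀ t ∈ Ioc τ T, HasDerivAt (fun y => z (y, t)) (z' (x, t)) x) →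
      (∫ t in Ioc τ T, (z (d, t) * f (d, t) - z (c, t) * f (c, t)))
        - (∫ p in Ioo c d ×ˢ Ioc τ T, z p * f' p)
        = ∫ p in Ioo c d ×ˢ Ioc τ T, z' p * f p := by
    intro z z' hz hz' hzd
    have h := setIntegral_rect_deriv_fst hcd (Φ := fun p => z p * f p)
      (Φ' := fun p => z' p * f p + z p * f' p) (hz.mul hf) ((hz'.mul hf).add (hz.mul hf'))
      fun x hx t ht => (hzd x hx t ht).mul (hfd x hx t ht)
    have e : ∫ p in Ioo c d ×ˢ Ioc τ T, (z' p * f p + z p * f' p)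
        = (∫ p in Ioo c d ×ˢ Ioc τ T, z' p * f p) + ∫ p in Ioo c d ×ˢ Ioc τ T, z p * f' p :=
      integral_add (hz'.mul hf).integrableOn_rect (hz.mul hf').integrableOn_rect
    rw [e] at h
    linarith
  obtain ⟨Cf, hCf⟩ := (isCompact_Icc.prod isCompact_Icc).exists_bound_of_continuousOn hf
  obtain ⟨Cf', hCf'⟩ := (isCompact_Icc.prod isCompact_Icc).exists_bound_of_continuousOn hf'
  have hR : Ioo c d ×ˢ Ioc τ T ⊆ Icc c d ×ˢ Icc τ T :=
    Set.prod_mono Ioo_subset_Icc_self Ioc_subset_Icc_self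
  have hRm : MeasurableSet (Ioo c d ×ˢ Ioc τ T) := measurableSet_Ioo.prod measurableSet_Ioc
  have hRv : volume (Ioo c d ×ˢ Ioc τ T) < ⊤ :=
    (measure_mono hR).trans_lt (isCompact_Icc.prod isCompact_Icc).measure_lt_top
  have l1 : Tendsto (fun n => ∫ p in Ioo c d ×ˢ Ioc τ T, W n p * f' p) atTop
      (𝓝 (∫ p in Ioo c d ×ˢ Ioc τ T, w p * f' p)) := by
    refine tendsto_setIntegral_of_bounded hRm hRv ?_ (C := C * Cf') ?_
      fun p hp => (hlim p (hR hp)).mul_const _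
    · filter_upwards [hW] with n hn
      exact ((hn.1.mul hf').mono hR).aestronglyMeasurable hRm
    · filter_upwards [hC] with n hn p hp
      rw [abs_mul]
      exact mul_le_mul (hn p (hR hp)) (hCf' p (hR hp)) (abs_nonneg _)
        ((abs_nonneg _).trans (hn p (hR hp)))
  have l2 : Tendsto (fun n => ∫ t in Ioc τ T, (W n (d, t) * f (d, t) - W n (c, t) * f (c, t)))
      atTop (𝓝 (∫ t in Ioc τ T, (w (d, t) * f (d, t) - w (c, t) * f (c, t)))) := by
    have hdm : ∀ t ∈ Ioc τ T, (d, t) ∈ Icc c d ×ˢ Icc τ T := fun t ht =>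
      ⟨right_mem_Icc.2 hcd, Ioc_subset_Icc_self ht⟩
    have hcm : ∀ t ∈ Ioc τ T, (c, t) ∈ Icc c d ×ˢ Icc τ T := fun t ht =>
      ⟨left_mem_Icc.2 hcd, Ioc_subset_Icc_self ht⟩
    refine tendsto_setIntegral_of_bounded measurableSet_Ioc (by simp) ?_ (C := C * Cf + C * Cf) ?_
      fun t ht => ((hlim _ (hdm t ht)).mul_const _).sub ((hlim _ (hcm t ht)).mul_const _)
    · filter_upwards [hW] with n hn
      exact ((((hn.1.mul hf).slice_right (right_mem_Icc.2 hcd)).sub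
        ((hn.1.mul hf).slice_right (left_mem_Icc.2 hcd))).mono
          Ioc_subset_Icc_self).aestronglyMeasurable measurableSet_Ioc
    · filter_upwards [hC] with n hn t ht
      have key : ∀ p ∈ Icc c d ×ˢ Icc τ T, |W n p * f p| ≤ C * Cf := fun p hp => by
        rw [abs_mul]
        exact mul_le_mul (hn p hp) (hCf p hp) (abs_nonneg _) ((abs_nonneg _).trans (hn p hp))
      exact (abs_sub _ _).trans (add_le_add (key _ (hdm t ht)) (key _ (hcm t ht)))
  rw [← hparts w w' hw hw' hwd]
  refine (l2.sub l1).congr' ?_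
  filter_upwards [hW] with n hn
  exact hparts (W n) (W' n) hn.1 hn.2.1 hn.2.2

/-- Boundary terms weighted by `c ^ (α + 1)` vanish as `c → 0`, since they are bounded when
weighted by a smaller power of `c`. -/
theorem tendsto_rpow_mul_of_bounded {α β K : ℝ} (hβα : β < α) {B : ℕ → ℝ}
    (hB : ∀ᶠ n in atTop, 0 ≤ B n)
    (hK : ∀ᶠ n : ℕ in atTop, (1 / (n : ℝ)) ^ (β + 1) * B n ≤ K) :
    Tendsto (fun n : ℕ => (1 / (n : ℝ)) ^ (α + 1) * B n) atTop (𝓝 0) := by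
  have h0 : Tendsto (fun n : ℕ => (1 / (n : ℝ)) ^ (α - β) * K) atTop (𝓝 0) := by
    have h1 := (tendsto_one_div_atTop_nhds_zero_nat (𝕜 := ℝ)).rpow_const
      (p := α - β) (Or.inr (by linarith))
    rw [Real.zero_rpow (by linarith)] at h1
    simpa using h1.mul_const K
  refine squeeze_zero' ?_ ?_ h0
  · filter_upwards [hB] with n hn
    positivity
  · filter_upwards [hK, eventually_gt_atTop 0] with n hn hn0
    have hn' : (0:ℝ) < 1 / (n : ℝ) := by positivity
    rw [show α + 1 = (α - β) + (β + 1) by ring, Real.rpow_add hn', mul_assoc]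
    gcongr

theorem rpow_deriv_sq {α s v : ℝ} (hs : 0 < s) :
    ((α + 2) / 2 * s ^ ((α + 2) / 2 - 1) * v) ^ 2 = ((α + 2) / 2) ^ 2 * (s ^ α * v ^ 2) := by
  have : (s ^ ((α + 2) / 2 - 1)) ^ 2 = s ^ α := by
    rw [← Real.rpow_natCast, ← Real.rpow_mul hs.le]
    congr 1; push_cast; ring
  rw [mul_pow, mul_pow, this]; ring

theorem derivWithin_rpow {a b x v q : ℝ} {f : ℝ → ℝ} (hab : a < b) (hx : x ∈ Icc a b)
    (hf : HasDerivWithinAt f v (Icc a b) x) (hpos : 0 < f x) :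
    derivWithin (fun y => f y ^ q) (Icc a b) x = q * f x ^ (q - 1) * v := by
  have := (hf.rpow_const (p := q) (Or.inl hpos.ne')).derivWithin (uniqueDiffOn_Icc hab x hx)
  rw [this]; ring


theorem IsSmoothSol.rpow_cont {c d τ T : ℝ} {u ux uxx : ℝ → ℝ → ℝ}
    (hu : IsSmoothSol c d τ T u ux uxx) (r : ℝ) :
    ContinuousOn (fun p : ℝ × ℝ => u p.1 p.2 ^ r) (Icc c d ×ˢ Icc τ T) :=
  hu.comp_cont fun s hs => (Real.continuousAt_rpow_const s r
    (Or.inl (ne_of_gt hs))).continuousWithinAt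

theorem IsSmoothSol.rpow_deriv_cont {c d τ T : ℝ} {u ux uxx : ℝ → ℝ → ℝ}
    (hu : IsSmoothSol c d τ T u ux uxx) (q : ℝ) :
    ContinuousOn (fun p : ℝ × ℝ => q * u p.1 p.2 ^ (q - 1) * ux p.1 p.2)
      (Icc c d ×ˢ Icc τ T) :=
  (continuousOn_const.mul (hu.rpow_cont (q - 1))).mul hu.cont_x

theorem IsSmoothSol.rpow_hasDerivAt {c d τ T : ℝ} {u ux uxx : ℝ → ℝ → ℝ}
    (hu : IsSmoothSol c d τ T u ux uxx) (q : ℝ) :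
    ∀ x ∈ Ioo c d, ∀ t ∈ Ioc τ T,
      HasDerivAt (fun y => u y t ^ q) (q * u x t ^ (q - 1) * ux x t) x := by
  intro x hx t ht
  have h := (hu.deriv_x x hx t ht).rpow_const (p := q)
    (Or.inl (hu.pos x (Ioo_subset_Icc_self hx) t (Ioc_subset_Icc_self ht)).ne')
  convert h using 1
  ring

theorem IsSmoothSol.mono {a b σ c d τ T : ℝ} {u ux uxx : ℝ → ℝ → ℝ}
    (hu : IsSmoothSol a b σ T u ux uxx) (hac : a ≤ c) (hcd : c < d) (hdb : d ≤ b)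
    (hστ : σ ≤ τ) (hτ : τ < T) : IsSmoothSol c d τ T u ux uxx := by
  have hsub : Icc c d ×ˢ Icc τ T ⊆ Icc a b ×ˢ Icc σ T :=
    Set.prod_mono (Icc_subset_Icc hac hdb) (Icc_subset_Icc_left hστ)
  exact ⟨hcd, hτ, hu.cont.mono hsub, hu.cont_x.mono hsub, hu.cont_xx.mono hsub,
    fun x hx t ht => hu.pos x (Icc_subset_Icc hac hdb hx) t (Icc_subset_Icc_left hστ ht),
    fun x hx t ht => hu.deriv_x x (Ioo_subset_Ioo hac hdb hx) t (Ioc_subset_Ioc_left hστ ht),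
    fun x hx t ht => hu.deriv_xx x (Ioo_subset_Ioo hac hdb hx) t (Ioc_subset_Ioc_left hστ ht),
    fun x hx t ht => hu.deriv_t x (Ioo_subset_Ioo hac hdb hx) t (Ioo_subset_Ioo_left hστ ht)⟩

theorem tendsto_pairing_rpow {c d τ T q M : ℝ} {U v w : ℕ → ℝ → ℝ → ℝ} {u ux uxx : ℝ → ℝ → ℝ}
    (hq : 0 ≤ q) (hU : ∀ᶠ n in atTop, IsSmoothSol c d τ T (U n) (v n) (w n))
    (hu : IsSmoothSol c d τ T u ux uxx)
    (hM : ∀ᶠ n in atTop, ∀ x ∈ Icc c d, ∀ t ∈ Icc τ T, U n x t ≤ M)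
    (hlim : ∀ x ∈ Icc c d, ∀ t ∈ Icc τ T, Tendsto (fun n => U n x t) atTop (𝓝 (u x t))) :
    Tendsto (fun n => ∫ p in Ioo c d ×ˢ Ioc τ T, (q * U n p.1 p.2 ^ (q - 1) * v n p.1 p.2)
        * (q * u p.1 p.2 ^ (q - 1) * ux p.1 p.2)) atTop
      (𝓝 (∫ p in Ioo c d ×ˢ Ioc τ T, (q * u p.1 p.2 ^ (q - 1) * ux p.1 p.2) ^ 2)) := by
  simp_rw [sq]
  refine tendsto_setIntegral_deriv_mul hu.lt.le (C := M ^ q)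
    (W := fun n p => U n p.1 p.2 ^ q) (w := fun p => u p.1 p.2 ^ q)
    (W' := fun n p => q * U n p.1 p.2 ^ (q - 1) * v n p.1 p.2)
    (w' := fun p => q * u p.1 p.2 ^ (q - 1) * ux p.1 p.2)
    (f := fun p => q * u p.1 p.2 ^ (q - 1) * ux p.1 p.2)
    (f' := fun p => q * ((q - 1) * u p.1 p.2 ^ (q - 1 - 1) * ux p.1 p.2) * ux p.1 p.2
      + q * u p.1 p.2 ^ (q - 1) * uxx p.1 p.2)
    ?_ (hu.rpow_cont q) (hu.rpow_deriv_cont q) (hu.rpow_hasDerivAt q) (hu.rpow_deriv_cont q)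
    ?_ ?_ ?_ ?_
  · filter_upwards [hU] with n hn
    exact ⟨hn.rpow_cont q, hn.rpow_deriv_cont q, hn.rpow_hasDerivAt q⟩
  · exact ((continuousOn_const.mul (hu.rpow_deriv_cont (q - 1))).mul hu.cont_x).add
      ((continuousOn_const.mul (hu.rpow_cont (q - 1))).mul hu.cont_xx)
  · intro x hx t ht
    exact ((hu.rpow_hasDerivAt (q - 1) x hx t ht).const_mul q).mul (hu.deriv_xx x hx t ht)
  · filter_upwards [hU, hM] with n hn hnM p hp
    have hp0 := (hn.pos p.1 hp.1 p.2 hp.2).le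
    rw [abs_of_nonneg (Real.rpow_nonneg hp0 q)]
    exact Real.rpow_le_rpow hp0 (hnM p.1 hp.1 p.2 hp.2) hq
  · intro p hp
    exact (hlim p.1 hp.1 p.2 hp.2).rpow_const (Or.inr hq)

section Convergence

variable {a b T α M : ℝ} {U v : ℕ → ℝ → ℝ → ℝ} {u ux uxx : ℝ → ℝ → ℝ}

theorem IsApproxReg.integral_sq {c : ℝ} {u v : ℝ → ℝ → ℝ} (hc : 0 < c)
    (hu : IsApproxReg a b T c u v) (hα : -1 < α) :
    4 * (α + 1) / (α + 2) ^ 2 * ∫ p in QiSet a b T,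
        ((α + 2) / 2 * u p.1 p.2 ^ ((α + 2) / 2 - 1) * v p.1 p.2) ^ 2
      = ∫ p in QiSet a b T, (α + 1) * u p.1 p.2 ^ α * v p.1 p.2 ^ 2 := by
  have hα2 : α + 2 ≠ 0 := by linarith
  rw [← integral_const_mul]
  refine setIntegral_congr_fun (measurableSet_QiSet a b T) fun p hp => ?_
  have hp0 := hc.trans_le (hu.ge p.1 (Ioo_subset_Icc_self hp.1) p.2 (Ioc_subset_Icc_self hp.2))
  simp only [rpow_deriv_sq hp0]
  field_simp
  ring

theorem IsDegReg.integral_sq (hu : IsDegReg a b T u ux uxx) (hα : -1 < α) :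
    4 * (α + 1) / (α + 2) ^ 2 * ∫ p in QiSet a b T,
        ((α + 2) / 2 * u p.1 p.2 ^ ((α + 2) / 2 - 1) * ux p.1 p.2) ^ 2
      = ∫ p in QiSet a b T, (α + 1) * u p.1 p.2 ^ α * ux p.1 p.2 ^ 2 := by
  have hα2 : α + 2 ≠ 0 := by linarith
  rw [← integral_const_mul]
  refine setIntegral_congr_fun (measurableSet_QiSet a b T) fun p hp => ?_
  have hp0 := hu.pos p.1 hp.1 p.2 (Ioc_subset_Icc_self hp.2)
  simp only [rpow_deriv_sq hp0]
  field_simp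
  ring

theorem tendsto_integral_sq (hab : a < b) (hT : 0 < T) (hα : -1 < α)
    (hU : ∀ n : ℕ, 0 < n → IsApproxReg a b T (1 / (n : ℝ)) (U n) (v n))
    (hM : ∀ n : ℕ, 0 < n → ∀ x ∈ Icc a b, ∀ t ∈ Icc 0 T, U n x t ≤ M)
    (hlim : ∀ x ∈ Icc a b, ∀ t ∈ Icc 0 T, Tendsto (fun n => U n x t) atTop (𝓝 (u x t))) :
    Tendsto (fun n => ∫ p in QiSet a b T, (α + 1) * U n p.1 p.2 ^ α * v n p.1 p.2 ^ 2) atTop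
      (𝓝 (energyData a b T α u)) := by
  have hn0 : ∀ n : ℕ, 0 < n → (0:ℝ) < 1 / (n : ℝ) := fun n hn => by positivity
  have hdata : ∀ β : ℝ, -1 < β →
      Tendsto (fun n => energyData a b T β (U n)) atTop (𝓝 (energyData a b T β u)) := by
    intro β hβ
    refine tendsto_energyData (M := M) hT hβ ?_ ?_ hlim
    · filter_upwards [eventually_gt_atTop 0] with n hn using (hU n hn).cont
    · filter_upwards [eventually_gt_atTop 0] with n hn x hx t ht
      exact ⟨(hn0 n hn).le.trans ((hU n hn).ge x hx t ht), hM n hn x hx t ht⟩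
  have hB : ∀ n : ℕ, 0 < n → 0 ≤ ∫ t in Ioc 0 T, (v n a t - v n b t) := fun n hn =>
    setIntegral_nonneg measurableSet_Ioc fun t ht => by
      linarith [(hU n hn).deriv_left t ht, (hU n hn).deriv_right t ht]
  obtain ⟨K, hK⟩ := (hdata ((α - 1) / 2) (by linarith)).bddAbove_range
  have hbdry : Tendsto (fun n : ℕ => (1 / (n : ℝ)) ^ (α + 1) *
      ∫ t in Ioc 0 T, (v n a t - v n b t)) atTop (𝓝 0) := by
    refine tendsto_rpow_mul_of_bounded (β := (α - 1) / 2) (K := K) (by linarith) ?_ ?_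
    · filter_upwards [eventually_gt_atTop 0] with n hn using hB n hn
    · filter_upwards [eventually_gt_atTop 0] with n hn
      have hE := ((hU n hn).energy hab hT (hn0 n hn) (α := (α - 1) / 2) (by linarith)).2.2
      have hle : energyData a b T ((α - 1) / 2) (U n) ≤ K := hK (mem_range_self n)
      have hnn : 0 ≤ ∫ p in QiSet a b T,
          ((α - 1) / 2 + 1) * U n p.1 p.2 ^ ((α - 1) / 2) * v n p.1 p.2 ^ 2 :=
        setIntegral_nonneg (measurableSet_QiSet a b T) fun p hp => by
          have hp0 := (hn0 n hn).trans_le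
            ((hU n hn).ge p.1 (Ioo_subset_Icc_self hp.1) p.2 (Ioc_subset_Icc_self hp.2))
          have : 0 ≤ (α - 1) / 2 + 1 := by linarith
          positivity
      linarith
  have h := (hdata α hα).sub hbdry
  rw [sub_zero] at h
  refine h.congr' ?_
  filter_upwards [eventually_gt_atTop 0] with n hn
  linarith [((hU n hn).energy hab hT (hn0 n hn) hα).2.2]

theorem IsDegReg.tendsto_deriv (hab : a < b) (hT : 0 < T) (hα : -1 < α)
    (hU : ∀ n : ℕ, 0 < n → IsApproxReg a b T (1 / (n : ℝ)) (U n) (v n))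
    (hM : ∀ n : ℕ, 0 < n → ∀ x ∈ Icc a b, ∀ t ∈ Icc 0 T, U n x t ≤ M)
    (hlim : ∀ x ∈ Icc a b, ∀ t ∈ Icc 0 T, Tendsto (fun n => U n x t) atTop (𝓝 (u x t)))
    (hu : IsDegReg a b T u ux uxx) :
    IntegrableOn (fun p : ℝ × ℝ =>
        ((α + 2) / 2 * u p.1 p.2 ^ ((α + 2) / 2 - 1) * ux p.1 p.2) ^ 2) (QiSet a b T) ∧
      Tendsto (fun n => ∫ p in QiSet a b T,
        ((α + 2) / 2 * U n p.1 p.2 ^ ((α + 2) / 2 - 1) * v n p.1 p.2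
          - (α + 2) / 2 * u p.1 p.2 ^ ((α + 2) / 2 - 1) * ux p.1 p.2) ^ 2) atTop (𝓝 0) := by
  have hα1 : 0 < α + 1 := by linarith
  have hα2 : 0 < α + 2 := by linarith
  have hκ : 0 < 4 * (α + 1) / (α + 2) ^ 2 := by positivity
  have hQm := measurableSet_QiSet a b T
  have hn0 : ∀ n : ℕ, 0 < n → (0:ℝ) < 1 / (n : ℝ) := fun n hn => by positivity
  have hQ : QiSet a b T ⊆ Icc a b ×ˢ Icc 0 T :=
    Set.prod_mono Ioo_subset_Icc_self Ioc_subset_Icc_self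
  have hUpos : ∀ n : ℕ, 0 < n → ∀ p ∈ QiSet a b T, 0 < U n p.1 p.2 := fun n hn p hp =>
    (hn0 n hn).trans_le ((hU n hn).ge p.1 (hQ hp).1 p.2 (hQ hp).2)
  have hupos : ∀ p ∈ QiSet a b T, 0 < u p.1 p.2 := fun p hp => hu.pos p.1 hp.1 p.2 (hQ hp).2
  obtain ⟨c, d, τ, hcdτ, hca, hdb, hτ0⟩ := exists_exhaustion hab hT
  have hs : ∀ k, IsSmoothSol (c k) (d k) (τ k) T u ux uxx := fun k =>
    hu.smooth (c k) (d k) (τ k) (hcdτ k).1 (hcdτ k).2.1 (hcdτ k).2.2.1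
      (hcdτ k).2.2.2.1 (hcdτ k).2.2.2.2
  have hw : ∀ n : ℕ, ∃ w, 0 < n → ∀ σ, 0 < σ → σ < T → IsSmoothSol a b σ T (U n) (v n) w := by
    intro n
    by_cases hn : 0 < n
    · exact (hU n hn).smooth.imp fun w hw _ => hw
    · exact ⟨0, fun h => absurd h hn⟩
  choose w hw using hw
  have hA := (tendsto_integral_sq hab hT hα hU hM hlim).div_const (4 * (α + 1) / (α + 2) ^ 2)
  have key := integrableOn_sq_of_local_pairing (μ := volume) (Q := QiSet a b T)
    (S := fun k => Ioo (c k) (d k) ×ˢ Ioc (τ k) T)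
    (F := fun n p => (α + 2) / 2 * U n p.1 p.2 ^ ((α + 2) / 2 - 1) * v n p.1 p.2)
    (f := fun p => (α + 2) / 2 * u p.1 p.2 ^ ((α + 2) / 2 - 1) * ux p.1 p.2)
    (A := energyData a b T α u / (4 * (α + 1) / (α + 2) ^ 2))
    hQm (fun k => measurableSet_Ioo.prod measurableSet_Ioc)
    (fun k => exhaustion_subset (hcdτ k).1.le (hcdτ k).2.2.1.le (hcdτ k).2.2.2.1.le)
    (exhaustion_eventually_mem hca hdb hτ0) ?_ ?_ ?_ ?_ ?_ ?_
  · refine ⟨key.1, key.2 (le_of_eq ?_)⟩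
    have hint : IntegrableOn (fun p : ℝ × ℝ => u p.1 p.2 ^ α * ux p.1 p.2 ^ 2) (QiSet a b T) := by
      refine IntegrableOn.congr_fun (key.1.const_mul ((((α + 2) / 2) ^ 2)⁻¹)) (fun p hp => ?_) hQm
      simp only [rpow_deriv_sq (hupos p hp)]
      field_simp
    rw [div_eq_iff hκ.ne', mul_comm, hu.integral_sq hα]
    refine (hu.energy hab hT hα (M := M) (fun x hx t ht => ?_) hint).symm
    refine le_of_tendsto (hlim x (Ioo_subset_Icc_self hx) t ht) ?_
    filter_upwards [eventually_gt_atTop 0] with n hn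
    exact hM n hn x (Ioo_subset_Icc_self hx) t ht
  · filter_upwards [eventually_gt_atTop 0] with n hn
    refine ContinuousOn.aestronglyMeasurable ?_ hQm
    refine (continuousOn_const.mul (((hU n hn).cont.mono hQ).rpow_const
      fun p hp => Or.inl (hUpos n hn p hp).ne')).mul ((hU n hn).cont_x.mono ?_)
    exact Set.prod_mono Ioo_subset_Icc_self Subset.rfl
  · refine ContinuousOn.aestronglyMeasurable ?_ hQm
    exact (continuousOn_const.mul ((hu.cont.mono hQ).rpow_const
      fun p hp => Or.inl (hupos p hp).ne')).mul hu.cont_x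
  · filter_upwards [eventually_gt_atTop 0] with n hn
    refine IntegrableOn.congr_fun (((hU n hn).energy hab hT (hn0 n hn) hα).1.const_mul
      ((α + 2) ^ 2 / (4 * (α + 1)))) (fun p hp => ?_) hQm
    simp only [rpow_deriv_sq (hUpos n hn p hp)]
    field_simp
    ring
  · intro k
    exact ((hs k).rpow_deriv_cont _).pow 2 |>.integrableOn_rect
  · refine hA.congr' ?_
    filter_upwards [eventually_gt_atTop 0] with n hn
    rw [div_eq_iff hκ.ne', mul_comm, (hU n hn).integral_sq (hn0 n hn) hα]
  · intro k
    obtain ⟨h1, h2, h3, h4, h5⟩ := hcdτ k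
    have hx : Icc (c k) (d k) ⊆ Icc a b := Icc_subset_Icc h1.le h3.le
    have ht : Icc (τ k) T ⊆ Icc 0 T := Icc_subset_Icc_left h4.le
    refine tendsto_pairing_rpow (M := M) (w := w) (by positivity) ?_ (hs k) ?_
      fun x hx' t ht' => hlim x (hx hx') t (ht ht')
    · filter_upwards [eventually_gt_atTop 0] with n hn
      exact (hw n hn (τ k) h4 h5).mono h1.le h2 h3.le le_rfl h5
    · filter_upwards [eventually_gt_atTop 0] with n hn x hx' t ht'
      exact hM n hn x (hx hx') t (ht ht')

end Convergence

/-- Lemma 8.2, estimates (8.49) and (8.50): uniform energy estimates for `u_{i,n}`,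
membership `u_i^{(α+2)/2} ∈ L²(0,T;H¹)`, and `L²` convergence of the spatial derivatives
of `u_{i,n}^{(α+2)/2}` to those of `u_i^{(α+2)/2}`. -/
theorem stmt15 (xi xip T : ℝ) (h : xi < xip) (hT : 0 < T)
    (u₀ : ℝ → ℝ) (h₀c : ContinuousOn u₀ (Set.Icc xi xip))
    (h₀pos : ∀ x ∈ Set.Ioo xi xip, 0 < u₀ x)
    (h₀i : u₀ xi = 0) (h₀ip : u₀ xip = 0)
    (uin : ℕ → ℝ → ℝ → ℝ)
    (huin : ∀ n : ℕ, 0 < n →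
      IsApproxSol xi xip T (1 / (n:ℝ)) (fun x => u₀ x + 1 / (n:ℝ)) (uin n))
    (hdec : ∀ n : ℕ, 0 < n → ∀ x ∈ Set.Icc xi xip, ∀ t ∈ Set.Icc (0:ℝ) T,
      uin (n + 1) x t ≤ uin n x t)
    (ui : ℝ → ℝ → ℝ)
    (hlim : ∀ x ∈ Set.Icc xi xip, ∀ t ∈ Set.Icc (0:ℝ) T,
      Tendsto (fun n => uin n x t) atTop (𝓝 (ui x t)))
    (hui : IsDegSol xi xip T u₀ ui)
    (α : ℝ) (hα : -1 < α) :
    (∃ K > (0:ℝ), ∀ n : ℕ, 0 < n →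
      4 * (α + 1) / (α + 2) ^ 2 *
          (∫ p in QiSet xi xip T,
            (derivWithin (fun y => uin n y p.2 ^ ((α + 2) / 2))
              (Set.Icc xi xip) p.1) ^ 2)
        + (∫ t in (0:ℝ)..T, (n : ℝ) ^ (-(α + 1)) *
            (|derivWithin (fun y => uin n y t) (Set.Icc xi xip) xip|
              + |derivWithin (fun y => uin n y t) (Set.Icc xi xip) xi|)) ≤ K) ∧
    MeasureTheory.IntegrableOn
      (fun p : ℝ × ℝ => (ui p.1 p.2 ^ ((α + 2) / 2)) ^ 2) (QiSet xi xip T) volume ∧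
    MeasureTheory.IntegrableOn
      (fun p : ℝ × ℝ =>
        (derivWithin (fun y => ui y p.2 ^ ((α + 2) / 2)) (Set.Icc xi xip) p.1) ^ 2)
      (QiSet xi xip T) volume ∧
    Tendsto (fun n : ℕ =>
        ∫ p in QiSet xi xip T,
          (derivWithin (fun y => uin n y p.2 ^ ((α + 2) / 2)) (Set.Icc xi xip) p.1
            - derivWithin (fun y => ui y p.2 ^ ((α + 2) / 2)) (Set.Icc xi xip) p.1) ^ 2)
      atTop (𝓝 0) := by
  have hn0 : ∀ n : ℕ, 0 < n → (0:ℝ) < 1 / (n : ℝ) := fun n hn => by positivity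
  have hQm := measurableSet_QiSet xi xip T
  have hanti : ∀ m : ℕ, 0 < m → ∀ n, m ≤ n → ∀ x ∈ Icc xi xip, ∀ t ∈ Icc (0:ℝ) T,
      uin n x t ≤ uin m x t := by
    intro m hm n hmn x hx t ht
    induction n, hmn using Nat.le_induction with
    | base => exact le_rfl
    | succ k hk ih => exact (hdec k (hm.trans_le hk) x hx t ht).trans ih
  have hle : ∀ n : ℕ, 0 < n → ∀ x ∈ Icc xi xip, ∀ t ∈ Icc (0:ℝ) T, ui x t ≤ uin n x t :=
    fun n hn x hx t ht => le_of_tendsto (hlim x hx t ht)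
      ((eventually_ge_atTop n).mono fun k hk => hanti n hn k hk x hx t ht)
  obtain ⟨ux, uxx, hreg⟩ := hui.exists_reg h h₀pos h₀i h₀ip
  have h₀nn : ∀ x ∈ Icc xi xip, 0 ≤ u₀ x := by
    intro x hx
    rcases hx.1.eq_or_lt with rfl | h1
    · exact h₀i.ge
    rcases hx.2.eq_or_lt with rfl | h2
    · exact h₀ip.ge
    exact (h₀pos x ⟨h1, h2⟩).le
  have hpos : ∀ n : ℕ, 0 < n → ∀ x ∈ Icc xi xip, ∀ t ∈ Icc (0:ℝ) T, 0 < uin n x t := by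
    intro n hn x hx t ht
    rcases ht.1.eq_or_lt with rfl | ht0
    · rw [(huin n hn).2.2.1 x hx]
      linarith [h₀nn x hx, hn0 n hn]
    have hb := (huin n hn).2.1 t ⟨ht0, ht.2⟩
    rcases hx.1.eq_or_lt with rfl | h1
    · exact hb.1 ▸ hn0 n hn
    rcases hx.2.eq_or_lt with rfl | h2
    · exact hb.2 ▸ hn0 n hn
    exact (hreg.pos x ⟨h1, h2⟩ t ht).trans_le (hle n hn x hx t ht)
  obtain ⟨M, hM⟩ := (isCompact_Icc.prod isCompact_Icc).exists_bound_of_continuousOn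
    (huin 1 one_pos).1
  have hbound : ∀ n : ℕ, 0 < n → ∀ x ∈ Icc xi xip, ∀ t ∈ Icc (0:ℝ) T, uin n x t ≤ M :=
    fun n hn x hx t ht => (hanti 1 one_pos n hn x hx t ht).trans
      ((le_abs_self _).trans (hM (x, t) ⟨hx, ht⟩))
  have hv : ∀ n : ℕ, ∃ v, 0 < n → IsApproxReg xi xip T (1 / (n : ℝ)) (uin n) v := by
    intro n
    by_cases hn : 0 < n
    · obtain ⟨v, hv⟩ := (huin n hn).exists_reg h hT
        ((div_le_one (by positivity)).2 (by exact_mod_cast hn))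
        (fun x hx => by linarith [h₀nn x hx]) (hpos n hn)
      exact ⟨v, fun _ => hv⟩
    · exact ⟨0, fun h => absurd h hn⟩
  choose v hv using hv
  have hdn : ∀ n : ℕ, 0 < n → ∀ p ∈ QiSet xi xip T,
      derivWithin (fun y => uin n y p.2 ^ ((α + 2) / 2)) (Icc xi xip) p.1
        = (α + 2) / 2 * uin n p.1 p.2 ^ ((α + 2) / 2 - 1) * v n p.1 p.2 := fun n hn p hp =>
    derivWithin_rpow h (Ioo_subset_Icc_self hp.1)
      ((hv n hn).deriv_x p.1 (Ioo_subset_Icc_self hp.1) p.2 hp.2)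
      (hpos n hn p.1 (Ioo_subset_Icc_self hp.1) p.2 (Ioc_subset_Icc_self hp.2))
  have hdu : ∀ p ∈ QiSet xi xip T,
      derivWithin (fun y => ui y p.2 ^ ((α + 2) / 2)) (Icc xi xip) p.1
        = (α + 2) / 2 * ui p.1 p.2 ^ ((α + 2) / 2 - 1) * ux p.1 p.2 := fun p hp =>
    derivWithin_rpow h (Ioo_subset_Icc_self hp.1)
      (hreg.deriv_x p.1 hp.1 p.2 hp.2).hasDerivWithinAt
      (hreg.pos p.1 hp.1 p.2 (Ioc_subset_Icc_self hp.2))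
  obtain ⟨hsq, hconv⟩ := hreg.tendsto_deriv h hT hα hv hbound hlim
  refine ⟨?_, ?_, ?_, ?_⟩
  · have hdata : Tendsto (fun n => energyData xi xip T α (uin n)) atTop
        (𝓝 (energyData xi xip T α ui)) := by
      refine tendsto_energyData (M := M) hT hα ?_ ?_ hlim
      · filter_upwards [eventually_gt_atTop 0] with n hn using (huin n hn).1
      · filter_upwards [eventually_gt_atTop 0] with n hn x hx t ht
        exact ⟨(hpos n hn x hx t ht).le, hbound n hn x hx t ht⟩
    obtain ⟨K, hK⟩ := hdata.bddAbove_range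
    refine ⟨max K 1, by positivity, fun n hn => (le_of_eq ?_).trans
      ((hK (mem_range_self n)).trans (le_max_left K 1))⟩
    rw [← ((hv n hn).energy h hT (hn0 n hn) hα).2.2, ← (hv n hn).integral_sq (hn0 n hn) hα]
    congr 1
    · congr 1
      exact setIntegral_congr_fun hQm fun p hp => by simp only [hdn n hn p hp]
    · rw [intervalIntegral.integral_of_le hT.le, ← integral_const_mul]
      refine setIntegral_congr_fun measurableSet_Ioc fun t ht => ?_
      have hl := ((hv n hn).deriv_x xi (left_mem_Icc.2 h.le) t ht).derivWithin
        (uniqueDiffOn_Icc h xi (left_mem_Icc.2 h.le))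
      have hr := ((hv n hn).deriv_x xip (right_mem_Icc.2 h.le) t ht).derivWithin
        (uniqueDiffOn_Icc h xip (right_mem_Icc.2 h.le))
      simp only [hl, hr]
      rw [abs_of_nonneg ((hv n hn).deriv_left t ht), abs_of_nonpos ((hv n hn).deriv_right t ht),
        one_div, Real.inv_rpow n.cast_nonneg, Real.rpow_neg n.cast_nonneg]
      ring
  · exact ((hui.1.rpow_const fun _ _ => Or.inr (by linarith)).pow 2).integrableOn_rect
  · exact hsq.congr_fun (fun p hp => by simp only [hdu p hp]) hQm
  · refine hconv.congr' ?_
    filter_upwards [eventually_gt_atTop 0] with n hn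
    exact setIntegral_congr_fun hQm fun p hp => by simp only [hdn n hn p hp, hdu p hp]
end
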